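/- arXiv:1912.09687 — 2 statements merged into one kernel-verified Lean document; each statement's English description precedes it below -/
import Mathlib

section
/- Let k be an algebraically closed field of characteristic p > 0 and (H, ω) a symplectic k-vector space of dimension 2g. The group Sp(H, ω) acts on the set of symplectic zips on H by conjugation, τ·φ = τ∘φ∘τ^{-1}, and this action has exactly 2^g orbits; in particular, there are only finitely many isomorphism classes of symplectic zips on H. -/
/-!
STATEMENT 12: Let `k` be an algebraically closed field of characteristic `p > 0` and
`(H, ω)` a symplectic `k`-vector space of dimension `2g`. The group `Sp(H, ω)` acts on the
set of symplectic zips on `H` by conjugation `τ·φ = τ∘φ∘τ⁻¹`, and this action has exactly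
`2^g` orbits; in particular there are only finitely many isomorphism classes of symplectic
zips on `H`. (We express "exactly `2^g` orbits" by the existence of a surjection onto
`Fin (2^g)` whose fibers are exactly the conjugation orbits.)
-/

/-- The orthogonal complement `F^⊥ = {x ∈ H : ω x y = 0 for all y ∈ F}`. -/
def perp {k H : Type*} [Field k] [AddCommGroup H] [Module k H]
    (ω : H →ₗ[k] H →ₗ[k] k) (F : Submodule k H) : Submodule k H where
  carrier := {x | ∀ y ∈ F, ω x y = 0}
  add_mem' := by
    intro a b ha hb y hy
    simp only [map_add, LinearMap.add_apply, ha y hy, hb y hy, add_zero]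
  zero_mem' := by
    intro y hy
    simp
  smul_mem' := by
    intro c x hx y hy
    simp only [map_smul, LinearMap.smul_apply, hx y hy, smul_zero]

/-- A subspace is Lagrangian if it equals its own orthogonal complement. -/
def IsLagrangian {k H : Type*} [Field k] [AddCommGroup H] [Module k H]
    (ω : H →ₗ[k] H →ₗ[k] k) (F : Submodule k H) : Prop :=
  perp ω F = F

/-- Over a perfect field the Frobenius is surjective, so ranges of Frobenius-semilinear
maps are submodules. -/
instance frobeniusSurjective (k : Type*) [Field k] (p : ℕ) [Fact p.Prime] [CharP k p]
    [PerfectRing k p] : RingHomSurjective (frobenius k p) :=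
  ⟨surjective_frobenius k p⟩



namespace ZipOrb

/-- number of jumps below `s` -/
def cnt {g : ℕ} (J : Fin (2*g) → Bool) : ℕ → ℕ
  | 0 => 0
  | s+1 => cnt J s + (if h : s < 2*g then (if J ⟨s, h⟩ then 1 else 0) else 0)

/-- combinatorial types -/
structure ZT (g : ℕ) where
  J : Fin (2*g) → Bool
  hJ : ∀ i, J (Fin.rev i) = !(J i)

variable {g : ℕ}

lemma cnt_succ_true (J : Fin (2*g) → Bool) (i : Fin (2*g)) (h : J i = true) :
    cnt J (i.val+1) = cnt J i.val + 1 := by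
  simp [cnt, h]

lemma cnt_succ_false (J : Fin (2*g) → Bool) (i : Fin (2*g)) (h : J i = false) :
    cnt J (i.val+1) = cnt J i.val := by
  simp [cnt, h]

lemma cnt_step (J : Fin (2*g) → Bool) (s : ℕ) :
    cnt J s ≤ cnt J (s+1) ∧ cnt J (s+1) ≤ cnt J s + 1 := by
  rw [cnt]; split_ifs <;> omega

lemma cnt_mono (J : Fin (2*g) → Bool) {s t : ℕ} (h : s ≤ t) :
    cnt J s ≤ cnt J t ∧ cnt J t + s ≤ cnt J s + t := by
  induction t, h using Nat.le_induction with
  | base => omega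
  | succ t h ih => have := cnt_step J t; omega

lemma cnt_zero (J : Fin (2*g) → Bool) : cnt J 0 = 0 := rfl

lemma cnt_le (J : Fin (2*g) → Bool) (s : ℕ) : cnt J s ≤ s := by
  have := cnt_mono J (Nat.zero_le s); rw [cnt_zero] at this; omega

namespace ZT
variable (t : ZT g)

lemma cnt_aux (s : ℕ) (hs : s ≤ 2*g) : cnt t.J (2*g - s) + s = cnt t.J (2*g) + cnt t.J s := by
  induction s with
  | zero => simp [cnt_zero]
  | succ s ih =>
    have ih := ih (by omega)
    have h1 : s < 2*g := by omega
    have hr := t.hJ ⟨s, h1⟩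
    have e1 : (Fin.rev ⟨s, h1⟩ : Fin (2*g)).val = 2*g - (s+1) := by simp [Fin.val_rev]
    have e2 : 2*g - s = (Fin.rev ⟨s, h1⟩ : Fin (2*g)).val + 1 := by omega
    rw [e2] at ih
    cases hb : t.J ⟨s, h1⟩
    · rw [hb] at hr
      have a := cnt_succ_true t.J _ hr
      have b := cnt_succ_false t.J ⟨s, h1⟩ hb
      simp only at b
      rw [← e1, b]; omega
    · rw [hb] at hr
      have a := cnt_succ_false t.J _ hr
      have b := cnt_succ_true t.J ⟨s, h1⟩ hb
      simp only at b
      rw [← e1, b]; omega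

lemma cnt_top : cnt t.J (2*g) = g := by
  have := t.cnt_aux (2*g) le_rfl
  simp [cnt_zero] at this; omega

lemma cnt_rev (s : ℕ) (hs : s ≤ 2*g) : cnt t.J (2*g - s) + s = g + cnt t.J s := by
  have := t.cnt_aux s hs
  rw [t.cnt_top] at this; exact this

lemma cnt_le_g (s : ℕ) (hs : s ≤ 2*g) : cnt t.J s ≤ g := by
  have := cnt_mono t.J hs; rw [t.cnt_top] at this; omega

/-- the map on indices -/
def pf (i : Fin (2*g)) : Fin (2*g) :=
  ⟨if t.J i then cnt t.J i else g + (i - cnt t.J i), by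
    have h1 := i.2
    have h2 := cnt_mono t.J (show i.val + 1 ≤ 2*g from i.2)
    have h3 := t.cnt_top
    have h4 := cnt_le t.J i
    split_ifs with h
    · have := cnt_succ_true t.J i h; omega
    · have := cnt_succ_false t.J i (by simpa using h); omega⟩

lemma pf_true {i : Fin (2*g)} (h : t.J i = true) : (t.pf i).val = cnt t.J i := by simp [pf, h]
lemma pf_false {i : Fin (2*g)} (h : t.J i = false) : (t.pf i).val + cnt t.J i = g + i := by
  have h4 := cnt_le t.J i
  simp [pf, h]; omega

lemma pf_lt_cnt {i : Fin (2*g)} (h : t.J i = true) (s : ℕ) :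
    (t.pf i).val < cnt t.J s ↔ i.val < s := by
  rw [t.pf_true h]
  constructor
  · intro h1; by_contra h2
    have := cnt_mono t.J (not_lt.mp h2); omega
  · intro h1
    have := cnt_mono t.J (show i.val + 1 ≤ s from h1)
    have := cnt_succ_true t.J i h; omega

lemma pf_lt_nu {i : Fin (2*g)} (h : t.J i = false) (s : ℕ) :
    (t.pf i).val + cnt t.J s < g + s ↔ i.val < s := by
  have h0 := t.pf_false h
  constructor
  · intro h1; by_contra h2
    have := cnt_mono t.J (not_lt.mp h2); omega
  · intro h1
    have := cnt_mono t.J (show i.val + 1 ≤ s from h1)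
    have := cnt_succ_false t.J i h; omega

lemma pf_lt_g {i : Fin (2*g)} (h : t.J i = true) : (t.pf i).val < g := by
  have := (t.pf_lt_cnt h (2*g)).2 i.2; rwa [t.cnt_top] at this

lemma pf_ge_g {i : Fin (2*g)} (h : t.J i = false) : g ≤ (t.pf i).val := by
  have := t.pf_false h; have := cnt_le t.J i; omega

lemma pf_inj : Function.Injective t.pf := by
  intro i j hij
  have hv : (t.pf i).val = (t.pf j).val := by rw [hij]
  cases hi : t.J i <;> cases hj : t.J j
  · have a := t.pf_lt_nu hi j; have b := t.pf_lt_nu hj i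
    have c := t.pf_lt_nu hi i; have d := t.pf_lt_nu hj j
    apply Fin.ext
    have := t.pf_false hi; have := t.pf_false hj
    by_contra hne
    rcases Nat.lt_or_gt_of_ne hne with h | h
    · have := a.2 h; omega
    · have := b.2 h; omega
  · have := t.pf_ge_g hi; have := t.pf_lt_g hj; omega
  · have := t.pf_ge_g hj; have := t.pf_lt_g hi; omega
  · have a := t.pf_lt_cnt hi j; have b := t.pf_lt_cnt hj i
    apply Fin.ext
    have := t.pf_true hi; have := t.pf_true hj
    by_contra hne
    rcases Nat.lt_or_gt_of_ne hne with h | h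
    · have := a.2 h; omega
    · have := b.2 h; omega

/-- the permutation attached to a type -/
noncomputable def pi : Equiv.Perm (Fin (2*g)) :=
  Equiv.ofBijective t.pf (Finite.injective_iff_bijective.mp t.pf_inj)

@[simp] lemma pi_apply (i : Fin (2*g)) : t.pi i = t.pf i := rfl

lemma pi_rev (i : Fin (2*g)) : t.pf (Fin.rev i) = Fin.rev (t.pf i) := by
  apply Fin.ext
  have hr := t.hJ i
  have h1 := t.cnt_rev (i.val+1) i.2
  have e1 : (Fin.rev i).val = 2*g - (i.val+1) := by simp [Fin.val_rev]
  have e2 : (Fin.rev (t.pf i)).val = 2*g - ((t.pf i).val+1) := by simp [Fin.val_rev]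
  have := i.2
  rw [e2]
  cases hi : t.J i
  · rw [hi] at hr
    have := t.pf_true hr; have := t.pf_false hi
    have := cnt_succ_false t.J i hi
    rw [← e1] at h1
    omega
  · rw [hi] at hr
    have := t.pf_false hr; have := t.pf_true hi
    have := cnt_succ_true t.J i hi
    rw [← e1] at h1
    omega

lemma pf_lt_pf {i j : Fin (2*g)} (h : t.J i = t.J j) (hij : i < j) : t.pf i < t.pf j := by
  have hij' : i.val < j.val := hij
  show (t.pf i).val < (t.pf j).val
  cases hi : t.J i
  · have hj : t.J j = false := by rw [← h, hi]
    have := (t.pf_lt_nu hi j).2 hij'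
    have := t.pf_false hj; omega
  · have hj : t.J j = true := by rw [← h, hi]
    have := (t.pf_lt_cnt hi j).2 hij'
    rw [t.pf_true hj]; omega

lemma exists_pf_lt {s : ℕ} {i : Fin (2*g)} (hi : i.val < cnt t.J s) (hs : s ≤ 2*g) :
    ∃ l, t.J l = true ∧ l.val < s ∧ t.pf l = i := by
  obtain ⟨l, hl⟩ := t.pi.surjective i
  rw [pi_apply] at hl
  have h1 := t.cnt_le_g s hs
  cases hb : t.J l
  · have := t.pf_ge_g hb; rw [hl] at this; omega
  · exact ⟨l, hb, by rw [← t.pf_lt_cnt hb s, hl]; exact hi, hl⟩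

/-- levels -/
def lev : ℕ → Set ℕ
  | 0 => {0, 2*g}
  | n+1 => {s | ∃ r ∈ lev n, s = cnt t.J r ∨ s = 2*g - cnt t.J r}

lemma lev_le (n : ℕ) : ∀ s ∈ t.lev n, s ≤ 2*g := by
  induction n with
  | zero => intro s hs; simp [lev] at hs; omega
  | succ n ih =>
    rintro s ⟨r, hr, h⟩
    have := t.cnt_le_g r (ih r hr); omega

lemma lev_rev (n : ℕ) : ∀ s ∈ t.lev n, 2*g - s ∈ t.lev n := by
  cases n with
  | zero => intro s hs; simp [lev] at hs ⊢; omega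
  | succ n =>
    rintro s ⟨r, hr, h⟩
    have := t.cnt_le_g r (t.lev_le n r hr)
    refine ⟨r, hr, by omega⟩

lemma lev_zero_mem (n : ℕ) : 0 ∈ t.lev n := by
  induction n with
  | zero => simp [lev]
  | succ n ih => exact ⟨0, ih, Or.inl rfl⟩

lemma lev_mono_succ (n : ℕ) : t.lev n ⊆ t.lev (n+1) := by
  induction n with
  | zero =>
    intro s hs; simp [lev] at hs
    refine ⟨0, by simp [lev], ?_⟩
    simp [cnt_zero]; omega
  | succ n ih =>
    rintro s ⟨r, hr, h⟩
    exact ⟨r, ih hr, h⟩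

lemma lev_mono {m n : ℕ} (h : m ≤ n) : t.lev m ⊆ t.lev n :=
  monotone_nat_of_le_succ (f := t.lev) t.lev_mono_succ h

end ZT

/-- Counting lemma -/
lemma count_lemma (S : Finset ℕ) (g : ℕ) (a b : ℕ → ℕ) 
    (ha : ∀ s ∈ S, ∀ r ∈ S, s ≤ r → a s ≤ a r) (hb : ∀ s ∈ S, ∀ r ∈ S, s ≤ r → b s ≤ b r)
    (h0 : 0 ∈ S)
    (haS : ∀ s ∈ S, a s ∈ S ∧ a s ≤ g) (hbS : ∀ s ∈ S, b s ∈ S ∧ g ≤ b s)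
    (hab : ∀ s ∈ S, a s + b s = g + s)
    (s s' : ℕ) (hs : s ∈ S) (hs' : s' ∈ S) (hlt : s < s') (hcons : ∀ r ∈ S, r ≤ s ∨ s' ≤ r) :
    a s = a s' ∨ b s = b s' := by
  classical
  by_contra hcon
  push Not at hcon
  have hbd : a s < a s' ∧ b s < b s' :=
    ⟨lt_of_le_of_ne (ha s hs s' hs' hlt.le) hcon.1, lt_of_le_of_ne (hb s hs s' hs' hlt.le) hcon.2⟩
  set A := S.filter (fun r => r ≠ 0 ∧ ∀ q ∈ S, q < r → a q < a r) with hA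
  set B := S.filter (fun r => r ≠ 0 ∧ ∀ q ∈ S, q < r → b q < b r) with hB
  have hU : S.erase 0 ⊆ A ∪ B := by
    intro r hr
    rw [Finset.mem_erase] at hr
    by_contra hn
    simp only [hA, hB, Finset.mem_union, Finset.mem_filter, not_or, not_and, not_forall] at hn
    obtain ⟨q, hq, hqr, hq2⟩ := hn.1 hr.2 hr.1
    obtain ⟨q', hq', hqr', hq2'⟩ := hn.2 hr.2 hr.1
    have h1 := hab q hq; have h2 := hab q' hq'; have h3 := hab r hr.2
    have h4 := ha q hq r hr.2 hqr.le
    have h5 := hb q' hq' r hr.2 hqr'.le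
    rcases le_total q q' with h | h
    · have := ha q hq q' hq' h; have := ha q' hq' r hr.2 hqr'.le; omega
    · have := hb q' hq' q hq h; have := hb q hq r hr.2 hqr.le; omega
  have hI : s' ∈ A ∩ B := by
    simp only [hA, hB, Finset.mem_inter, Finset.mem_filter]
    refine ⟨⟨hs', by omega, fun q hq hqs => ?_⟩, ⟨hs', by omega, fun q hq hqs => ?_⟩⟩
    · have := hcons q hq
      have := ha q hq s hs (by omega); omega
    · have := hcons q hq
      have := hb q hq s hs (by omega); omega
  have hc1 : (A ∪ B).card + (A ∩ B).card = A.card + B.card := Finset.card_union_add_card_inter A B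
  have hc2 : 1 ≤ (A ∩ B).card := Finset.card_pos.2 ⟨s', hI⟩
  have hc3 := Finset.card_le_card hU
  have hc4 := Finset.card_erase_of_mem h0
  have hSpos : 1 ≤ S.card := Finset.card_pos.2 ⟨0, h0⟩
  have hgS : g ∈ S := by
    have := haS 0 h0; have h2 := hbS 0 h0; have := hab 0 h0
    have : b 0 = g := by omega
    rw [← this]; exact h2.1
  have hcA : A.card ≤ ((S.filter (· ≤ g)).erase (a 0)).card := by
    apply Finset.card_le_card_of_injOn a
    · intro r hr
      simp only [hA, Finset.coe_filter, Set.mem_ofPred_eq] at hr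
      simp only [Finset.coe_erase, Finset.coe_filter, Set.mem_sdiff, Set.mem_ofPred_eq, Set.mem_singleton_iff]
      exact ⟨haS r hr.1, (hr.2.2 0 h0 (by omega)).ne'⟩
    · intro r hr q hq hrq
      simp only [hA, Finset.coe_filter, Set.mem_ofPred_eq] at hr hq
      rcases lt_trichotomy r q with h | h | h
      · have := hq.2.2 r hr.1 h; omega
      · exact h
      · have := hr.2.2 q hq.1 h; omega
  have hcB : B.card ≤ ((S.filter (g ≤ ·)).erase (b 0)).card := by
    apply Finset.card_le_card_of_injOn b
    · intro r hr
      simp only [hB, Finset.coe_filter, Set.mem_ofPred_eq] at hr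
      simp only [Finset.coe_erase, Finset.coe_filter, Set.mem_sdiff, Set.mem_ofPred_eq, Set.mem_singleton_iff]
      exact ⟨hbS r hr.1, (hr.2.2 0 h0 (by omega)).ne'⟩
    · intro r hr q hq hrq
      simp only [hB, Finset.coe_filter, Set.mem_ofPred_eq] at hr hq
      rcases lt_trichotomy r q with h | h | h
      · have := hq.2.2 r hr.1 h; omega
      · exact h
      · have := hr.2.2 q hq.1 h; omega
  rw [Finset.card_erase_of_mem (by simp; exact haS 0 h0)] at hcA
  rw [Finset.card_erase_of_mem (by simp; exact hbS 0 h0)] at hcB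
  have hu : (S.filter (· ≤ g)).card + (S.filter (g ≤ ·)).card ≤ S.card + 1 := by
    rw [← Finset.card_union_add_card_inter]
    apply add_le_add
    · apply Finset.card_le_card
      intro x hx; simp at hx; rcases hx with h | h <;> exact h.1
    · rw [Finset.card_le_one]
      intro x hx y hy; simp at hx hy; omega
  have p1 : 1 ≤ (S.filter (· ≤ g)).card := Finset.card_pos.2 ⟨g, by simp [hgS]⟩
  have p2 : 1 ≤ (S.filter (g ≤ ·)).card := Finset.card_pos.2 ⟨g, by simp [hgS]⟩
  omega

end ZipOrb

namespace ZipOrb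
set_option linter.unusedSectionVars false
set_option linter.unusedSimpArgs false
section semilin
variable {k : Type*} [Field k]

/-- injective semilinear maps between spaces of equal dimension are surjective -/
lemma semi_surj {V W : Type*} [AddCommGroup V] [Module k V] [FiniteDimensional k V]
    [AddCommGroup W] [Module k W] [FiniteDimensional k W]
    (θ : k ≃+* k) (f : V →+ W) (hf : ∀ a x, f (a • x) = θ a • f x)
    (hinj : ∀ x, f x = 0 → x = 0) (hd : Module.finrank k V = Module.finrank k W) :
    Function.Surjective f := by
  intro w
  let b := Module.finBasis k V
  have hli : LinearIndependent k (f ∘ b) :=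
    b.linearIndependent.map_of_injective_injective θ.symm f
      (fun r h => by simpa using h) hinj (fun r m => by rw [hf]; simp)
  have hsp : Submodule.span k (Set.range (f ∘ b)) = ⊤ :=
    hli.span_eq_top_of_card_eq_finrank' (by simp [hd])
  have hw : w ∈ Submodule.span k (Set.range (f ∘ b)) := by rw [hsp]; trivial
  induction hw using Submodule.span_induction with
  | mem x hx => obtain ⟨i, rfl⟩ := hx; exact ⟨b i, rfl⟩
  | zero => exact ⟨0, map_zero f⟩
  | add x y _ _ hx hy =>
    obtain ⟨a, rfl⟩ := hx; obtain ⟨b, rfl⟩ := hy; exact ⟨a + b, map_add f a b⟩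
  | smul a x _ hx =>
    obtain ⟨y, rfl⟩ := hx; exact ⟨θ.symm a • y, by rw [hf]; simp⟩

variable (p : ℕ) [Fact p.Prime] [CharP k p] [IsAlgClosed k]

open Polynomial in
/-- auxiliary polynomials -/
noncomputable def PL (q : ℕ) (c : ℕ → k) : ℕ → k[X]
  | 0 => C (c 0) * X ^ q
  | i+1 => PL q c i ^ q + C (c (i+1)) * X ^ q

open Polynomial in
lemma PL_dvd (q : ℕ) (hq : 2 ≤ q) (c : ℕ → k) (r : ℕ) : X ^ 2 ∣ PL q c r := by
  induction r with
  | zero => exact (pow_dvd_pow X hq).mul_left _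
  | succ r ih =>
    exact dvd_add (ih.trans (dvd_pow_self _ (by omega))) ((pow_dvd_pow X hq).mul_left _)

open Polynomial in
lemma PL_ne (q : ℕ) (hq : 2 ≤ q) (c : ℕ → k) (r : ℕ) (h : ∃ i ≤ r, c i ≠ 0) : PL q c r ≠ 0 := by
  induction r with
  | zero =>
    obtain ⟨i, hi, hc⟩ := h
    obtain rfl : i = 0 := by omega
    simp [PL, hc]
  | succ r ih =>
    by_cases h' : PL q c r = 0
    · obtain ⟨i, hi, hc⟩ := h
      have : i = r + 1 := by
        by_contra hne
        exact ih ⟨i, by omega, hc⟩ h'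
      subst this
      have hq0 : q ≠ 0 := by omega
      simp [PL, h', hc, hq0]
    · have h2 : 2 ≤ (PL q c r).natDegree := by
        have := natDegree_le_of_dvd (PL_dvd q hq c r) h'
        simpa using this
      intro h0
      rw [PL, add_eq_zero_iff_eq_neg] at h0
      have h3 := congrArg natDegree h0
      rw [natDegree_pow, natDegree_neg] at h3
      have h4 := natDegree_C_mul_X_pow_le (c (r+1)) q
      nlinarith

open Polynomial in
lemma PL_root (q : ℕ) (hq : 2 ≤ q) (c : ℕ → k) (r : ℕ) (h : ∃ i ≤ r, c i ≠ 0) :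
    ∃ z : k, z ≠ 0 ∧ (PL q c r).eval z = z := by
  obtain ⟨R, hR⟩ := PL_dvd q hq c r
  have hR0 : R ≠ 0 := by
    rintro rfl; exact PL_ne q hq c r h (by rw [hR]; simp)
  have hd : (X * R - 1 : k[X]).degree ≠ 0 := by
    have h1 : (X * R).degree = R.degree + 1 := by rw [mul_comm, degree_mul_X]
    have h2 : (0 : WithBot ℕ) < (X * R).degree := by
      rw [h1, degree_eq_natDegree hR0]; exact_mod_cast Nat.succ_pos _
    rw [degree_sub_eq_left_of_degree_lt (by rw [degree_one]; exact h2)]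
    exact h2.ne'
  obtain ⟨z, hz⟩ := IsAlgClosed.exists_root _ hd
  simp [IsRoot] at hz
  have h1 : z * eval z R = 1 := by linear_combination hz
  refine ⟨z, ?_, ?_⟩
  · rintro rfl; simp at h1
  · rw [hR]; simp; linear_combination z * h1

variable {V : Type*} [AddCommGroup V] [Module k V] [FiniteDimensional k V]

/-- partial cyclic spans -/
def cycN (T : V →+ V) (V' : Submodule k V) (x : V) : ℕ → Submodule k V
  | 0 => V'
  | m+1 => cycN T V' x m ⊔ Submodule.span k {T^[m] x}

lemma mem_cycN (T : V →+ V) (V' : Submodule k V) (x : V) (m : ℕ) (w : V) :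
    w ∈ cycN T V' x m ↔ ∃ c : ℕ → k, ∃ v ∈ V', w = (∑ i ∈ Finset.range m, c i • T^[i] x) + v := by
  induction m generalizing w with
  | zero => simp [cycN]
  | succ m ih =>
    rw [cycN, Submodule.mem_sup]
    constructor
    · rintro ⟨y, hy, z, hz, rfl⟩
      obtain ⟨c, v, hv, rfl⟩ := (ih y).1 hy
      obtain ⟨a, rfl⟩ := Submodule.mem_span_singleton.1 hz
      refine ⟨fun i => if i = m then a else c i, v, hv, ?_⟩
      rw [Finset.sum_range_succ]
      simp only [if_true]
      have : ∑ i ∈ Finset.range m, (if i = m then a else c i) • T^[i] x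
          = ∑ i ∈ Finset.range m, c i • T^[i] x := by
        refine Finset.sum_congr rfl fun i hi => ?_
        rw [if_neg (Finset.mem_range.1 hi).ne]
      rw [this]; abel
    · rintro ⟨c, v, hv, rfl⟩
      refine ⟨_, (ih _).2 ⟨c, v, hv, rfl⟩, c m • T^[m] x, 
        Submodule.mem_span_singleton.2 ⟨_, rfl⟩, ?_⟩
      rw [Finset.sum_range_succ]; abel

lemma exists_fixed_mod (q : ℕ) (hq : 2 ≤ q) (T : V →+ V)
    (hT : ∀ (a : k) x, T (a • x) = a ^ q • T x) (V' : Submodule k V)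
    (hV : ∀ x, T x ∈ V' → x ∈ V') (hne : V' ≠ ⊤) : ∃ y, y ∉ V' ∧ T y - y ∈ V' := by
  obtain ⟨x, hx⟩ : ∃ x, x ∉ V' := by
    by_contra h; push Not at h; exact hne (eq_top_iff.2 fun x _ => h x)
  have hex : ∃ m, T^[m] x ∈ cycN T V' x m := by
    by_contra h
    push Not at h
    have : ∀ m, m ≤ Module.finrank k (cycN T V' x m) := by
      intro m
      induction m with
      | zero => exact Nat.zero_le _
      | succ m ih =>
        have : cycN T V' x m < cycN T V' x (m+1) := by
          refine lt_of_le_of_ne le_sup_left fun he => h m ?_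
          rw [he]
          exact Submodule.mem_sup_right (Submodule.mem_span_singleton_self _)
        have := Submodule.finrank_lt_finrank_of_lt this
        omega
    have h1 := this (Module.finrank k V + 1)
    have := Submodule.finrank_le (cycN T V' x (Module.finrank k V + 1))
    omega
  classical
  obtain ⟨m, hm, hmin⟩ : ∃ m, T^[m] x ∈ cycN T V' x m ∧ ∀ j < m, T^[j] x ∉ cycN T V' x j :=
    ⟨Nat.find hex, Nat.find_spec hex, fun j hj => Nat.find_min hex hj⟩
  have hm0 : m ≠ 0 := by rintro rfl; exact hx hm
  obtain ⟨r, rfl⟩ := Nat.exists_eq_succ_of_ne_zero hm0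
  rw [mem_cycN] at hm
  obtain ⟨c, v, hv, hc⟩ := hm
  have hcn : ∃ i ≤ r, c i ≠ 0 := by
    by_contra h; push Not at h
    rw [Finset.sum_eq_zero (fun i hi => by
      rw [h i (by have := Finset.mem_range.1 hi; omega), zero_smul]), zero_add] at hc
    have : ∀ j, T^[j] x ∈ V' → x ∈ V' := by
      intro j; induction j with
      | zero => exact id
      | succ j ih => 
        intro h; rw [Function.iterate_succ_apply'] at h; exact ih (hV _ h)
    exact hx (this _ (hc ▸ hv))
  obtain ⟨z, hz0, hz⟩ := PL_root q hq c r hcn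
  let b : ℕ → k := fun i => (PL q c i).eval z
  have hb0 : b 0 = c 0 * z ^ q := by simp [b, PL]
  have hbs : ∀ i, b (i+1) = b i ^ q + c (i+1) * z ^ q := by intro i; simp [b, PL]
  have hbr : b r = z := hz
  refine ⟨∑ i ∈ Finset.range (r+1), b i • T^[i] x, ?_, ?_⟩
  · intro h
    apply hmin r (by omega)
    rw [mem_cycN]
    rw [Finset.sum_range_succ, hbr] at h
    refine ⟨fun i => - z⁻¹ * b i, _, V'.smul_mem z⁻¹ h, ?_⟩
    rw [smul_add, Finset.smul_sum, smul_smul, inv_mul_cancel₀ hz0, one_smul, ← add_assoc,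
      ← Finset.sum_add_distrib, Finset.sum_eq_zero, zero_add]
    intro i _; rw [smul_smul, ← add_smul]; simp
  · have : T (∑ i ∈ Finset.range (r+1), b i • T^[i] x) - ∑ i ∈ Finset.range (r+1), b i • T^[i] x
        = z ^ q • v := by
      rw [map_sum]
      simp_rw [hT, ← Function.iterate_succ_apply']
      rw [Finset.sum_range_succ, hbr, hc, Finset.sum_range_succ', Finset.sum_range_succ', hb0]
      simp_rw [hbs, add_smul, Finset.sum_add_distrib, smul_add, Finset.smul_sum, smul_smul]
      simp only [mul_comm (z^q)]
      abel
    rw [this]; exact V'.smul_mem _ hv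

lemma exists_AS (q : ℕ) (hq : 2 ≤ q) (c : k) : ∃ a : k, a ^ q - a = c := by
  open Polynomial in
  have hd : (X ^ q - (X + C c) : k[X]).degree ≠ 0 := by
    have h1 : (X + C c : k[X]).degree < (X ^ q : k[X]).degree := by
      rw [degree_X_add_C, degree_X_pow]; exact_mod_cast hq
    rw [degree_sub_eq_left_of_degree_lt h1, degree_X_pow]
    exact_mod_cast (by omega : q ≠ 0)
  obtain ⟨z, hz⟩ := IsAlgClosed.exists_root _ hd
  simp at hz
  exact ⟨z, by linear_combination hz⟩

lemma two_le_q (n : ℕ) (hn : 1 ≤ n) : 2 ≤ p ^ n :=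
  (Fact.out : p.Prime).two_le.trans (Nat.le_self_pow (by omega) p)

/-- Lang's theorem for injective semilinear maps -/
theorem lang (n : ℕ) (hn : 1 ≤ n) (T : V →+ V)
    (hT : ∀ (a : k) x, T (a • x) = a ^ p ^ n • T x) (hinj : ∀ x, T x = 0 → x = 0) :
    Submodule.span k {x | T x = x} = ⊤ := by
  by_contra hne
  have hq := two_le_q p n hn
  set V' := Submodule.span k {x | T x = x} with hV'
  have hmem : ∀ x ∈ V', T x ∈ V' := by
    intro x hx
    induction hx using Submodule.span_induction with
    | mem x hx => rw [show T x = x from hx]; exact Submodule.subset_span hx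
    | zero => simp
    | add x y _ _ hx hy => rw [map_add]; exact V'.add_mem hx hy
    | smul a x _ hx => rw [hT]; exact V'.smul_mem _ hx
  let T' : V' →+ V' := AddMonoidHom.mk' (fun x => ⟨T x, hmem x x.2⟩) 
    (fun a b => by ext; simp)
  have hs : Function.Surjective T' := semi_surj (iterateFrobeniusEquiv k p n) T'
    (fun a x => by ext; simp [T', hT, iterateFrobenius_def]) 
    (fun x h => by
      have : T x = 0 := congrArg Subtype.val h
      ext; exact hinj _ this) rfl
  obtain ⟨y, hy, hTy⟩ := exists_fixed_mod (p ^ n) hq T hT V' (by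
    intro x hx
    obtain ⟨v, hv⟩ := hs ⟨T x, hx⟩
    have h1 : T v = T x := congrArg Subtype.val hv
    have : x - v = 0 := hinj _ (by rw [map_sub, h1, sub_self])
    rw [sub_eq_zero.1 this]; exact v.2) hne
  have key : ∀ w ∈ V', ∃ v ∈ V', T v - v = w := by
    intro w hw
    induction hw using Submodule.span_induction with
    | mem x hx => 
      obtain ⟨a, ha⟩ := exists_AS (p ^ n) hq (1 : k)
      refine ⟨a • x, V'.smul_mem _ (Submodule.subset_span hx), ?_⟩
      rw [hT, show T x = x from hx, ← sub_smul, ha, one_smul]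
    | zero => exact ⟨0, V'.zero_mem, by simp⟩
    | add x y _ _ hx hy =>
      obtain ⟨a, ha, rfl⟩ := hx; obtain ⟨b, hb, rfl⟩ := hy
      exact ⟨a + b, V'.add_mem ha hb, by rw [map_add]; abel⟩
    | smul a x hx' hx =>
      clear hx
      induction hx' using Submodule.span_induction generalizing a with
      | mem x hx => 
        obtain ⟨a, ha⟩ := exists_AS (p ^ n) hq (a : k)
        refine ⟨a • x, V'.smul_mem _ (Submodule.subset_span hx), ?_⟩
        rw [hT, show T x = x from hx, ← sub_smul, ha]
      | zero => exact ⟨0, V'.zero_mem, by simp⟩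
      | add x y _ _ hx hy =>
        obtain ⟨u, ha, hu⟩ := hx a; obtain ⟨v, hb, hv⟩ := hy a
        exact ⟨u + v, V'.add_mem ha hb, by rw [map_add, smul_add, ← hu, ← hv]; abel⟩
      | smul b x _ hx => rw [smul_smul]; exact hx (a * b)
  obtain ⟨v, hv, hv'⟩ := key _ hTy
  apply hy
  have : y - v ∈ V' := Submodule.subset_span (by
    show T (y - v) = y - v
    rw [map_sub]
    have : T y - y - (T v - v) = 0 := by rw [hv', sub_self]
    rw [← sub_eq_zero, ← this]; abel)
  simpa using V'.add_mem this hv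

/-- basis of fixed vectors -/
theorem lang_basis (n : ℕ) (hn : 1 ≤ n) (T : V →+ V)
    (hT : ∀ (a : k) x, T (a • x) = a ^ p ^ n • T x) (hinj : ∀ x, T x = 0 → x = 0)
    {ι : Type*} [Fintype ι] (hι : Fintype.card ι = Module.finrank k V) :
    ∃ b : Module.Basis ι k V, ∀ i, T (b i) = b i := by
  have h := lang p n hn T hT hinj
  obtain ⟨s, hs, hsp, hli⟩ := exists_linearIndependent k {x | T x = x}
  rw [h] at hsp
  let b := Module.Basis.mk hli (by simp [hsp])
  have e : s ≃ ι := by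
    haveI : Fintype s := FiniteDimensional.fintypeBasisIndex b
    exact Fintype.equivOfCardEq (by rw [hι, Module.finrank_eq_card_basis b])
  refine ⟨b.reindex e, fun i => ?_⟩
  have := hs (e.symm i).2
  simpa [b] using this

/-- nondegenerate forms, linear on the left, `q`-semilinear on the right -/
structure SF (q : ℕ) {V : Type*} [AddCommGroup V] [Module k V] (b : V → V → k) : Prop where
  al : ∀ x y z, b (x + y) z = b x z + b y z
  ar : ∀ x y z, b x (y + z) = b x y + b x z
  sl : ∀ (a : k) x y, b (a • x) y = a * b x y
  sr : ∀ (a : k) x y, b x (a • y) = a ^ q * b x y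
  ndl : ∀ x, (∀ y, b x y = 0) → x = 0
  ndr : ∀ y, (∀ x, b x y = 0) → y = 0


namespace SF
variable {p}
variable {q : ℕ} {b : V → V → k}

lemma zl (h : SF q b) (y) : b 0 y = 0 := by simpa using h.sl 0 0 y
lemma zr (hq : 0 < q) (h : SF q b) (x) : b x 0 = 0 := by
  have := h.sr 0 x 0; rwa [smul_zero, zero_pow hq.ne', zero_mul] at this
lemma suml (h : SF q b) {ι : Type*} (s : Finset ι) (f : ι → V) (y) :
    b (∑ i ∈ s, f i) y = ∑ i ∈ s, b (f i) y := by
  classical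
  induction s using Finset.induction_on with
  | empty => simp [h.zl]
  | insert a s ha ih => rw [Finset.sum_insert ha, Finset.sum_insert ha, h.al, ih]
lemma sumr (hq : 0 < q) (h : SF q b) {ι : Type*} (s : Finset ι) (f : ι → V) (x) :
    b x (∑ i ∈ s, f i) = ∑ i ∈ s, b x (f i) := by
  classical
  induction s using Finset.induction_on with
  | empty => simp [h.zr hq]
  | insert a s ha ih => rw [Finset.sum_insert ha, Finset.sum_insert ha, h.ar, ih]

lemma exists_T {m : ℕ} (h : SF (p ^ m) b) (z : V) : ∃ w, ∀ y, b w y = b y z ^ p ^ m := by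
  let θ := iterateFrobeniusEquiv k p m
  have hθ : ∀ a, θ a = a ^ p ^ m := fun a => iterateFrobeniusEquiv_def k p m a
  let F : V →+ Module.Dual k V := AddMonoidHom.mk' (fun w =>
    { toFun := fun y => θ.symm (b w y)
      map_add' := fun x y => by rw [h.ar, map_add]
      map_smul' := fun a y => by rw [h.sr, map_mul, ← hθ]; simp })
    (fun x y => by ext z; simp [h.al])
  have hs := semi_surj θ.symm F (fun a x => by ext y; simp [F, h.sl]) (fun x hx => h.ndl x (by
    intro y
    have := LinearMap.congr_fun hx y
    simpa [F] using this)) (Subspace.dual_finrank_eq).symm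
  let f : Module.Dual k V :=
    { toFun := fun y => b y z
      map_add' := fun x y => h.al x y z
      map_smul' := fun a y => h.sl a y z }
  obtain ⟨w, hw⟩ := hs f
  refine ⟨w, fun y => ?_⟩
  have := LinearMap.congr_fun hw y
  rw [← hθ]
  rw [← show θ.symm (b w y) = b y z from this]; simp

/-- a vector which is non isotropic and for which orthogonality is symmetric -/
lemma exists_good {m : ℕ} (hm : 1 ≤ m) (h : SF (p ^ m) b) (hV : 0 < Module.finrank k V) :
    ∃ x, b x x ≠ 0 ∧ ∀ y, b x y = 0 ↔ b y x = 0 := by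
  have hq := two_le_q p m hm
  choose T0 hT0 using h.exists_T
  have inj : ∀ x y, (∀ z, b x z = b y z) → x = y := by
    intro x y hxy
    have := h.ndl (x + (-1 : k) • y) (fun z => by rw [h.al, h.sl, hxy]; ring)
    rw [neg_one_smul, ← sub_eq_add_neg, sub_eq_zero] at this
    exact this
  let T : V →+ V := AddMonoidHom.mk' T0 (fun x y => inj _ _ fun z => by
    rw [h.al, hT0, hT0, hT0, h.ar, add_pow_char_pow])
  have hT : ∀ z y, b (T z) y = b y z ^ p ^ m := hT0
  have hTs : ∀ (a : k) x, T (a • x) = a ^ p ^ (2 * m) • T x := by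
    intro a x
    apply inj; intro z
    rw [hT, h.sr, h.sl, hT, mul_pow, ← pow_mul, ← pow_add, two_mul]
  have hTi : ∀ x, T x = 0 → x = 0 := by
    intro x hx
    apply h.ndr; intro y
    have := hT x y
    rw [hx, h.zl] at this
    exact pow_eq_zero_iff (by omega) |>.1 this.symm
  have hl := lang p (2 * m) (by omega) T hTs hTi
  have hsym : ∀ x, T x = x → ∀ y, b x y = b y x ^ p ^ m := by
    intro x hx y
    conv_lhs => rw [← hx]
    exact hT x y
  suffices ∃ x, T x = x ∧ b x x ≠ 0 by
    obtain ⟨x, hx, hb⟩ := this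
    refine ⟨x, hb, fun y => ?_⟩
    rw [hsym x hx y]
    exact pow_eq_zero_iff (by omega)
  by_contra hcon
  push Not at hcon
  obtain ⟨e, he⟩ := IsAlgClosed.exists_pow_nat_eq (-1 : k) (n := p ^ m - 1) (by omega)
  have he1 : e ^ p ^ m = - e := by
    have : p ^ m = (p ^ m - 1) + 1 := by omega
    rw [this, pow_succ, he]; ring
  have he0 : e ≠ 0 := by
    rintro rfl
    rw [zero_pow (by omega)] at he
    exact one_ne_zero (neg_eq_zero.1 he.symm)
  obtain ⟨a, ha⟩ := exists_AS (p ^ m) hq e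
  have ha' : a ^ p ^ m = a + e := by linear_combination ha
  have ha2 : a ^ p ^ (2 * m) = a := by
    rw [two_mul, pow_add, pow_mul, ha', add_pow_char_pow, ha', he1]; ring
  have hz : ∀ x y, T x = x → T y = y → b x y = 0 := by
    intro x y hx hy
    have h1 : ∀ x y, T x = x → T y = y → b x y + b y x = 0 := by
      intro x y hx hy
      have h2 := hcon (x + y) (by rw [map_add, hx, hy])
      rw [h.al, h.ar, h.ar, hcon x hx, hcon y hy] at h2
      linear_combination h2
    have h2 := h1 x y hx hy
    have h3 := h1 (a • x) y (by rw [hTs, ha2, hx]) hy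
    rw [h.sl, h.sr, ha'] at h3
    have : e * b x y = 0 := by linear_combination (a + e) * h2 - h3
    exact (mul_eq_zero.1 this).resolve_left he0
  have hall : ∀ x : V, x = 0 := by
    intro x
    apply h.ndl
    intro y
    have hx : x ∈ Submodule.span k {x | T x = x} := by rw [hl]; trivial
    have hy : y ∈ Submodule.span k {x | T x = x} := by rw [hl]; trivial
    induction hx using Submodule.span_induction with
    | mem x hx =>
      induction hy using Submodule.span_induction with
      | mem y hy => exact hz x y hx hy
      | zero => exact h.zr (by omega) x
      | add u v _ _ hu hv => rw [h.ar, hu, hv, add_zero]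
      | smul a u _ hu => rw [h.sr, hu, mul_zero]
    | zero => exact h.zl y
    | add u v _ _ hu hv => rw [h.al, hu, hv, add_zero]
    | smul a u _ hu => rw [h.sl, hu, mul_zero]
  have : Subsingleton V := ⟨fun x y => by rw [hall x, hall y]⟩
  rw [Module.finrank_zero_of_subsingleton] at hV
  exact lt_irrefl _ hV

theorem exists_orthonormal {m : ℕ} (hm : 1 ≤ m) (d : ℕ) : ∀ {V : Type*} [AddCommGroup V]
    [Module k V] [FiniteDimensional k V] {b : V → V → k} (_ : SF (p ^ m) b)
    (_ : Module.finrank k V = d), ∃ o : Fin d → V, ∀ i j, b (o i) (o j) = if i = j then 1 else 0 := by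
  have hq := two_le_q p m hm
  induction d with
  | zero => intro V _ _ _ b h hd; exact ⟨Fin.elim0, fun i => i.elim0⟩
  | succ d ih =>
    intro V _ _ _ b h hd
    obtain ⟨x0, hx0, hsym⟩ := h.exists_good hm (by omega)
    obtain ⟨l, hl⟩ := IsAlgClosed.exists_pow_nat_eq (b x0 x0)⁻¹ (n := 1 + p ^ m) (by omega)
    have hl0 : l ≠ 0 := by
      rintro rfl
      rw [zero_pow (by omega)] at hl
      exact inv_ne_zero hx0 hl.symm
    set x := l • x0 with hx
    have hxx : b x x = 1 := by
      rw [hx, h.sl, h.sr, ← mul_assoc, ← pow_succ', add_comm, hl, inv_mul_cancel₀ hx0]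
    have hsx : ∀ y, b x y = 0 ↔ b y x = 0 := by
      intro y
      rw [hx, h.sl, h.sr, mul_eq_zero, mul_eq_zero, hsym y]
      have : l ^ p ^ m ≠ 0 := pow_ne_zero _ hl0
      simp [hl0, this]
    let f : Module.Dual k V :=
      { toFun := fun y => b y x
        map_add' := fun u y => h.al u y x
        map_smul' := fun a y => h.sl a y x }
    have hf : ∀ y, f y = b y x := fun _ => rfl
    have hrk := f.finrank_range_add_finrank_ker
    have hr : LinearMap.range f = ⊤ := LinearMap.range_eq_top.2 fun c => ⟨c • x, by
      rw [hf, h.sl, hxx, mul_one]⟩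
    rw [hr, finrank_top, Module.finrank_self, hd] at hrk
    have hmem : ∀ y : LinearMap.ker f, b y x = 0 := fun y => LinearMap.mem_ker.1 y.2
    have hdec : ∀ y : V, ∃ (y' : LinearMap.ker f) (a : k), y = y' + a • x := by
      intro y
      refine ⟨⟨y + (-(b y x)) • x, ?_⟩, b y x, by simp⟩
      rw [LinearMap.mem_ker, hf, h.al, h.sl, hxx]; ring
    have h' : SF (p ^ m) (fun y z : LinearMap.ker f => b y z) :=
      { al := fun x y z => h.al x y z
        ar := fun x y z => h.ar x y z
        sl := fun a x y => h.sl a x y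
        sr := fun a x y => h.sr a x y
        ndl := fun y hy => by
          ext; apply h.ndl; intro z
          obtain ⟨z', a, rfl⟩ := hdec z
          rw [h.ar, h.sr, hmem, hy z']; simp
        ndr := fun y hy => by
          ext; apply h.ndr; intro z
          obtain ⟨z', a, rfl⟩ := hdec z
          rw [h.al, h.sl, (hsx y).2 (hmem y), hy z']; simp }
    obtain ⟨o, ho⟩ := ih h' (by omega)
    refine ⟨Fin.cons x (fun i => o i), ?_⟩
    intro i j
    refine Fin.cases ?_ (fun i => ?_) i <;> refine Fin.cases ?_ (fun j => ?_) j
    · simp [hxx]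
    · simp only [Fin.cons_zero, Fin.cons_succ]
      rw [(hsx _).2 (hmem _), if_neg (Fin.succ_ne_zero j).symm]
    · simp only [Fin.cons_zero, Fin.cons_succ]
      rw [hmem, if_neg (Fin.succ_ne_zero i)]
    · simp only [Fin.cons_succ, Fin.succ_inj]
      exact ho i j

lemma orthonormal_li {m : ℕ} {d : ℕ} (h : SF (p ^ m) b) (o : Fin d → V)
    (ho : ∀ i j, b (o i) (o j) = if i = j then 1 else 0) : LinearIndependent k o := by
  rw [Fintype.linearIndependent_iff]
  intro c hc i
  have : b (∑ j, c j • o j) (o i) = 0 := by rw [hc, h.zl]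
  rw [h.suml] at this
  simpa [h.sl, ho] using this

theorem exists_frame {m : ℕ} (hm : 1 ≤ m) (h : SF (p ^ m) b) {ι : Type*} [Fintype ι] [DecidableEq ι]
    (hι : Fintype.card ι = Module.finrank k V) (θ : Equiv.Perm ι) :
    ∃ f : ι → V, ∀ u v, b (f u) (f v) = if v = θ u then 1 else 0 := by
  have hq := two_le_q p m hm
  obtain ⟨o, ho⟩ := exists_orthonormal hm _ h rfl
  let b0 : (ι → k) → (ι → k) → k := fun x y => ∑ u, x u * y (θ u) ^ p ^ m
  have h0 : SF (p ^ m) b0 :=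
    { al := fun x y z => by simp [b0, add_mul, Finset.sum_add_distrib]
      ar := fun x y z => by simp [b0, mul_add, Finset.sum_add_distrib, add_pow_char_pow]
      sl := fun a x y => by simp [b0, Finset.mul_sum, mul_assoc]
      sr := fun a x y => by
        simp only [b0, Finset.mul_sum, Pi.smul_apply, smul_eq_mul, mul_pow]
        refine Finset.sum_congr rfl fun i _ => by ring
      ndl := fun x hx => by
        ext u
        have := hx (Pi.single (θ u) 1)
        simp only [b0, Pi.single_apply, θ.injective.eq_iff, ite_pow, one_pow,
          zero_pow (show p ^ m ≠ 0 by omega)] at this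
        simpa using this
      ndr := fun x hx => by
        ext u
        have := hx (Pi.single (θ.symm u) 1)
        simp only [b0, Pi.single_apply] at this
        simp at this
        exact this.1 }
  obtain ⟨o0, ho0⟩ := exists_orthonormal hm (Module.finrank k V) h0 (by
    rw [Module.finrank_pi, hι])
  have hli := h0.orthonormal_li o0 ho0
  have hsp := hli.span_eq_top_of_card_eq_finrank' (by
    rw [Module.finrank_pi, hι, Fintype.card_fin])
  have hc : ∀ u : ι, ∃ c : Fin (Module.finrank k V) → k, ∑ a, c a • o0 a = Pi.single u 1 := by
    intro u
    have : (Pi.single u 1 : ι → k) ∈ Submodule.span k (Set.range o0) := by rw [hsp]; trivial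
    exact (Submodule.mem_span_range_iff_exists_fun k).1 this
  choose c hc using hc
  refine ⟨fun u => ∑ a, c u a • o a, fun u v => ?_⟩
  have e1 : b (∑ a, c u a • o a) (∑ a, c v a • o a) = ∑ a, c u a * c v a ^ p ^ m := by
    rw [h.suml]
    refine Finset.sum_congr rfl fun i _ => ?_
    rw [h.sl, h.sumr (by omega)]
    simp [h.sr, ho]
  have e2 : b0 (∑ a, c u a • o0 a) (∑ a, c v a • o0 a) = ∑ a, c u a * c v a ^ p ^ m := by
    rw [h0.suml]
    refine Finset.sum_congr rfl fun i _ => ?_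
    rw [h0.sl, h0.sumr (by omega)]
    simp [h0.sr, ho0]
  rw [e1, ← e2, hc, hc]
  simp only [b0, Pi.single_apply, ite_pow, one_pow, zero_pow (show p ^ m ≠ 0 by omega)]
  by_cases hv : v = θ u
  · subst hv; simp
  · rw [if_neg hv]
    refine Finset.sum_eq_zero fun i _ => ?_
    by_cases hi : i = u
    · subst hi; simp [Ne.symm hv]
    · simp [hi]
end SF
end semilin
end ZipOrb

namespace ZipOrb
set_option linter.unusedSectionVars false
set_option linter.unusedSimpArgs false
section blocklang
variable {k : Type*} [Field k] {p : ℕ} [Fact p.Prime] [CharP k p] [IsAlgClosed k]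
variable {I κ : Type*} [Fintype I] [DecidableEq I]

/-- the split symmetric pairing -/
def Bf (r : I → I) (x y : I → k) : k := ∑ i, x i * y (r i)

/-- functions supported on the block of `i` -/
def Xb (k : Type*) [Field k] (cl : I → κ) (i : I) : Submodule k (I → k) where
  carrier := {x | ∀ j, cl j ≠ cl i → x j = 0}
  add_mem' := fun {a b} ha hb j hj => by simp [ha j hj, hb j hj]
  zero_mem' := fun j _ => rfl
  smul_mem' := fun c x hx j hj => by simp [hx j hj]

lemma mem_Xb {cl : I → κ} {i : I} {x : I → k} : x ∈ Xb k cl i ↔ ∀ j, cl j ≠ cl i → x j = 0 := Iff.rfl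

lemma single_mem_Xb {cl : I → κ} {i j : I} (h : cl j = cl i) : (Pi.single j 1 : I → k) ∈ Xb k cl i := by
  intro l hl
  have : l ≠ j := by rintro rfl; exact hl h
  simp [this]

lemma Xb_congr {cl : I → κ} {i j : I} (h : cl j = cl i) : Xb k cl i = Xb k cl j := by
  ext x; simp [mem_Xb, h]

open Classical in
lemma finrank_Xb (cl : I → κ) (i : I) :
    Fintype.card {j // cl j = cl i} = Module.finrank k (Xb k cl i) := by
  let e : Xb k cl i ≃ₗ[k] ({j // cl j = cl i} → k) :=
    { toFun := fun x j => x.1 j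
      invFun := fun y => ⟨fun j => if h : cl j = cl i then y ⟨j, h⟩ else 0, fun j hj => by simp [hj]⟩
      map_add' := fun x y => by ext; simp
      map_smul' := fun x y => by ext; simp
      left_inv := fun x => by
        ext j
        by_cases h : cl j = cl i
        · simp [h]
        · simp [h, x.2 j h]
      right_inv := fun y => by ext j; simp [j.2] }
  rw [e.finrank_eq, Module.finrank_pi]

/-- the block Lang situation -/
structure BL (p : ℕ) (π : Equiv.Perm I) (r : I → I) (cl : I → κ) (R : (I → k) →+ (I → k)) : Prop where
  rr : ∀ i, r (r i) = i
  rpi : ∀ i, π (r i) = r (π i)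
  clpi : ∀ i j, cl i = cl j → cl (π i) = cl (π j)
  clr : ∀ i j, cl i = cl j → cl (r i) = cl (r j)
  nr : ∀ i, cl (r i) ≠ cl i
  o1 : ∀ m i, cl (π^[m] i) = cl i → π^[m] i = i
  Rs : ∀ (a : k) x, R (a • x) = a ^ p • R x
  RX : ∀ i, ∀ x ∈ Xb k cl i, R x ∈ Xb k cl (π i)
  RB : ∀ x y, Bf r (R x) (R y) = Bf r x y ^ p

section Bf
variable {r : I → I}
lemma Bf_al (x y z : I → k) : Bf r (x + y) z = Bf r x z + Bf r y z := by
  simp [Bf, add_mul, Finset.sum_add_distrib]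
lemma Bf_ar (x y z : I → k) : Bf r x (y + z) = Bf r x y + Bf r x z := by
  simp [Bf, mul_add, Finset.sum_add_distrib]
lemma Bf_sl (a : k) (x z : I → k) : Bf r (a • x) z = a * Bf r x z := by
  simp [Bf, Finset.mul_sum, mul_assoc]
lemma Bf_sr (a : k) (x z : I → k) : Bf r x (a • z) = a * Bf r x z := by
  simp only [Bf, Finset.mul_sum, Pi.smul_apply, smul_eq_mul]
  exact Finset.sum_congr rfl fun i _ => by ring
lemma Bf_subr (x y z : I → k) : Bf r x (y - z) = Bf r x y - Bf r x z := by
  simp [Bf, mul_sub, Finset.sum_sub_distrib]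
lemma Bf_subl (x y z : I → k) : Bf r (x - y) z = Bf r x z - Bf r y z := by
  simp [Bf, sub_mul, Finset.sum_sub_distrib]
lemma Bf_single (hr : ∀ i, r (r i) = i) (j : I) (y : I → k) : Bf r y (Pi.single j 1) = y (r j) := by
  unfold Bf
  rw [Finset.sum_eq_single (r j)]
  · simp [hr]
  · intro b _ hb
    have : r b ≠ j := by rintro rfl; exact hb (hr b).symm
    simp [this]
  · simp
lemma Bf_comm (hr : ∀ i, r (r i) = i) (x y : I → k) : Bf r x y = Bf r y x := by
  unfold Bf
  let e : Equiv.Perm I := ⟨r, r, hr, hr⟩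
  rw [← Equiv.sum_comp e]
  refine Finset.sum_congr rfl fun i _ => ?_
  show x (r i) * y (r (r i)) = _
  rw [hr]; ring
end Bf

namespace BL
variable {π : Equiv.Perm I} {r : I → I} {cl : I → κ} {R : (I → k) →+ (I → k)}

lemma clr_iff (h : BL p π r cl R) {i j} : cl (r i) = cl (r j) ↔ cl i = cl j :=
  ⟨fun e => by have := h.clr _ _ e; rwa [h.rr, h.rr] at this, h.clr i j⟩

lemma nd (h : BL p π r cl R) {i : I} {x : I → k} (hx : x ∈ Xb k cl i) (h0 : ∀ y ∈ Xb k cl (r i), Bf r x y = 0) : x = 0 := by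
  ext j
  by_cases hj : cl j = cl i
  · have := h0 (Pi.single (r j) 1) (single_mem_Xb (h.clr _ _ hj))
    rw [Bf_single h.rr, h.rr] at this
    exact this
  · exact hx j hj

lemma perp_Xb (h : BL p π r cl R) {i j : I} (hij : cl j ≠ cl (r i)) {x y : I → k} (hx : x ∈ Xb k cl i) (hy : y ∈ Xb k cl j) :
    Bf r x y = 0 := by
  refine Finset.sum_eq_zero fun l _ => ?_
  by_cases hl : cl l = cl i
  · rw [hy (r l) (fun e => hij (by rw [← e]; exact h.clr _ _ hl)), mul_zero]
  · rw [hx l hl, zero_mul]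

lemma dual (h : BL p π r cl R) {i : I} (l : Module.Dual k (Xb k cl i)) : 
    ∃ d ∈ Xb k cl (r i), ∀ x : Xb k cl i, Bf r x d = l x := by
  classical
  obtain ⟨L, hL⟩ := LinearMap.exists_extend l
  have hL : ∀ x : Xb k cl i, L x = l x := fun x => LinearMap.congr_fun hL x
  refine ⟨fun j => if cl j = cl (r i) then L (Pi.single (r j) 1) else 0, fun j hj => by simp [hj], ?_⟩
  intro x
  rw [← hL]
  conv_rhs => rw [pi_eq_sum_univ' x.1, map_sum]
  unfold Bf
  refine Finset.sum_congr rfl fun j _ => ?_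
  beta_reduce
  rw [map_smul, h.rr, h.clr_iff]
  by_cases hj : cl j = cl i
  · rw [if_pos hj]; rfl
  · rw [x.2 j hj]; simp

lemma piI (h : BL p π r cl R) {i j : I} (c : ℕ) (e : cl i = cl j) : cl (π^[c] i) = cl (π^[c] j) := by
  induction c generalizing i j with
  | zero => exact e
  | succ c ih => exact ih (h.clpi _ _ e)

lemma rpiI (h : BL p π r cl R) (c : ℕ) (i : I) : π^[c] (r i) = r (π^[c] i) := by
  induction c generalizing i with
  | zero => rfl
  | succ c ih => rw [Function.iterate_succ_apply, Function.iterate_succ_apply, h.rpi, ih]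

lemma RsI (h : BL p π r cl R) (c : ℕ) (a : k) (x) : R^[c] (a • x) = a ^ p ^ c • R^[c] x := by
  induction c generalizing a x with
  | zero => simp
  | succ c ih => rw [Function.iterate_succ_apply, Function.iterate_succ_apply, h.Rs, ih, pow_succ',
      pow_mul]

lemma RaI (h : BL p π r cl R) (c : ℕ) (x y) : R^[c] (x + y) = R^[c] x + R^[c] y := by
  induction c generalizing x y with
  | zero => simp
  | succ c ih => simp only [Function.iterate_succ_apply, map_add, ih]

lemma RXI (h : BL p π r cl R) (c : ℕ) {i : I} {x} (hx : x ∈ Xb k cl i) : R^[c] x ∈ Xb k cl (π^[c] i) := by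
  induction c generalizing i x with
  | zero => exact hx
  | succ c ih => exact ih (h.RX _ _ hx)

lemma RBI (h : BL p π r cl R) (c : ℕ) (x y) : Bf r (R^[c] x) (R^[c] y) = Bf r x y ^ p ^ c := by
  induction c generalizing x y with
  | zero => simp
  | succ c ih => rw [Function.iterate_succ_apply, Function.iterate_succ_apply, ih, h.RB, pow_succ',
      pow_mul]

lemma Rinj (h : BL p π r cl R) (c : ℕ) (x) (hx : R^[c] x = 0) : x = 0 := by
  ext j
  have h1 := h.RBI c x (Pi.single (r j) 1)
  rw [hx, Bf_single h.rr, h.rr] at h1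
  have h2 : (0 : k) = x j ^ p ^ c := by rw [← h1]; simp [Bf]
  exact pow_eq_zero_iff (pow_ne_zero _ (Fact.out : p.Prime).ne_zero) |>.1 h2.symm

lemma per_iff (h : BL p π r cl R) {i j : I} (e : cl i = cl j) (c : ℕ) : π^[c] i = i ↔ π^[c] j = j := by
  constructor
  · intro h1; apply h.o1; rw [← h.piI c e, h1, e]
  · intro h1; apply h.o1; rw [h.piI c e, h1, e]

lemma exists_per (h : BL p π r cl R) : ∃ n, 1 ≤ n ∧ ∀ i, π^[n] i = i := by
  refine ⟨orderOf π, orderOf_pos π, fun i => ?_⟩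
  have := pow_orderOf_eq_one π
  rw [Equiv.Perm.iterate_eq_pow, this]; rfl

lemma R_mul (h : BL p π r cl R) (n t : ℕ) (x) (hx : R^[n] x = x) : R^[n * t] x = x := by
  rw [Function.iterate_mul]
  exact Function.iterate_fixed hx t

end BL

/-- frame for one orbit -/
structure Frame (π : Equiv.Perm I) (r : I → I) (cl : I → κ) (R : (I → k) →+ (I → k)) (j0 : I)
    (Z : Set I) (f : I → I → k) : Prop where
  mem : j0 ∈ Z
  P1 : ∀ u ∈ Z, f u ∈ Xb k cl u
  P2 : ∀ u ∈ Z, ∀ c, π^[c] u = u → R^[c] (f u) = f u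
  P3 : ∀ u ∈ Z, ∀ v ∈ Z, ∀ c, cl (π^[c] v) = cl (r u) →
    Bf r (f u) (R^[c] (f v)) = if π^[c] v = r u then 1 else 0
  P4 : ∀ u ∈ Z, ∀ v ∈ Z, ∀ c, π^[c] u = v → u = v
  P5 : ∀ u ∈ Z, ∀ v, cl v = cl u → v ∈ Z
  P6 : ∀ u ∈ Z, ∃ v ∈ Z, ∃ c, π^[c] v = r u

namespace BL
variable {π : Equiv.Perm I} {r : I → I} {cl : I → κ} {R : (I → k) →+ (I → k)}

lemma frame1 (h : BL p π r cl R) (j0 : I) (hno : ∀ c, cl (π^[c] j0) ≠ cl (r j0)) : 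
    ∃ Z f, Frame π r cl R j0 Z f := by
  classical
  set n := Function.minimalPeriod π j0 with hn
  obtain ⟨N, hN1, hN⟩ := h.exists_per
  have hn1 : 1 ≤ n := Function.minimalPeriod_pos_of_mem_periodicPts ⟨N, hN1, hN j0⟩
  have hnj : π^[n] j0 = j0 := Function.iterate_minimalPeriod
  have hdvd : ∀ u, cl u = cl j0 → ∀ c, π^[c] u = u → n ∣ c := by
    intro u hu c hc
    exact Function.IsPeriodicPt.minimalPeriod_dvd ((h.per_iff hu c).1 hc)
  have hrev : ∀ u c, π^[c] (r u) = r u ↔ π^[c] u = u := by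
    intro u c
    rw [h.rpiI]
    exact ⟨fun e => by have := congrArg r e; rwa [h.rr, h.rr] at this, fun e => by rw [e]⟩
  let T : Xb k cl j0 →+ Xb k cl j0 := AddMonoidHom.mk' 
    (fun x => ⟨R^[n] x, by have := h.RXI n x.2; rwa [hnj] at this⟩)
    (fun x y => by ext; simp [h.RaI])
  obtain ⟨b, hb⟩ := lang_basis p n hn1 T (fun a x => Subtype.ext (h.RsI n a x)) 
    (fun x hx => Subtype.ext (h.Rinj n x (congrArg Subtype.val hx)))
    (finrank_Xb cl j0)
  have hb : ∀ i, R^[n] (b i).1 = (b i).1 := fun i => congrArg Subtype.val (hb i)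
  have hd := fun i => h.dual (b.coord i)
  choose d hdX hdB using hd
  have hdd : ∀ i j, Bf r (b i).1 (d j) = if i = j then 1 else 0 := by
    intro i j; rw [hdB]; simp [Finsupp.single_apply]
  have hdf : ∀ j, R^[n] (d j) = d j := by
    intro j
    have hm : R^[n] (d j) - d j ∈ Xb k cl (r j0) := by
      refine Submodule.sub_mem _ ?_ (hdX j)
      have := h.RXI n (hdX j)
      rwa [(hrev j0 n).2 hnj] at this
    have : R^[n] (d j) - d j = 0 := by
      refine h.nd hm ?_
      rw [h.rr]
      intro y hy
      have hy' : y = (∑ i, b.repr ⟨y, hy⟩ i • b i : Xb k cl j0).1 := by rw [b.sum_repr]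
      rw [Bf_comm h.rr, hy']
      rw [AddSubmonoidClass.coe_finsetSum]
      have hs : ∀ (s : Finset {j // cl j = cl j0}) (f : _ → I → k) z, Bf r (∑ i ∈ s, f i) z
          = ∑ i ∈ s, Bf r (f i) z := by
        intro s f z
        induction s using Finset.induction_on with
        | empty => simp [Bf]
        | insert a s ha ih => rw [Finset.sum_insert ha, Finset.sum_insert ha, Bf_al, ih]
      rw [hs]
      refine Finset.sum_eq_zero fun i _ => ?_
      rw [Submodule.coe_smul, Bf_sl, Bf_subr]
      conv_lhs => enter [2, 1]; rw [← hb i]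
      rw [h.RBI, hdd]
      have : p ^ n ≠ 0 := pow_ne_zero _ (Fact.out : p.Prime).ne_zero
      split_ifs
      · simp
      · rw [zero_pow this]; simp
    exact sub_eq_zero.1 this
  let f : I → I → k := fun u => if hu : cl u = cl j0 then (b ⟨u, hu⟩).1 else
    if hu : cl (r u) = cl j0 then d ⟨r u, hu⟩ else 0
  have hf1 : ∀ u (hu : cl u = cl j0), f u = (b ⟨u, hu⟩).1 := fun u hu => by simp [f, hu]
  have hf2 : ∀ u (hu : cl (r u) = cl j0), f u = d ⟨r u, hu⟩ := fun u hu => by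
    have : cl u ≠ cl j0 := by rw [← hu]; exact (h.nr u).symm
    simp [f, hu, this]
  have hfR : ∀ u, (cl u = cl j0 ∨ cl (r u) = cl j0) → ∀ c, π^[c] u = u → R^[c] (f u) = f u := by
    rintro u (hu | hu) c hc
    · obtain ⟨t, rfl⟩ := hdvd u hu c hc
      apply h.R_mul; rw [hf1 u hu]; exact hb _
    · obtain ⟨t, rfl⟩ := hdvd (r u) hu c ((hrev u c).2 hc)
      apply h.R_mul; rw [hf2 u hu]; exact hdf _
  have hcontra : ∀ u v c, cl u = cl j0 → cl (r v) = cl j0 → cl (π^[c] u) ≠ cl v := by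
    intro u v c hu hv e
    apply hno c
    rw [← h.piI c hu, e, ← h.clr_iff, h.rr, hv]
  have hback : ∀ u v c, π^[c] u = v → ∃ c', π^[c'] v = u := by
    intro u v c e
    refine ⟨(N - 1) * c, ?_⟩
    rw [← e, ← Function.iterate_add_apply]
    have : (N - 1) * c + c = N * c := by
      obtain ⟨M, rfl⟩ : ∃ M, N = M + 1 := ⟨N - 1, by omega⟩
      simp; ring
    rw [this, Function.iterate_mul]
    exact Function.iterate_fixed (hN u) c
  have hbackc : ∀ u v c, cl (π^[c] u) = cl v → ∃ c', cl (π^[c'] v) = cl u := by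
    intro u v c e
    obtain ⟨c', hc'⟩ := hback u _ c rfl
    exact ⟨c', by rw [← h.piI c' e, hc']⟩
  refine ⟨{u | cl u = cl j0 ∨ cl (r u) = cl j0}, f, ?_, ?_, hfR, ?_, ?_, ?_, ?_⟩
  · exact Or.inl rfl
  · rintro u (hu | hu)
    · rw [hf1 u hu, ← Xb_congr hu]; exact (b _).2
    · have : cl u = cl (r j0) := by rw [← h.clr_iff, h.rr, hu]
      rw [hf2 u hu, ← Xb_congr this]; exact hdX _
  · rintro u hu v hv c hc
    have hcc : π^[c] v = v := by
      apply h.o1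
      rw [hc]
      rcases hu with hu | hu <;> rcases hv with hv | hv
      · exact absurd hc (hcontra v (r u) c hv (by rw [h.rr, hu]))
      · rw [← h.clr_iff, h.rr, hu, hv]
      · rw [hu, hv]
      · obtain ⟨c', hc'⟩ := hbackc _ _ _ hc
        exact absurd hc' (hcontra (r u) v c' hu hv)
    rw [hfR v hv c hcc, hcc]
    rw [hcc] at hc
    rcases hu with hu | hu
    · have hv' : cl (r v) = cl j0 := by rw [h.clr _ _ hc, h.rr, hu]
      rw [hf1 u hu, hf2 v hv', hdd]
      congr 1
      simp only [Subtype.mk.injEq, eq_iff_iff]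
      exact ⟨fun e => by rw [e, h.rr], fun e => by rw [e, h.rr]⟩
    · have hv' : cl v = cl j0 := by rw [hc, hu]
      rw [hf2 u hu, hf1 v hv', Bf_comm h.rr, hdd]
      congr 1
      simp only [Subtype.mk.injEq, eq_iff_iff]
  · rintro u hu v hv c hc
    rw [← hc]
    symm
    apply h.o1
    rw [hc]
    rcases hu with hu | hu <;> rcases hv with hv | hv
    · rw [hu, hv]
    · exact absurd (congrArg cl hc) (hcontra u v c hu hv)
    · obtain ⟨c', hc'⟩ := hback _ _ _ hc
      exact absurd (congrArg cl hc') (hcontra v u c' hv hu)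
    · rw [← h.clr_iff, hu, hv]
  · rintro u hu v hv
    rcases hu with hu | hu
    · exact Or.inl (hv.trans hu)
    · exact Or.inr ((h.clr _ _ hv).trans hu)
  · rintro u hu
    refine ⟨r u, ?_, 0, rfl⟩
    rcases hu with hu | hu
    · exact Or.inr (by rw [h.rr, hu])
    · exact Or.inl hu

lemma frame2 (h : BL p π r cl R) (j0 : I) (hex : ∃ c, cl (π^[c] j0) = cl (r j0)) : 
    ∃ Z f, Frame π r cl R j0 Z f := by
  classical
  set n := Function.minimalPeriod π j0 with hn
  obtain ⟨N, hN1, hN⟩ := h.exists_per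
  have hn1 : 1 ≤ n := Function.minimalPeriod_pos_of_mem_periodicPts ⟨N, hN1, hN j0⟩
  have hnj : π^[n] j0 = j0 := Function.iterate_minimalPeriod
  have hdvd : ∀ u, cl u = cl j0 → ∀ c, π^[c] u = u → n ∣ c := by
    intro u hu c hc
    exact Function.IsPeriodicPt.minimalPeriod_dvd ((h.per_iff hu c).1 hc)
  obtain ⟨m, hm, hmin⟩ : ∃ m, cl (π^[m] j0) = cl (r j0) ∧ ∀ c < m, cl (π^[c] j0) ≠ cl (r j0) :=
    ⟨Nat.find hex, Nat.find_spec hex, fun j hj => Nat.find_min hex hj⟩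
  have hpos : ∀ c, cl (π^[c] j0) = cl (r j0) → c ≠ 0 := by
    rintro c hc rfl
    exact h.nr j0 hc.symm
  have hm1 : 1 ≤ m := Nat.one_le_iff_ne_zero.2 (hpos m hm)
  have h2m : π^[m + m] j0 = j0 := by
    apply h.o1
    rw [Function.iterate_add_apply, h.piI m hm, h.rpiI, h.clr _ _ hm, h.rr]
  have hnm : n = m + m := by
    obtain ⟨t, ht⟩ := hdvd j0 rfl _ h2m
    have hlt : m < n := by
      by_contra hle
      have e : π^[m - n] j0 = π^[m] j0 := by
        conv_rhs => rw [show m = (m - n) + n by omega, Function.iterate_add_apply, hnj]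
      exact hmin (m - n) (by omega) (by rw [e, hm])
    have : t = 1 := by
      have h1 : t < 2 := by
        by_contra hh
        have : n * 2 ≤ n * t := Nat.mul_le_mul_left n (by omega)
        omega
      have h2 : t ≠ 0 := by rintro rfl; omega
      omega
    subst this; omega
  have hcm : ∀ c, cl (π^[c] j0) = cl (r j0) → ∃ t, c = m + n * t := by
    intro c hc
    have hle : m ≤ c := by by_contra hh; exact hmin c (by omega) hc
    have : π^[c - m] (π^[m] j0) = π^[m] j0 := by
      apply h.o1
      rw [← Function.iterate_add_apply, Nat.sub_add_cancel hle, hc, hm]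
    rw [← Function.iterate_add_apply, add_comm, Function.iterate_add_apply] at this
    have := (π.injective.iterate m) this
    obtain ⟨t, ht⟩ := hdvd j0 rfl _ this
    exact ⟨t, by omega⟩
  have h2mu : ∀ u, cl u = cl j0 → π^[m] (π^[m] u) = u := by
    intro u hu
    rw [← Function.iterate_add_apply]
    exact (h.per_iff hu _).2 h2m
  have hclm : ∀ u, cl u = cl j0 → cl (π^[m] (r u)) = cl j0 := by
    intro u hu
    rw [h.rpiI, ← h.rr j0, h.clr_iff, h.piI m hu, hm]
  -- the form
  let b : Xb k cl j0 → Xb k cl j0 → k := fun x y => Bf r x.1 (R^[m] y.1)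
  have hRm : ∀ y : Xb k cl j0, R^[m] y.1 ∈ Xb k cl (r j0) := fun y => by
    have := h.RXI m y.2; rwa [Xb_congr hm.symm] at this
  let F : Xb k cl j0 →+ Xb k cl (r j0) := AddMonoidHom.mk' (fun y => ⟨R^[m] y, hRm y⟩)
    (fun x y => by ext; simp [h.RaI])
  have hFs : Function.Surjective F := by
    refine semi_surj (iterateFrobeniusEquiv k p m) F (fun a x => Subtype.ext ?_)
      (fun x hx => Subtype.ext (h.Rinj m x (congrArg Subtype.val hx))) ?_
    · show R^[m] (a • x.1) = _
      rw [h.RsI, iterateFrobeniusEquiv_def]; rfl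
    · rw [← finrank_Xb, ← finrank_Xb]
      refine Fintype.card_congr ⟨fun u => ⟨r u.1, h.clr _ _ u.2⟩, 
        fun u => ⟨r u.1, by rw [h.clr _ _ u.2, h.rr]⟩, fun u => ?_, fun u => ?_⟩ <;> simp [h.rr]
  have hb : SF (p ^ m) b :=
    { al := fun x y z => Bf_al _ _ _
      ar := fun x y z => by simp only [b, Submodule.coe_add, h.RaI, Bf_ar]
      sl := fun a x y => Bf_sl _ _ _
      sr := fun a x y => by simp only [b, Submodule.coe_smul, h.RsI, Bf_sr]
      ndl := fun x hx => Subtype.ext (h.nd x.2 (fun y hy => by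
        obtain ⟨z, hz⟩ := hFs ⟨y, hy⟩
        have := hx z
        rwa [show y = R^[m] z.1 from (congrArg Subtype.val hz).symm]))
      ndr := fun y hy => Subtype.ext (h.Rinj m _ (h.nd (hRm y) (fun x hx => by
        rw [h.rr] at hx
        rw [Bf_comm h.rr]; exact hy ⟨x, hx⟩))) }
  let θ : Equiv.Perm {u // cl u = cl j0} :=
    ⟨fun u => ⟨π^[m] (r u.1), hclm _ u.2⟩, fun u => ⟨π^[m] (r u.1), hclm _ u.2⟩,
      fun u => Subtype.ext (by
        show π^[m] (r (π^[m] (r u.1))) = u.1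
        rw [h.rpiI m u.1, h.rr, h2mu _ u.2]),
      fun u => Subtype.ext (by
        show π^[m] (r (π^[m] (r u.1))) = u.1
        rw [h.rpiI m u.1, h.rr, h2mu _ u.2])⟩
  obtain ⟨f0, hf0⟩ := hb.exists_frame hm1 (finrank_Xb cl j0) θ
  have hθ : ∀ u v : {u // cl u = cl j0}, v = θ u ↔ π^[m] v.1 = r u.1 := by
    intro u v
    rw [Subtype.ext_iff]
    show v.1 = π^[m] (r u.1) ↔ _
    constructor
    · intro e; rw [e, h.rpiI m, h.rpiI m, h2mu _ u.2]
    · intro e; rw [← e, h2mu _ v.2]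
  have hθs : ∀ u v : {u // cl u = cl j0}, v = θ u ↔ u = θ v := by
    intro u v
    rw [hθ u v, hθ v u]
    constructor
    · intro e; rw [← h.rr (π^[m] u.1), ← h.rpiI, ← e, h2mu _ v.2]
    · intro e; rw [← h.rr (π^[m] v.1), ← h.rpiI, ← e, h2mu _ u.2]
  have hfix : ∀ u, R^[n] (f0 u).1 = (f0 u).1 := by
    intro u
    have hX : R^[n] (f0 u).1 ∈ Xb k cl j0 := by
      have := h.RXI n (f0 u).2; rwa [hnj] at this
    have hz : ∀ v, b (⟨R^[n] (f0 u).1, hX⟩ - f0 u) (f0 v) = 0 := by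
      intro v
      show Bf r (R^[n] (f0 u).1 - (f0 u).1) (R^[m] (f0 v).1) = 0
      rw [Bf_subl]
      have e1 : Bf r (R^[n] (f0 u).1) (R^[m] (f0 v).1) = b (f0 v) (f0 u) ^ p ^ m := by
        rw [hnm, Function.iterate_add_apply, h.RBI, Bf_comm h.rr]
      rw [e1, show Bf r (f0 u).1 (R^[m] (f0 v).1) = b (f0 u) (f0 v) from rfl, hf0, hf0]
      have hp : p ^ m ≠ 0 := pow_ne_zero _ (Fact.out : p.Prime).ne_zero
      by_cases e : v = θ u
      · rw [if_pos e, if_pos ((hθs u v).1 e)]; simp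
      · rw [if_neg e, if_neg (fun e' => e ((hθs u v).2 e')), zero_pow hp, sub_zero]
    -- f0 spans
    have hli : LinearIndependent k f0 := by
      rw [Fintype.linearIndependent_iff]
      intro c hc i
      have : b (∑ j, c j • f0 j) (f0 (θ i)) = 0 := by rw [hc, hb.zl]
      rw [hb.suml] at this
      simpa [hb.sl, hf0] using this
    have hsp := hli.span_eq_top_of_card_eq_finrank' (finrank_Xb cl j0)
    have h0 : (⟨R^[n] (f0 u).1, hX⟩ - f0 u : Xb k cl j0) = 0 := by
      apply hb.ndl
      intro y
      have hy : y ∈ Submodule.span k (Set.range f0) := by rw [hsp]; trivial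
      induction hy using Submodule.span_induction with
      | mem x hx => obtain ⟨v, rfl⟩ := hx; exact hz v
      | zero => exact hb.zr (pow_pos (Fact.out : p.Prime).pos _) _
      | add x y _ _ hx hy => rw [hb.ar, hx, hy, add_zero]
      | smul a x _ hx => rw [hb.sr, hx, mul_zero]
    exact congrArg Subtype.val (sub_eq_zero.1 h0)
  let f : I → I → k := fun u => if hu : cl u = cl j0 then (f0 ⟨u, hu⟩).1 else 0
  have hf : ∀ u (hu : cl u = cl j0), f u = (f0 ⟨u, hu⟩).1 := fun u hu => by simp [f, hu]
  have hfR : ∀ u, cl u = cl j0 → ∀ c, π^[c] u = u → R^[c] (f u) = f u := by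
    rintro u hu c hc
    obtain ⟨t, rfl⟩ := hdvd u hu c hc
    apply h.R_mul; rw [hf u hu]; exact hfix _
  refine ⟨{u | cl u = cl j0}, f, rfl, ?_, hfR, ?_, ?_, ?_, ?_⟩
  · intro u hu
    rw [hf u hu, ← Xb_congr hu]; exact (f0 _).2
  · intro u hu v hv c hc
    have h1 : cl (π^[c] j0) = cl (r j0) := by
      rw [← h.piI c hv, hc, h.clr _ _ hu]
    obtain ⟨t, rfl⟩ := hcm c h1
    have e1 : R^[m + n * t] (f v) = R^[m] (f v) := by
      rw [Function.iterate_add_apply]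
      congr 1
      apply h.R_mul; rw [hf v hv]; exact hfix _
    have e2 : π^[m + n * t] v = π^[m] v := by
      rw [Function.iterate_add_apply]
      congr 1
      rw [Function.iterate_mul]
      exact Function.iterate_fixed ((h.per_iff hv n).2 hnj) t
    rw [e1, e2, hf u hu, hf v hv]
    rw [show Bf r (f0 ⟨u, hu⟩).1 (R^[m] (f0 ⟨v, hv⟩).1) = b (f0 ⟨u, hu⟩) (f0 ⟨v, hv⟩) from rfl, hf0]
    congr 1
    exact propext (hθ _ _)
  · intro u hu v hv c hc
    rw [← hc]
    symm
    apply h.o1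
    rw [hc]
    exact Eq.trans hv hu.symm
  · intro u hu v hv
    exact Eq.trans hv hu
  · intro u hu
    refine ⟨π^[m] (r u), hclm u hu, m, ?_⟩
    rw [h.rpiI m, h.rpiI m, h2mu u hu]

lemma exists_frame (h : BL p π r cl R) (j0 : I) : ∃ Z f, Frame π r cl R j0 Z f := by
  by_cases hex : ∃ c, cl (π^[c] j0) = cl (r j0)
  · exact h.frame2 j0 hex
  · push Not at hex; exact h.frame1 j0 hex

/-- generating relation -/
def genRel (π : Equiv.Perm I) (r : I → I) (cl : I → κ) (i j : I) : Prop :=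
  cl i = cl j ∨ j = π i ∨ j = r i

theorem main (h : BL p π r cl R) : ∃ f : I → I → k, (∀ i, f i ∈ Xb k cl i) ∧ (∀ i, R (f i) = f (π i)) ∧
    ∀ i j, Bf r (f i) (f j) = if j = r i then 1 else 0 := by
  classical
  obtain ⟨N, hN1, hN⟩ := h.exists_per
  have hback : ∀ u v c, π^[c] u = v → ∃ c', π^[c'] v = u := by
    intro u v c e
    refine ⟨(N - 1) * c, ?_⟩
    rw [← e, ← Function.iterate_add_apply]
    have : (N - 1) * c + c = N * c := by
      obtain ⟨M, rfl⟩ : ∃ M, N = M + 1 := ⟨N - 1, by omega⟩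
      simp; ring
    rw [this, Function.iterate_mul]
    exact Function.iterate_fixed (hN u) c
  choose Z F hF using h.exists_frame
  have hreach : ∀ j0 i, Relation.EqvGen (genRel π r cl) j0 i → ∃ u ∈ Z j0, ∃ a, π^[a] u = i := by
    intro j0 i hi
    have key : ∀ x y, Relation.EqvGen (genRel π r cl) x y → 
        ((∃ u ∈ Z j0, ∃ a, π^[a] u = x) ↔ (∃ u ∈ Z j0, ∃ a, π^[a] u = y)) := by
      intro x y hxy
      induction hxy with
      | rel x y hxy =>
        rcases hxy with hxy | hxy | hxy
        · have : ∀ x y, cl x = cl y → (∃ u ∈ Z j0, ∃ a, π^[a] u = x) → 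
              (∃ u ∈ Z j0, ∃ a, π^[a] u = y) := by
            rintro x y hxy ⟨u, hu, a, ha⟩
            obtain ⟨c, hc⟩ := hback _ _ _ ha
            obtain ⟨c', hc'⟩ := hback y _ c rfl
            exact ⟨π^[c] y, (hF j0).P5 u hu _ (by rw [← h.piI c hxy, hc]), c', hc'⟩
          exact ⟨this x y hxy, this y x hxy.symm⟩
        · subst hxy
          constructor
          · rintro ⟨u, hu, a, ha⟩
            exact ⟨u, hu, a + 1, by rw [Function.iterate_succ_apply', ha]⟩
          · rintro ⟨u, hu, a, ha⟩
            obtain ⟨c, hc⟩ := hback x (π x) 1 rfl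
            exact ⟨u, hu, c + a, by rw [Function.iterate_add_apply, ha, hc]⟩
        · have : ∀ x, (∃ u ∈ Z j0, ∃ a, π^[a] u = x) → 
              (∃ u ∈ Z j0, ∃ a, π^[a] u = r x) := by
            rintro x ⟨u, hu, a, ha⟩
            obtain ⟨v, hv, c, hc⟩ := (hF j0).P6 u hu
            exact ⟨v, hv, a + c, by rw [Function.iterate_add_apply, hc, h.rpiI, ha]⟩
          subst hxy
          exact ⟨this x, fun hh => by have := this _ hh; rwa [h.rr] at this⟩
      | refl x => rfl
      | symm x y _ ih => exact ih.symm
      | trans x y z _ _ h1 h2 => exact h1.trans h2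
    exact (key j0 i hi).1 ⟨j0, (hF j0).mem, 0, rfl⟩
  let st : Setoid I := Relation.EqvGen.setoid (genRel π r cl)
  let rep : I → I := fun i => (Quotient.mk st i).out
  have hrep : ∀ i, Relation.EqvGen (genRel π r cl) (rep i) i := fun i =>
    Quotient.exact (s := st) (Quotient.out_eq _)
  have hrepeq : ∀ i j, genRel π r cl i j → rep i = rep j := by
    intro i j hij
    have : Quotient.mk st i = Quotient.mk st j := Quotient.sound (s := st) (Relation.EqvGen.rel _ _ hij)
    simp only [rep, this]
  choose U hU A hA using fun i => hreach (rep i) i (hrep i)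
  have wd : ∀ j0, ∀ u ∈ Z j0, ∀ a b, a ≤ b → π^[a] u = π^[b] u → R^[a] (F j0 u) = R^[b] (F j0 u) := by
    intro j0 u hu a b hab e
    obtain ⟨d, rfl⟩ := Nat.exists_eq_add_of_le hab
    rw [Function.iterate_add_apply] at e
    have := π.injective.iterate a e
    rw [Function.iterate_add_apply, (hF j0).P2 u hu d this.symm]
  have wd' : ∀ j0, ∀ u ∈ Z j0, ∀ v ∈ Z j0, ∀ a b, π^[a] u = π^[b] v → 
      R^[a] (F j0 u) = R^[b] (F j0 v) := by
    intro j0 u hu v hv a b e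
    obtain ⟨c, hc⟩ := hback v _ b rfl
    have : u = v := (hF j0).P4 u hu v hv (c + a) (by rw [Function.iterate_add_apply, e, hc])
    subst this
    rcases le_total a b with hab | hab
    · exact wd j0 u hu a b hab e
    · exact (wd j0 u hu b a hab e.symm).symm
  have hX : ∀ i, R^[A i] (F (rep i) (U i)) ∈ Xb k cl i := by
    intro i
    have := h.RXI (A i) ((hF (rep i)).P1 _ (hU i))
    rwa [hA i] at this
  refine ⟨fun i => R^[A i] (F (rep i) (U i)), hX, ?_, ?_⟩
  · intro i
    have e : rep (π i) = rep i := (hrepeq i (π i) (Or.inr (Or.inl rfl))).symm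
    have h1 := hU (π i)
    beta_reduce
    rw [← Function.iterate_succ_apply' (⇑R)]
    rw [e] at h1 ⊢
    apply wd' (rep i) _ (hU i) _ h1
    rw [hA, Function.iterate_succ_apply', hA]
  · intro i j
    by_cases hij : cl j = cl (r i)
    · have e1 : rep (r i) = rep i := (hrepeq i (r i) (Or.inr (Or.inr rfl))).symm
      have e2 : rep j = rep (r i) := hrepeq _ _ (Or.inl hij)
      have e := e2.trans e1
      have h1 := hU j
      beta_reduce
      rw [e] at h1 ⊢
      have main : ∀ u ∈ Z (rep i), ∀ v ∈ Z (rep i), ∀ a b, a ≤ b → cl (π^[b] v) = cl (r (π^[a] u)) →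
          Bf r (R^[a] (F (rep i) u)) (R^[b] (F (rep i) v)) = if π^[b] v = r (π^[a] u) then 1 else 0 := by
        intro u hu v hv a b hab hcl
        obtain ⟨d, rfl⟩ := Nat.exists_eq_add_of_le hab
        have hcl' : cl (π^[d] v) = cl (r u) := by
          obtain ⟨c, hc⟩ := hback _ _ a (rfl : π^[a] u = π^[a] u)
          have hh := h.piI (N * a - a) hcl
          have hNa : ∀ x, π^[N * a - a] (π^[a] x) = x := by
            intro x
            rw [← Function.iterate_add_apply, Nat.sub_add_cancel (Nat.le_mul_of_pos_left a hN1),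
              Function.iterate_mul]
            exact Function.iterate_fixed (hN x) a
          rwa [Function.iterate_add_apply, hNa, ← h.rpiI, hNa] at hh
        rw [Function.iterate_add_apply, h.RBI, (hF (rep i)).P3 u hu v hv d hcl']
        have hiff : π^[a + d] v = r (π^[a] u) ↔ π^[d] v = r u := by
          rw [Function.iterate_add_apply, ← h.rpiI]
          exact (π.injective.iterate a).eq_iff
        have hp : p ^ a ≠ 0 := pow_ne_zero _ (Fact.out : p.Prime).ne_zero
        by_cases hc : π^[d] v = r u
        · rw [if_pos hc, if_pos (hiff.2 hc), one_pow]
        · rw [if_neg hc, if_neg (fun e => hc (hiff.1 e)), zero_pow hp]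
      rcases le_total (A i) (A j) with hle | hle
      · rw [main _ (hU i) _ h1 _ _ hle (by rw [hA, hA, hij]), hA, hA]
      · rw [Bf_comm h.rr, main _ h1 _ (hU i) _ _ hle (by
          rw [hA, hA, ← h.rr i, h.clr_iff, hij]), hA, hA]
        congr 1
        exact propext ⟨fun e => by rw [e, h.rr], fun e => by rw [e, h.rr]⟩
    · rw [h.perp_Xb hij (hX i) (hX j), if_neg]
      rintro rfl; exact hij rfl

end BL
end blocklang
end ZipOrb

namespace ZipOrb
set_option linter.unusedSectionVars false
set_option linter.unusedSimpArgs false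

/-- the standing symplectic assumptions -/
structure SS {k H : Type*} [Field k] [AddCommGroup H] [Module k H] (g : ℕ)
    (ω : H →ₗ[k] H →ₗ[k] k) : Prop where
  alt : ∀ x, ω x x = 0
  nd : ∀ x, (∀ y, ω x y = 0) → x = 0
  dim : Module.finrank k H = 2 * g

section sympl
variable {k H : Type*} [Field k] [AddCommGroup H] [Module k H] [FiniteDimensional k H]

/-- adapted bases for chains -/
lemma chain_basis (m : ℕ) : ∀ (D : Submodule k H) (C : Set (Submodule k H))
    (_ : IsChain (· ≤ ·) C) (_ : ∀ X ∈ C, X ≤ D) (_ : Module.finrank k D = m),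
    ∃ d : Fin m → H, LinearIndependent k d ∧ Submodule.span k (Set.range d) = D ∧
      ∀ X ∈ C, X = Submodule.span k (d '' {i | i.val < Module.finrank k X}) := by
  induction m with
  | zero =>
    intro D C hC hD hd
    have : D = ⊥ := Submodule.finrank_eq_zero.1 hd
    subst this
    refine ⟨Fin.elim0, linearIndependent_empty_type, by simp, ?_⟩
    intro X hX
    have : X = ⊥ := le_bot_iff.1 (hD X hX)
    subst this
    symm; rw [eq_bot_iff, Submodule.span_le]
    rintro _ ⟨i, _⟩; exact i.elim0
  | succ m ih =>
    intro D C hC hD hd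
    obtain ⟨M, hMD, hM⟩ : ∃ M, M < D ∧ ∀ X ∈ C, X ≠ D → X ≤ M := by
      by_cases hne : ∃ X ∈ C, X ≠ D
      · obtain ⟨M, ⟨hMC, hMD⟩, hmax⟩ := (wellFounded_gt (α := Submodule k H)).has_min
          {X | X ∈ C ∧ X ≠ D} hne
        refine ⟨M, lt_of_le_of_ne (hD M hMC) hMD, fun X hX hXD => ?_⟩
        rcases hC.total hX hMC with h | h
        · exact h
        · by_contra h2
          exact hmax X ⟨hX, hXD⟩ (lt_of_le_not_ge h h2)
      · push Not at hne
        refine ⟨⊥, bot_lt_iff_ne_bot.2 ?_, fun X hX h => absurd (hne X hX) h⟩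
        rintro rfl; simp at hd
    obtain ⟨x, hxD, hxM⟩ := SetLike.exists_of_lt hMD
    obtain ⟨f, hfx, hfM⟩ := Submodule.exists_le_ker_of_notMem hxM
    have hxD' : x ∉ D ⊓ LinearMap.ker f := fun h => hfx (LinearMap.mem_ker.1 h.2)
    have hdec : ∀ y ∈ D, ∃ z ∈ D ⊓ LinearMap.ker f, ∃ a : k, y = z + a • x := by
      intro y hy
      refine ⟨y - (f y / f x) • x, ⟨D.sub_mem hy (D.smul_mem _ hxD), ?_⟩, f y / f x, by simp⟩
      show f (y - (f y / f x) • x) = 0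
      rw [map_sub, map_smul, smul_eq_mul]; field_simp; simp
    have hdim : Module.finrank k (D ⊓ LinearMap.ker f : Submodule k H) = m := by
      have h1 : D ⊓ LinearMap.ker f < D := lt_of_le_of_ne inf_le_left fun e => hxD' (e.ge hxD)
      have h1 := Submodule.finrank_lt_finrank_of_lt h1
      have h2 : D ≤ D ⊓ LinearMap.ker f ⊔ Submodule.span k {x} := by
        intro y hy
        obtain ⟨z, hz, a, rfl⟩ := hdec y hy
        exact Submodule.add_mem_sup hz (Submodule.mem_span_singleton.2 ⟨a, rfl⟩)
      have h2 := Submodule.finrank_mono h2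
      have h3 := Submodule.finrank_add_le_finrank_add_finrank (D ⊓ LinearMap.ker f) (Submodule.span k {x})
      have h4 := finrank_span_le_card (R := k) ({x} : Set H)
      simp at h4
      omega
    obtain ⟨d, hli, hsp, hX⟩ := ih (D ⊓ LinearMap.ker f) {X | X ∈ C ∧ X ≠ D}
      (hC.mono fun X hX => hX.1)
      (fun X hX => le_inf (hD X hX.1) ((hM X hX.1 hX.2).trans hfM)) hdim
    have hsp' : Submodule.span k (Set.range (Fin.snoc d x : Fin (m+1) → H)) = D := by
      apply le_antisymm
      · rw [Submodule.span_le]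
        rintro _ ⟨i, rfl⟩
        refine Fin.lastCases ?_ (fun i => ?_) i
        · simpa using hxD
        · simp only [Fin.snoc_castSucc]
          have : d i ∈ D ⊓ LinearMap.ker f := by rw [← hsp]; exact Submodule.subset_span ⟨i, rfl⟩
          exact this.1
      · intro y hy
        obtain ⟨z, hz, a, rfl⟩ := hdec y hy
        refine Submodule.add_mem _ ?_ (Submodule.smul_mem _ _ (Submodule.subset_span ⟨Fin.last m, by simp⟩))
        rw [← hsp] at hz
        refine Submodule.span_mono ?_ hz
        rintro _ ⟨i, rfl⟩
        exact ⟨i.castSucc, by simp⟩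
    refine ⟨Fin.snoc d x, ?_, hsp', ?_⟩
    · rw [linearIndependent_finSnoc, hsp]; exact ⟨hli, hxD'⟩
    · intro X hXC
      by_cases hXD : X = D
      · subst hXD
        rw [hd]
        conv_lhs => rw [← hsp']
        congr 1
        rw [← Set.image_univ]
        congr 1
        ext i; simp; omega
      · conv_lhs => rw [hX X ⟨hXC, hXD⟩]
        have hlt : Module.finrank k X ≤ m := by
          have := Submodule.finrank_lt_finrank_of_lt (lt_of_le_of_ne (hD X hXC) hXD)
          omega
        congr 1
        ext y
        constructor
        · rintro ⟨i, hi, rfl⟩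
          exact ⟨i.castSucc, by simpa using hi, by simp⟩
        · rintro ⟨i, hi, rfl⟩
          have hi : i.val < Module.finrank k X := hi
          have him : i.val < m := by omega
          refine ⟨⟨i.val, him⟩, hi, ?_⟩
          exact (Fin.snoc_castSucc (α := fun _ => H) x d ⟨i.val, him⟩).symm

variable {g : ℕ} {ω : H →ₗ[k] H →ₗ[k] k}

namespace SS

lemma skew (hS : SS g ω) (x y : H) : ω x y = - ω y x := by
  have := hS.alt (x + y)
  simp only [map_add, LinearMap.add_apply, hS.alt, zero_add, add_zero] at this
  linear_combination this

lemma nd' (hS : SS g ω) (x : H) (h : ∀ y, ω y x = 0) : x = 0 :=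
  hS.nd x fun y => by rw [hS.skew, h, neg_zero]

lemma ext (hS : SS g ω) {x y : H} (h : ∀ z, ω x z = ω y z) : x = y := by
  rw [← sub_eq_zero]; apply hS.nd; intro z; simp [h]

lemma nondeg (hS : SS g ω) : LinearMap.BilinForm.Nondegenerate (ω : LinearMap.BilinForm k H) :=
  ⟨hS.nd, hS.nd'⟩

lemma perp_eq (hS : SS g ω) (F : Submodule k H) : perp ω F = LinearMap.BilinForm.orthogonal (ω : LinearMap.BilinForm k H) F := by
  ext x
  rw [LinearMap.BilinForm.mem_orthogonal_iff]
  show (∀ y ∈ F, ω x y = 0) ↔ ∀ y ∈ F, ω y x = 0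
  refine forall₂_congr fun y _ => ?_
  rw [hS.skew, neg_eq_zero]

lemma finrank_perp (hS : SS g ω) (F : Submodule k H) : Module.finrank k (perp ω F) + Module.finrank k F = 2 * g := by
  rw [hS.perp_eq, LinearMap.BilinForm.finrank_orthogonal hS.nondeg, hS.dim]
  have := Submodule.finrank_le F
  rw [hS.dim] at this; omega

lemma perp_perp (hS : SS g ω) (F : Submodule k H) : perp ω (perp ω F) = F := by
  rw [hS.perp_eq, hS.perp_eq]
  refine LinearMap.BilinForm.orthogonal_orthogonal hS.nondeg ?_ F
  intro x y h
  rw [hS.skew, h, neg_zero]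

lemma perp_anti (hS : SS g ω) {F G : Submodule k H} (h : F ≤ G) : perp ω G ≤ perp ω F :=
  fun _ hx y hy => hx y (h hy)

lemma perp_bot (hS : SS g ω) : perp ω (⊥ : Submodule k H) = ⊤ := by
  rw [eq_top_iff]; intro x _ y hy; rw [(Submodule.mem_bot k).1 hy, map_zero]

lemma perp_top (hS : SS g ω) : perp ω (⊤ : Submodule k H) = ⊥ := by
  rw [← hS.perp_bot, hS.perp_perp]

lemma lag_finrank (hS : SS g ω) {F : Submodule k H} (h : IsLagrangian ω F) : Module.finrank k F = g := by
  have := hS.finrank_perp F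
  rw [show perp ω F = F from h] at this; omega

end SS

/-- signs -/
def ep (k : Type*) [Field k] {g : ℕ} (i : Fin (2*g)) : k := if i.val < g then 1 else -1

lemma ep_sq (i : Fin (2*g)) : ep k i * ep k i = 1 := by
  unfold ep; split_ifs <;> simp

lemma ep_rev (i : Fin (2*g)) : ep k (Fin.rev i) = - ep k i := by
  have := i.2
  unfold ep; rw [Fin.val_rev]
  split_ifs <;> first | omega | simp

lemma ep_ne (i : Fin (2*g)) : ep k i ≠ 0 := by
  intro h; have := ep_sq (k := k) i; rw [h] at this; simp at this

/-- symplectic bases -/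
def Symp (ω : H →ₗ[k] H →ₗ[k] k) (e : Fin (2*g) → H) : Prop :=
  ∀ i j, ω (e i) (e j) = if j = Fin.rev i then ep k i else 0

/-- standard flag -/
def W (k : Type*) {H : Type*} [Field k] [AddCommGroup H] [Module k H] {n : ℕ} (e : Fin n → H) (s : ℕ) :
    Submodule k H := Submodule.span k (e '' {i | i.val < s})

lemma W_mono {n : ℕ} (e : Fin n → H) {s t : ℕ} (h : s ≤ t) : W k e s ≤ W k e t :=
  Submodule.span_mono (Set.image_mono fun i (hi : i.val < s) => lt_of_lt_of_le hi h)

lemma mem_W_of_lt {n : ℕ} (e : Fin n → H) {s : ℕ} {i : Fin n} (h : i.val < s) : e i ∈ W k e s :=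
  Submodule.subset_span ⟨i, h, rfl⟩

lemma W_le_iff {n : ℕ} (e : Fin n → H) {s : ℕ} {X : Submodule k H} :
    W k e s ≤ X ↔ ∀ i : Fin n, i.val < s → e i ∈ X := by
  rw [W, Submodule.span_le]
  constructor
  · intro h i hi; exact h ⟨i, hi, rfl⟩
  · rintro h _ ⟨i, hi, rfl⟩; exact h i hi

lemma W_zero {n : ℕ} (e : Fin n → H) : W k e 0 = ⊥ := by
  rw [eq_bot_iff, W_le_iff]; intro i hi; omega

lemma finrank_W {n : ℕ} {e : Fin n → H} (he : LinearIndependent k e) {s : ℕ} (hs : s ≤ n) :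
    Module.finrank k (W k e s) = s := by
  have : e '' {i | i.val < s} = Set.range (e ∘ Fin.castLE hs) := by
    ext x; constructor
    · rintro ⟨i, hi, rfl⟩; exact ⟨⟨i.val, hi⟩, rfl⟩
    · rintro ⟨i, rfl⟩; exact ⟨Fin.castLE hs i, i.2, rfl⟩
  rw [W, this, finrank_span_eq_card (he.comp _ (Fin.castLE_injective hs)), Fintype.card_fin]

/-- coefficients with respect to a symplectic basis -/
def coef (ω : H →ₗ[k] H →ₗ[k] k) (e : Fin (2*g) → H) (x : H) (i : Fin (2*g)) : k :=
  ep k i * ω x (e (Fin.rev i))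

namespace Symp
variable {e : Fin (2*g) → H}

lemma coef_sum (he : Symp ω e) (c : Fin (2*g) → k) (i : Fin (2*g)) : coef ω e (∑ j, c j • e j) i = c i := by
  unfold coef
  rw [map_sum, LinearMap.sum_apply, Finset.sum_eq_single i]
  · rw [map_smul, LinearMap.smul_apply, he, if_pos rfl, smul_eq_mul]
    linear_combination c i * ep_sq (k := k) i
  · intro j _ hj
    rw [map_smul, LinearMap.smul_apply, he, if_neg, smul_zero]
    intro h; exact hj (Fin.rev_injective h).symm
  · simp

lemma li (he : Symp ω e) : LinearIndependent k e := by
  rw [Fintype.linearIndependent_iff]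
  intro c hc i
  rw [← he.coef_sum c i, hc]; simp [coef]


lemma span_top (he : Symp ω e) (hS : SS g ω) : Submodule.span k (Set.range e) = ⊤ :=
  he.li.span_eq_top_of_card_eq_finrank' (by rw [hS.dim, Fintype.card_fin])

lemma expand (he : Symp ω e) (hS : SS g ω) (x : H) : x = ∑ i, coef ω e x i • e i := by
  have : x ∈ Submodule.span k (Set.range e) := by rw [he.span_top hS]; trivial
  obtain ⟨c, rfl⟩ := (Submodule.mem_span_range_iff_exists_fun k).1 this
  simp_rw [he.coef_sum]

lemma mem_W (he : Symp ω e) (hS : SS g ω) {x : H} {s : ℕ} : x ∈ W k e s ↔ ∀ i : Fin (2*g), s ≤ i.val → ω x (e (Fin.rev i)) = 0 := by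
  constructor
  · intro h i hi
    have : W k e s ≤ LinearMap.ker (ω.flip (e (Fin.rev i))) := by
      rw [W_le_iff]; intro j hj
      rw [LinearMap.mem_ker, LinearMap.flip_apply, he, if_neg]
      intro h; have := Fin.rev_injective h; subst this; omega
    exact LinearMap.mem_ker.1 (this h)
  · intro h
    rw [he.expand hS x]
    refine Submodule.sum_mem _ fun i _ => ?_
    by_cases hi : i.val < s
    · exact Submodule.smul_mem _ _ (mem_W_of_lt e hi)
    · rw [coef, h i (by omega), mul_zero, zero_smul]; exact Submodule.zero_mem _

lemma mem_W' (he : Symp ω e) (hS : SS g ω) {x : H} {s : ℕ} : x ∈ W k e s ↔ ∀ i : Fin (2*g), i.val < 2*g - s → ω x (e i) = 0 := by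
  rw [he.mem_W hS]
  constructor
  · intro h i hi
    have := h (Fin.rev i) (by rw [Fin.val_rev]; omega)
    rwa [Fin.rev_rev] at this
  · intro h i hi
    exact h _ (by rw [Fin.val_rev]; omega)

lemma perp_W (he : Symp ω e) (hS : SS g ω) (s : ℕ) : perp ω (W k e s) = W k e (2*g - s) := by
  ext x
  rw [he.mem_W' hS]
  constructor
  · intro h i hi; 
    exact h _ (mem_W_of_lt e (by omega))
  · intro h
    have : W k e s ≤ LinearMap.ker (ω x) := by
      rw [W_le_iff]; intro j hj
      by_cases hs : s ≤ 2 * g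
      · exact h j (by omega)
      · exact h j (by omega)
    intro y hy; exact LinearMap.mem_ker.1 (this hy)

lemma W_top (he : Symp ω e) (hS : SS g ω) {s : ℕ} (hs : 2*g ≤ s) : W k e s = ⊤ := by
  rw [eq_top_iff]; intro x _; rw [he.mem_W hS]; intro i hi; omega

lemma ext_basis (he : Symp ω e) (hS : SS g ω) {x y : H} (h : ∀ i, ω x (e i) = ω y (e i)) : x = y := by
  rw [he.expand hS x, he.expand hS y]
  simp [coef, h]

end Symp

/-- basis of an isotropic subspace of dimension g extends to a symplectic basis -/
lemma SS.extend (hS : SS g ω) (d : Fin g → H) (hd : LinearIndependent k d)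
    (hiso : ∀ i j, ω (d i) (d j) = 0) :
    ∃ e : Fin (2*g) → H, Symp ω e ∧ ∀ i (h : i.val < g), e i = d ⟨i.val, h⟩ := by
  classical
  let f : H →ₗ[k] (Fin g → k) := LinearMap.pi fun i => ω (d i)
  have hker : LinearMap.ker f = perp ω (Submodule.span k (Set.range d)) := by
    ext x
    constructor
    · intro hx
      have hx : ∀ i, ω (d i) x = 0 := fun i => congrFun (LinearMap.mem_ker.1 hx) i
      have : Submodule.span k (Set.range d) ≤ LinearMap.ker (ω x) := by
        rw [Submodule.span_le]; rintro _ ⟨i, rfl⟩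
        show ω x (d i) = 0
        rw [hS.skew, hx, neg_zero]
      intro y hy; exact LinearMap.mem_ker.1 (this hy)
    · intro hx
      rw [LinearMap.mem_ker]; ext i
      show ω (d i) x = 0
      rw [hS.skew, hx _ (Submodule.subset_span ⟨i, rfl⟩), neg_zero]
  have hsurj : LinearMap.range f = ⊤ := by
    apply Submodule.eq_top_of_finrank_eq
    have h1 := f.finrank_range_add_finrank_ker
    have h2 := hS.finrank_perp (Submodule.span k (Set.range d))
    rw [finrank_span_eq_card hd, Fintype.card_fin] at h2
    rw [hker, hS.dim] at h1
    rw [Module.finrank_pi, Fintype.card_fin]; omega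
  have hy : ∀ j, ∃ y, f y = Pi.single j 1 := fun j => LinearMap.range_eq_top.1 hsurj _
  choose y hy using hy
  have hy : ∀ i j, ω (d i) (y j) = if i = j then 1 else 0 := fun i j => by
    have := congrFun (hy j) i
    rw [Pi.single_apply] at this; exact this
  have hy' : ∀ i j, ω (y j) (d i) = if i = j then -1 else 0 := fun i j => by
    rw [hS.skew, hy]; split_ifs <;> simp
  let z : Fin g → H := fun j => y j + ∑ i, (if j < i then - ω (y j) (y i) else 0) • d i
  have hdz : ∀ i j, ω (d i) (z j) = if i = j then 1 else 0 := by
    intro i j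
    simp only [z, map_add, map_sum, map_smul, hiso, smul_zero, Finset.sum_const_zero, add_zero, hy]
  have hzd : ∀ i j, ω (z j) (d i) = if i = j then -1 else 0 := fun i j => by
    rw [hS.skew, hdz]; split_ifs <;> simp
  have hzz : ∀ i j, ω (z i) (z j) = 0 := by
    intro i j
    have e1 : ω (z i) (z j) = ω (z i) (y j) + ∑ l, (if j < l then - ω (y j) (y l) else 0) * ω (z i) (d l) := by
      simp only [z, map_add, map_sum, map_smul, smul_eq_mul]
    have e2 : ω (z i) (y j) = ω (y i) (y j) + ∑ l, (if i < l then - ω (y i) (y l) else 0) * ω (d l) (y j) := by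
      simp only [z, map_add, map_sum, map_smul, smul_eq_mul, LinearMap.add_apply, LinearMap.sum_apply,
        LinearMap.smul_apply]
    rw [e1, e2]
    simp only [hy, hzd, mul_ite, mul_one, mul_zero, mul_neg, Finset.sum_ite_eq', Finset.mem_univ, if_true]
    rcases lt_trichotomy i j with h | h | h
    · simp [h, h.not_gt]
    · subst h; simp [hS.alt]
    · simp only [h, if_true, h.not_gt, if_false, neg_neg, add_zero]
      rw [hS.skew (y j) (y i)]; ring
  let e : Fin (2*g) → H := fun i => if h : i.val < g then d ⟨i.val, h⟩ else
    z ⟨2*g - 1 - i.val, by omega⟩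
  refine ⟨e, ?_, fun i h => by simp [e, h]⟩
  intro i j
  have hi := i.2
  have hj := j.2
  have hrev : j = Fin.rev i ↔ j.val + i.val + 1 = 2 * g := by
    rw [Fin.ext_iff, Fin.val_rev]; omega
  simp only [e, ep]
  by_cases h1 : i.val < g <;> by_cases h2 : j.val < g
  · simp only [h1, h2, dif_pos, hiso, if_true]
    rw [if_neg]; rw [hrev]; omega
  · simp only [h1, h2, dif_pos, dif_neg, not_false_eq_true, hdz, if_true]
    congr 1
    rw [hrev, Fin.ext_iff]; simp only [eq_iff_iff]; omega
  · simp only [h1, h2, dif_pos, dif_neg, not_false_eq_true, hzd, if_true, if_false]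
    congr 1
    rw [hrev, Fin.ext_iff]; simp only [eq_iff_iff]; omega
  · simp only [h1, h2, dif_neg, not_false_eq_true, hzz, if_false]
    rw [if_neg]; rw [hrev]; omega

lemma SS.exists_lag (hS : SS g ω) : ∃ F, IsLagrangian ω F := by
  obtain ⟨F, hF, hmax⟩ := (wellFounded_gt (α := Submodule k H)).has_min
    {F | F ≤ perp ω F} ⟨⊥, show (⊥ : Submodule k H) ≤ _ from bot_le⟩
  refine ⟨F, le_antisymm ?_ hF⟩
  intro x hx
  by_contra hxF
  refine hmax (F ⊔ Submodule.span k {x}) ?_ (lt_of_le_of_ne le_sup_left fun e => hxF ?_)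
  · show F ⊔ Submodule.span k {x} ≤ perp ω (F ⊔ Submodule.span k {x})
    intro y hy w hw
    obtain ⟨y1, hy1, y2, hy2, rfl⟩ := Submodule.mem_sup.1 hy
    obtain ⟨w1, hw1, w2, hw2, rfl⟩ := Submodule.mem_sup.1 hw
    obtain ⟨a, rfl⟩ := Submodule.mem_span_singleton.1 hy2
    obtain ⟨b, rfl⟩ := Submodule.mem_span_singleton.1 hw2
    simp only [map_add, map_smul, LinearMap.add_apply, LinearMap.smul_apply]
    rw [hF hy1 w1 hw1, hx w1 hw1, hS.alt, hS.skew y1 x, hx y1 hy1]; simp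
  · rw [e]; exact Submodule.mem_sup_right (Submodule.mem_span_singleton_self x)

lemma SS.exists_symp (hS : SS g ω) : ∃ e : Fin (2*g) → H, Symp ω e := by
  obtain ⟨F, hF⟩ := hS.exists_lag
  have hd := hS.lag_finrank hF
  let b := Module.finBasisOfFinrankEq k F hd
  obtain ⟨e, he, _⟩ := hS.extend (fun i => (b i : H))
    (b.linearIndependent.map' F.subtype (Submodule.ker_subtype F)) (fun i j => by
      have : (b i : H) ∈ perp ω F := by rw [show perp ω F = F from hF]; exact (b i).2
      exact this _ (b j).2)
  exact ⟨e, he⟩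

/-- rank-nullity for semilinear maps on submodules -/
lemma semi_rank {p : ℕ} [Fact p.Prime] [CharP k p] [PerfectRing k p]
    (φ : H →ₛₗ[frobenius k p] H) (X : Submodule k H) :
    Module.finrank k (X.map φ) + Module.finrank k (X ⊓ LinearMap.ker φ : Submodule k H)
      = Module.finrank k X := by
  let K : Submodule k X := (LinearMap.ker φ).comap X.subtype
  obtain ⟨C, hC⟩ := Submodule.exists_isCompl K
  have h1 := Submodule.finrank_add_eq_of_isCompl hC
  have h2 : Module.finrank k K = Module.finrank k (X ⊓ LinearMap.ker φ : Submodule k H) := by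
    rw [← Submodule.finrank_map_subtype_eq X K, Submodule.map_comap_subtype]
  let b := Module.finBasis k C
  let f : C →+ H := AddMonoidHom.mk' (fun x => φ x.1.1) (fun x y => by simp)
  have hli : LinearIndependent k (f ∘ b) :=
    b.linearIndependent.map_of_injective_injective (frobeniusEquiv k p).symm f
      (fun r h => by simpa using h) 
      (fun x hx => by
        have : x.1 ∈ K ⊓ C := ⟨LinearMap.mem_ker.2 hx, x.2⟩
        rw [hC.inf_eq_bot] at this
        exact Subtype.ext ((Submodule.mem_bot k).1 this)) 
      (fun r m => by
        show φ ((frobeniusEquiv k p).symm r • m.1.1) = r • φ m.1.1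
        rw [LinearMap.map_smulₛₗ, frobenius_apply_frobeniusEquiv_symm])
  have hsp : X.map φ = Submodule.span k (Set.range (f ∘ b)) := by
    apply le_antisymm
    · rintro _ ⟨x, hx, rfl⟩
      have : (⟨x, hx⟩ : X) ∈ K ⊔ C := by rw [hC.sup_eq_top]; trivial
      obtain ⟨u, hu, v, hv, huv⟩ := Submodule.mem_sup.1 this
      have e : x = u.1 + v.1 := (congrArg Subtype.val huv).symm
      have hu : φ u.1 = 0 := LinearMap.mem_ker.1 hu
      rw [e, map_add, hu, zero_add]
      have hv' : (⟨v, hv⟩ : C) = ∑ i, b.repr ⟨v, hv⟩ i • b i := (b.sum_repr _).symm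
      have : φ v.1 = f (∑ i, b.repr ⟨v, hv⟩ i • b i) := by rw [← hv']; rfl
      rw [this, map_sum]
      refine Submodule.sum_mem _ fun i _ => ?_
      have : f (b.repr ⟨v, hv⟩ i • b i) = (frobenius k p (b.repr ⟨v, hv⟩ i)) • f (b i) := by
        show φ (_ • (b i).1.1) = _
        rw [LinearMap.map_smulₛₗ]; rfl
      rw [this]
      exact Submodule.smul_mem _ _ (Submodule.subset_span ⟨i, rfl⟩)
    · rw [Submodule.span_le]
      rintro _ ⟨i, rfl⟩
      exact ⟨(b i).1.1, (b i).1.2, rfl⟩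
  rw [hsp, finrank_span_eq_card hli, Fintype.card_fin, ← h2]; omega

end sympl
end ZipOrb

namespace ZipOrb
set_option linter.unusedSectionVars false
set_option linter.unusedSimpArgs false
section lifting
variable {k H : Type*} [Field k] [AddCommGroup H] [Module k H] [FiniteDimensional k H]
variable {p : ℕ} [Fact p.Prime] [CharP k p] [PerfectRing k p]
variable {g : ℕ} {ω : H →ₗ[k] H →ₗ[k] k} {φ : H →ₛₗ[frobenius k p] H}

/-- u is the image of v under the adjoint (Verschiebung) of φ -/
def Adj (ω : H →ₗ[k] H →ₗ[k] k) (φ : H →ₛₗ[frobenius k p] H) (u v : H) : Prop :=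
  ∀ x, ω (φ x) v = ω x u ^ p

lemma pp : p ≠ 0 := (Fact.out : p.Prime).ne_zero

lemma phi_smul (φ : H →ₛₗ[frobenius k p] H) (a : k) (x : H) : φ (a • x) = a ^ p • φ x := by
  rw [LinearMap.map_smulₛₗ]; rfl

lemma pinj {a b : k} (h : a ^ p = b ^ p) : a = b := frobenius_inj k p h

lemma ep_pow (i : Fin (2*g)) : ep k i ^ p = ep k i := by
  unfold ep; split_ifs
  · simp
  · have := map_neg (frobenius k p) 1
    rw [map_one] at this; exact this

lemma exists_root (p : ℕ) [Fact p.Prime] [CharP k p] [PerfectRing k p] (a : k) : ∃ b : k, b ^ p = a :=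
  surjective_frobenius k p a

lemma Adj.add {u v u' v' : H} (h : Adj ω φ u v) (h' : Adj ω φ u' v') : Adj ω φ (u + u') (v + v') := by
  intro x; rw [map_add, map_add, h, h']; exact (map_add (frobenius k p) _ _).symm

lemma Adj.smul {u v : H} (h : Adj ω φ u v) (a : k) : Adj ω φ (a • u) (a ^ p • v) := by
  intro x; rw [map_smul, map_smul, h, smul_eq_mul, smul_eq_mul, mul_pow]

/-- vectors adjoint to something in X -/
def adjSub (ω : H →ₗ[k] H →ₗ[k] k) (φ : H →ₛₗ[frobenius k p] H) (X : Submodule k H) : Submodule k H where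
  carrier := {v | ∃ u ∈ X, Adj ω φ u v}
  add_mem' := by
    rintro a b ⟨u, hu, h⟩ ⟨u', hu', h'⟩
    exact ⟨u + u', X.add_mem hu hu', h.add h'⟩
  zero_mem' := ⟨0, X.zero_mem, fun x => by simp [pp]⟩
  smul_mem' := by
    rintro c x ⟨u, hu, h⟩
    obtain ⟨b, rfl⟩ := exists_root p c
    exact ⟨b • u, X.smul_mem _ hu, h.smul b⟩

lemma Adj.mem_ker (hC : IsLagrangian ω (LinearMap.ker φ)) (hS : SS g ω) {u v : H} (h : Adj ω φ u v) :
    u ∈ LinearMap.ker φ := by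
  have : u ∈ perp ω (LinearMap.ker φ) := by
    intro x hx
    rw [hS.skew, neg_eq_zero]
    have := h x
    rw [LinearMap.mem_ker.1 hx, map_zero, LinearMap.zero_apply] at this
    exact pow_eq_zero_iff pp |>.1 this.symm
  rwa [show perp ω (LinearMap.ker φ) = LinearMap.ker φ from hC] at this

lemma lag_zero {F : Submodule k H} (h : IsLagrangian ω F) {x y : H} (hx : x ∈ F) (hy : y ∈ F) : ω x y = 0 := by
  have : x ∈ perp ω F := by rwa [show perp ω F = F from h]
  exact this y hy

/-- approximate normal bases -/
structure Good (ω : H →ₗ[k] H →ₗ[k] k) (φ : H →ₛₗ[frobenius k p] H) (t : ZT g) (S : Set ℕ)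
    (e : Fin (2*g) → H) : Prop where
  symp : Symp ω e
  jmp : ∀ j, t.J j = true → ∃ s ∈ S, s ≤ j.val ∧ ∃ w ∈ W k e s, φ (e j + w) = e (t.pf j)
  njm : ∀ j, t.J j = false → ∃ s ∈ S, s ≤ j.val ∧ ∃ w ∈ W k e s,
    Adj ω φ (e j + w) (ep k (Fin.rev j) • e (t.pf j))

/-- normal bases -/
structure NB (ω : H →ₗ[k] H →ₗ[k] k) (φ : H →ₛₗ[frobenius k p] H) (t : ZT g)
    (e : Fin (2*g) → H) : Prop where
  symp : Symp ω e
  im : ∀ j, φ (e j) = if t.J j then e (t.pf j) else 0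

lemma Symp.W_eq (_hS : SS g ω) {e f : Fin (2*g) → H} (he : Symp ω e) (hf : Symp ω f)
    (h : ∀ j, f j ∈ W k e (j.val + 1)) {s : ℕ} (hs : s ≤ 2*g) : W k f s = W k e s := by
  apply Submodule.eq_of_le_of_finrank_eq
  · rw [W_le_iff]; intro i hi; exact W_mono e hi (h i)
  · rw [finrank_W he.li hs, finrank_W hf.li hs]

lemma Symp.zero_of {e : Fin (2*g) → H} (he : Symp ω e) (hS : SS g ω) {s r : ℕ} {x y : H}
    (hx : x ∈ W k e s) (hy : y ∈ W k e r) (h : s + r ≤ 2*g) : ω x y = 0 := by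
  have : x ∈ perp ω (W k e r) := by
    rw [he.perp_W hS]; exact W_mono e (by omega) hx
  exact this y hy

lemma lift (hS : SS g ω) (hC : IsLagrangian ω (LinearMap.ker φ)) (hD : IsLagrangian ω (LinearMap.range φ))
    (t : ZT g) (m : ℕ) (e : Fin (2*g) → H) (hg : Good ω φ t (t.lev (m+1)) e) :
    ∃ e', Good ω φ t (t.lev m) e' := by
  have he := hg.symp
  have key : ∀ j, ∃ s ∈ t.lev (m+1), s ≤ j.val ∧ ∃ w ∈ W k e s,
      (t.J j = true → φ (e j + w) = e (t.pf j)) ∧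
      (t.J j = false → Adj ω φ (e j + w) (ep k (Fin.rev j) • e (t.pf j))) := by
    intro j
    cases hj : t.J j
    · obtain ⟨s, hs, hsj, w, hw, h⟩ := hg.njm j hj
      exact ⟨s, hs, hsj, w, hw, by simp, fun _ => h⟩
    · obtain ⟨s, hs, hsj, w, hw, h⟩ := hg.jmp j hj
      exact ⟨s, hs, hsj, w, hw, fun _ => h, by simp⟩
  choose s hsl hsj w hw hJ hN using key
  set f : Fin (2*g) → H := fun j => e j + w j with hf
  have hfW : ∀ j, f j ∈ W k e (j.val+1) := fun j =>
    Submodule.add_mem _ (mem_W_of_lt e (Nat.lt_succ_self _)) (W_mono e (by have := hsj j; omega) (hw j))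
  have hfker : ∀ i, t.J i = false → f i ∈ LinearMap.ker φ := fun i hi => (hN i hi).mem_ker hC hS
  have hJrev : ∀ {i}, t.J i = true → t.J (Fin.rev i) = false := fun {i} h => by rw [t.hJ, h]; rfl
  have hJrev' : ∀ {i}, t.J i = false → t.J (Fin.rev i) = true := fun {i} h => by rw [t.hJ, h]; rfl
  have hJN : ∀ j i, t.J j = true → t.J i = false → ω (f j) (f i) = if i = Fin.rev j then ep k j else 0 := by
    intro j i hj hi
    apply pinj (p := p)
    rw [← hN i hi (f j), hJ j hj, map_smul, he, smul_eq_mul]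
    by_cases h : i = Fin.rev j
    · subst h
      rw [if_pos rfl, if_pos (t.pi_rev j), Fin.rev_rev, ep_pow]
      have : (t.pf j).val < g := t.pf_lt_g hj
      simp [ep, this]
    · rw [if_neg h, if_neg, mul_zero, zero_pow pp]
      rw [← t.pi_rev]
      exact fun h' => h (t.pf_inj h')
  have hNN : ∀ i i', t.J i = false → t.J i' = false → ω (f i) (f i') = 0 := fun i i' h h' =>
    lag_zero hC (hfker i h) (hfker i' h')
  have hNJ : ∀ j i, t.J j = true → t.J i = false → ω (f i) (f j) = if i = Fin.rev j then - ep k j else 0 := by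
    intro j i hj hi; rw [hS.skew, hJN j i hj hi]; split_ifs <;> simp
  have hx : ∀ j j', t.J j = true → t.J j' = true → ω (f j) (f j') ≠ 0 →
      (Fin.rev j).val < s j' ∨ (Fin.rev j').val < s j := by
    intro j j' hj hj' h
    by_contra hc
    push Not at hc
    apply h
    have h1 := hsj j
    have h2 := hsj j'
    have h3 := j.2
    have h4 := j'.2
    rw [Fin.val_rev, Fin.val_rev] at hc
    simp only [hf, map_add, LinearMap.add_apply]
    rw [he, if_neg, he.zero_of hS (hw j) (mem_W_of_lt e (Nat.lt_succ_self j'.val)) (by omega),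
      he.zero_of hS (mem_W_of_lt e (Nat.lt_succ_self j.val)) (hw j') (by omega),
      he.zero_of hS (hw j) (hw j') (by omega)]
    · simp
    · rintro rfl; rw [hJrev hj] at hj'; cases hj'
  classical
  let a : Fin (2*g) → Fin (2*g) → Prop := fun j j' =>
    (Fin.rev j).val < s j' ∧ (j < j' ∨ ¬ (Fin.rev j').val < s j)
  let c : Fin (2*g) → Fin (2*g) → k := fun j' i =>
    if t.J i = false ∧ a (Fin.rev i) j' then - (ep k (Fin.rev i) * ω (f (Fin.rev i)) (f j')) else 0
  let f' : Fin (2*g) → H := fun j => if t.J j = true then f j + ∑ i, c j i • f i else f j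
  have hcs : ∀ j i, c j i ≠ 0 → t.J i = false ∧ i.val < s j := by
    intro j i h
    simp only [c] at h
    split_ifs at h with h2
    · refine ⟨h2.1, ?_⟩
      have := h2.2.1
      rwa [Fin.rev_rev] at this
    · exact absurd rfl h
  have hf'W : ∀ j, f' j - e j ∈ W k e (s j) := by
    intro j
    simp only [f']
    split_ifs with h
    · have : f j + ∑ i, c j i • f i - e j = w j + ∑ i, c j i • f i := by simp only [hf]; abel
      rw [this]
      refine Submodule.add_mem _ (hw j) (Submodule.sum_mem _ fun i _ => ?_)
      by_cases hc : c j i = 0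
      · rw [hc, zero_smul]; exact Submodule.zero_mem _
      · exact Submodule.smul_mem _ _ (W_mono e (hcs j i hc).2 (hfW i))
    · simpa [hf] using hw j
  have hφ : ∀ j, t.J j = true → φ (f' j) = e (t.pf j) := by
    intro j hj
    simp only [f', if_pos hj, map_add]
    rw [← hJ j hj, map_sum, Finset.sum_eq_zero, add_zero]
    intro i _
    rw [phi_smul]
    by_cases hc : c j i = 0
    · rw [hc, zero_pow pp, zero_smul]
    · rw [LinearMap.mem_ker.1 (hfker i (hcs j i hc).1), smul_zero]
  have hf'N : ∀ i, t.J i = false → f' i = f i := fun i hi => by simp [f', hi]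
  have hcx : ∀ j j', t.J j = true → t.J j' = true → ω (f j) (∑ i, c j' i • f i) =
      if a j j' then - ω (f j) (f j') else 0 := by
    intro j j' hj hj'
    rw [map_sum, Finset.sum_eq_single (Fin.rev j)]
    · rw [map_smul, hJN j _ hj (hJrev hj), if_pos rfl, smul_eq_mul]
      simp only [c, Fin.rev_rev, hJrev hj, true_and]
      split_ifs
      · linear_combination (- ω (f j) (f j')) * ep_sq (k := k) j
      · simp
    · intro i _ hi
      rw [map_smul]
      by_cases hc : c j' i = 0
      · rw [hc, zero_smul]
      · rw [hJN j i hj (hcs _ _ hc).1, if_neg hi, smul_zero]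
    · simp
  have hcN : ∀ j i, t.J i = false → ω (∑ i', c j i' • f i') (f i) = 0 := by
    intro j i hi
    rw [map_sum, LinearMap.sum_apply]
    refine Finset.sum_eq_zero fun i' _ => ?_
    rw [map_smul, LinearMap.smul_apply]
    by_cases hc : c j i' = 0
    · rw [hc, zero_smul]
    · rw [hNN i' i (hcs _ _ hc).1 hi, smul_zero]
  have hcc : ∀ j j', ω (∑ i', c j i' • f i') (∑ i', c j' i' • f i') = 0 := by
    intro j j'
    rw [map_sum]
    refine Finset.sum_eq_zero fun i' _ => ?_
    rw [map_smul]
    by_cases hc : c j' i' = 0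
    · rw [hc, zero_smul]
    · rw [hcN j i' (hcs _ _ hc).1, smul_zero]
  have hsymp : Symp ω f' := by
    intro j j'
    cases hj : t.J j <;> cases hj' : t.J j'
    · rw [hf'N j hj, hf'N j' hj', hNN j j' hj hj', if_neg]
      rintro rfl; rw [hJrev' hj] at hj'; cases hj'
    · rw [hf'N j hj]
      simp only [f', if_pos hj', map_add]
      rw [hS.skew (f j) (∑ i, _), hcN _ _ hj, neg_zero, add_zero, hNJ j' j hj' hj]
      by_cases h : j = Fin.rev j'
      · subst h; rw [if_pos rfl, if_pos (Fin.rev_rev _).symm, ep_rev]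
      · rw [if_neg h, if_neg]; rintro rfl; exact h (Fin.rev_rev _).symm
    · rw [hf'N j' hj']
      simp only [f', if_pos hj, map_add, LinearMap.add_apply]
      rw [hcN _ _ hj', add_zero, hJN j j' hj hj']
    · rw [if_neg (by rintro rfl; rw [hJrev hj] at hj'; cases hj')]
      simp only [f', if_pos hj, if_pos hj', map_add, LinearMap.add_apply]
      rw [hcc, hcx j j' hj hj', hS.skew (∑ i, _) (f j'), hcx j' j hj' hj]
      by_cases hxx : ω (f j) (f j') = 0
      · rw [hS.skew (f j') (f j), hxx]; simp
      · have hne : j ≠ j' := by rintro rfl; exact hxx (hS.alt _)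
        have h3 := hx j j' hj hj' hxx
        have h4 : j < j' ∨ j' < j := lt_or_gt_of_ne hne
        rw [hS.skew (f j') (f j)]
        by_cases h1 : a j j'
        · have h2 : ¬ a j' j := by
            simp only [a] at h1 ⊢
            rcases h4 with h4 | h4
            · have := h4.not_gt; tauto
            · have := h4.not_gt; tauto
          rw [if_pos h1, if_neg h2]; simp
        · have h2 : a j' j := by
            simp only [a] at h1 ⊢
            tauto
          rw [if_neg h1, if_pos h2]; simp
  have hWW : ∀ s, s ≤ 2*g → W k f' s = W k e s := by
    intro s' hs'
    refine he.W_eq hS hsymp (fun j => ?_) hs'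
    have : f' j = e j + (f' j - e j) := by abel
    rw [this]
    exact Submodule.add_mem _ (mem_W_of_lt e (Nat.lt_succ_self _))
      (W_mono e (by have := hsj j; omega) (hf'W j))
  have hf'mem : ∀ j r, j.val < r → f' j ∈ W k e r := by
    intro j r hjr
    have : f' j = e j + (f' j - e j) := by abel
    rw [this]
    exact Submodule.add_mem _ (mem_W_of_lt e hjr)
      (W_mono e (by have := hsj j; omega) (hf'W j))
  have heD : ∀ i : Fin (2*g), i.val < g → e i ∈ LinearMap.range φ := by
    intro i hi
    obtain ⟨l, rfl⟩ := t.pi.surjective i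
    cases hl : t.J l
    · have := t.pf_ge_g hl
      rw [t.pi_apply] at hi; omega
    · exact ⟨f' l, hφ l hl⟩
  refine ⟨f', hsymp, ?_, ?_⟩
  · intro j hj
    obtain ⟨r, hr, hr'⟩ := hsl (t.pf j)
    have hr2 := t.lev_le _ _ hr
    have h1 := t.pf_lt_g hj
    have h2 := hsj (t.pf j)
    have h3 := t.cnt_le_g r hr2
    rcases hr' with hr' | hr'
    · have hrj : r ≤ j.val := by
        have := t.pf_lt_cnt hj r
        by_contra hc
        have := this.2 (by omega)
        omega
      have hle : W k e (cnt t.J r) ≤ (W k e r).map φ := by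
        rw [W_le_iff]
        intro i hi
        obtain ⟨l, hl, hlr, rfl⟩ := t.exists_pf_lt hi hr2
        exact ⟨f' l, hf'mem l r hlr, hφ l hl⟩
      obtain ⟨v, hv, hv'⟩ := hle (hr' ▸ hf'W (t.pf j))
      refine ⟨r, hr, hrj, v, by rw [hWW r hr2]; exact hv, ?_⟩
      rw [map_add, hφ j hj, hv']; abel
    · omega
  · intro j hj
    obtain ⟨r, hr, hr'⟩ := hsl (t.pf j)
    have hr2 := t.lev_le _ _ hr
    have h1 := t.pf_ge_g hj
    have h2 := hsj (t.pf j)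
    have h3 := t.cnt_le_g r hr2
    have hbase : Adj ω φ (f' j) (ep k (Fin.rev j) • e (t.pf j)) := by
      rw [hf'N j hj]; exact hN j hj
    have hlow : ∀ (X : Submodule k H) (i : Fin (2*g)), i.val < g → e i ∈ adjSub ω φ X := by
      intro X i hi
      refine ⟨0, X.zero_mem, fun x => ?_⟩
      rw [lag_zero hD ⟨x, rfl⟩ (heD i hi), map_zero, zero_pow pp]
    have fin : ∀ r0 ∈ t.lev m, r0 ≤ j.val → f' (t.pf j) - e (t.pf j) ∈ adjSub ω φ (W k e r0) →
        ∃ s ∈ t.lev m, s ≤ j.val ∧ ∃ w ∈ W k f' s,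
        Adj ω φ (f' j + w) (ep k (Fin.rev j) • f' (t.pf j)) := by
      intro r0 hr0 hr0j hmem
      obtain ⟨u, hu, hau⟩ := Submodule.smul_mem _ (ep k (Fin.rev j)) hmem
      refine ⟨r0, hr0, hr0j, u, by rw [hWW _ (t.lev_le _ _ hr0)]; exact hu, ?_⟩
      have := hbase.add hau
      rw [← smul_add, add_sub_cancel] at this
      exact this
    rcases hr' with hr' | hr'
    · refine fin 0 (t.lev_zero_mem m) (Nat.zero_le _) ?_
      have : W k e (s (t.pf j)) ≤ adjSub ω φ (W k e 0) := by
        rw [W_le_iff]; intro i hi; exact hlow _ i (by omega)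
      exact this (hf'W _)
    · have h4 := t.cnt_rev r hr2
      have hr0 : 2*g - r ∈ t.lev m := t.lev_rev _ _ hr
      refine fin (2*g - r) hr0 ?_ ?_
      · have := t.pf_lt_nu hj (2*g - r)
        by_contra hc
        have := this.2 (by omega)
        omega
      · have : W k e (s (t.pf j)) ≤ adjSub ω φ (W k e (2*g - r)) := by
          rw [W_le_iff]; intro i hi
          by_cases hig : i.val < g
          · exact hlow _ i hig
          · obtain ⟨l, rfl⟩ := t.pi.surjective i
            rw [t.pi_apply] at hi hig ⊢
            cases hl : t.J l
            · have hlr := (t.pf_lt_nu hl (2*g - r)).1 (by omega)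
              refine ⟨ep k (Fin.rev l) • f' l, Submodule.smul_mem _ _ (hf'mem l _ hlr), ?_⟩
              have := (hN l hl).smul (ep k (Fin.rev l))
              rw [ep_pow, smul_smul, ep_sq, one_smul] at this
              rw [hf'N l hl]; exact this
            · have := t.pf_lt_g hl; omega
        exact this (hf'W _)

lemma Good.to_NB (hS : SS g ω) (hC : IsLagrangian ω (LinearMap.ker φ)) 
    (t : ZT g) (e : Fin (2*g) → H) (hg : Good ω φ t (t.lev 0) e) : NB ω φ t e := by
  have h0 : ∀ (j : Fin (2*g)) s, s ∈ t.lev 0 → s ≤ j.val → s = 0 := by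
    intro j s hs hsj
    have := j.2
    rcases hs with h | h
    · exact h
    · have : s = 2*g := h
      omega
  refine ⟨hg.symp, fun j => ?_⟩
  cases hj : t.J j
  · obtain ⟨s, hs, hsj, w, hw, h⟩ := hg.njm j hj
    rw [h0 j s hs hsj, W_zero, Submodule.mem_bot] at hw
    rw [hw, add_zero] at h
    simpa using h.mem_ker hC hS
  · obtain ⟨s, hs, hsj, w, hw, h⟩ := hg.jmp j hj
    rw [h0 j s hs hsj, W_zero, Submodule.mem_bot] at hw
    rw [hw, add_zero] at h
    simpa using h

lemma lift_all (hS : SS g ω) (hC : IsLagrangian ω (LinearMap.ker φ)) (hD : IsLagrangian ω (LinearMap.range φ))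
    (t : ZT g) (m : ℕ) : ∀ (e : Fin (2*g) → H) (_ : Good ω φ t (t.lev m) e), ∃ e', NB ω φ t e' := by
  induction m with
  | zero => exact fun e h => ⟨e, h.to_NB hS hC⟩
  | succ m ih =>
    intro e h
    obtain ⟨e', h'⟩ := lift hS hC hD t m e h
    exact ih e' h'

end lifting
end ZipOrb

namespace ZipOrb
set_option linter.unusedSectionVars false
set_option linter.unusedSimpArgs false
section adapted
variable {k H : Type*} [Field k] [AddCommGroup H] [Module k H] [FiniteDimensional k H]
variable {p : ℕ} [Fact p.Prime] [CharP k p] [PerfectRing k p]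
variable {g : ℕ} {ω : H →ₗ[k] H →ₗ[k] k} {φ : H →ₛₗ[frobenius k p] H}

/-- the canonical filtration -/
inductive CC (ω : H →ₗ[k] H →ₗ[k] k) (φ : H →ₛₗ[frobenius k p] H) : Submodule k H → Prop
  | bot : CC ω φ ⊥
  | top : CC ω φ ⊤
  | im (X) : CC ω φ X → CC ω φ (X.map φ)
  | pim (X) : CC ω φ X → CC ω φ (perp ω (X.map φ))

lemma map_le_range' (X : Submodule k H) : X.map φ ≤ LinearMap.range φ := by
  rintro _ ⟨x, _, rfl⟩; exact ⟨x, rfl⟩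

lemma map_mono' {X Y : Submodule k H} (h : X ≤ Y) : X.map φ ≤ Y.map φ := by
  rintro _ ⟨x, hx, rfl⟩; exact ⟨x, h hx, rfl⟩

lemma CC.total (hS : SS g ω) (hD : IsLagrangian ω (LinearMap.range φ)) {X : Submodule k H} (hX : CC ω φ X) :
    ∀ Y, CC ω φ Y → X ≤ Y ∨ Y ≤ X := by
  have hc : ∀ A B : Submodule k H, A.map φ ≤ perp ω (B.map φ) := by
    intro A B x hx y hy
    exact lag_zero hD (map_le_range' A hx) (map_le_range' B hy)
  induction hX with
  | bot => exact fun Y _ => Or.inl bot_le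
  | top => exact fun Y _ => Or.inr le_top
  | im X hX ih =>
    intro Y hY
    cases hY with
    | bot => exact Or.inr bot_le
    | top => exact Or.inl le_top
    | im Y hY => exact (ih Y hY).imp map_mono' map_mono'
    | pim Y hY => exact Or.inl (hc X Y)
  | pim X hX ih =>
    intro Y hY
    cases hY with
    | bot => exact Or.inr bot_le
    | top => exact Or.inl le_top
    | im Y hY => exact Or.inr (hc Y X)
    | pim Y hY => exact (ih Y hY).symm.imp (fun h => hS.perp_anti (map_mono' h)) (fun h => hS.perp_anti (map_mono' h))

lemma CC.perp (hS : SS g ω) {X : Submodule k H} (hX : CC ω φ X) : CC ω φ (perp ω X) := by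
  cases hX with
  | bot => rw [hS.perp_bot]; exact .top
  | top => rw [hS.perp_top]; exact .bot
  | im X hX => exact .pim X hX
  | pim X hX => rw [hS.perp_perp]; exact .im X hX

lemma CC.low (hS : SS g ω) {X : Submodule k H} (hX : CC ω φ X) :
    X ≤ LinearMap.range φ ∨ _root_.perp ω X ≤ LinearMap.range φ := by
  cases hX with
  | bot => exact Or.inl bot_le
  | top => right; rw [hS.perp_top]; exact bot_le
  | im X hX => exact Or.inl (map_le_range' X)
  | pim X hX => right; rw [hS.perp_perp]; exact map_le_range' X

lemma exists_adapted (hS : SS g ω) (hD : IsLagrangian ω (LinearMap.range φ)) :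
    ∃ e : Fin (2*g) → H, Symp ω e ∧ ∀ X, CC ω φ X → X = W k e (Module.finrank k X) := by
  obtain ⟨d, hli, hsp, hX⟩ := chain_basis g (LinearMap.range φ) {X | CC ω φ X ∧ X ≤ LinearMap.range φ}
    (fun X hX Y hY _ => hX.1.total hS hD Y hY.1) (fun X hX => hX.2) (hS.lag_finrank hD)
  have hdm : ∀ i, d i ∈ LinearMap.range φ := fun i => by
    rw [← hsp]; exact Submodule.subset_span ⟨i, rfl⟩
  obtain ⟨e, he, hed⟩ := hS.extend d hli (fun i j => lag_zero hD (hdm i) (hdm j))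
  have hlow : ∀ X, CC ω φ X → X ≤ LinearMap.range φ → X = W k e (Module.finrank k X) := by
    intro X h1 h2
    have h3 : Module.finrank k X ≤ g := by
      rw [← hS.lag_finrank hD]; exact Submodule.finrank_mono h2
    conv_lhs => rw [hX X ⟨h1, h2⟩]
    rw [W]
    congr 1
    ext x
    constructor
    · rintro ⟨i, hi, rfl⟩
      exact ⟨⟨i.val, by omega⟩, hi, hed _ i.2⟩
    · rintro ⟨i, hi, rfl⟩
      have hi' : i.val < Module.finrank k X := hi
      exact ⟨⟨i.val, by omega⟩, hi, (hed i (by omega)).symm⟩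
  refine ⟨e, he, fun X h1 => ?_⟩
  rcases h1.low hS with h2 | h2
  · exact hlow X h1 h2
  · have h3 := hlow _ (h1.perp hS) h2
    have h4 := hS.finrank_perp X
    have h5 : X = W k e (2*g - Module.finrank k (_root_.perp ω X)) := by
      conv_lhs => rw [← hS.perp_perp X, h3, he.perp_W hS]
    conv_lhs => rw [h5]
    congr 1; omega

/-- dimension of the image of the orthogonal complement -/
lemma finrank_map_perp (hS : SS g ω) (hC : IsLagrangian ω (LinearMap.ker φ)) (X : Submodule k H) :
    Module.finrank k ((perp ω X).map φ) + Module.finrank k X = g + Module.finrank k (X.map φ) := by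
  have h1 := semi_rank φ X
  have h2 := semi_rank φ (perp ω X)
  have h3 : perp ω X ⊓ LinearMap.ker φ = perp ω (X ⊔ LinearMap.ker φ) := by
    apply le_antisymm
    · rintro x ⟨hx, hx'⟩ y hy
      obtain ⟨a, ha, b, hb, rfl⟩ := Submodule.mem_sup.1 hy
      rw [map_add, hx a ha, lag_zero hC hx' hb, add_zero]
    · refine le_inf (hS.perp_anti le_sup_left) ?_
      conv_rhs => rw [← show perp ω (LinearMap.ker φ) = LinearMap.ker φ from hC]
      exact hS.perp_anti le_sup_right
  rw [h3] at h2
  have h4 := hS.finrank_perp X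
  have h5 := hS.finrank_perp (X ⊔ LinearMap.ker φ)
  have h6 := Submodule.finrank_sup_add_finrank_inf_eq X (LinearMap.ker φ)
  have h7 := hS.lag_finrank hC
  omega

lemma map_step (φ : H →ₛₗ[frobenius k p] H) (e : Fin (2*g) → H) (i : Fin (2*g)) :
    Module.finrank k ((W k e (i.val+1)).map φ) ≤ Module.finrank k ((W k e i.val).map φ) + 1 := by
  have h1 : (W k e (i.val+1)).map φ ≤ (W k e i.val).map φ ⊔ Submodule.span k {φ (e i)} := by
    rw [Submodule.map_le_iff_le_comap, W_le_iff]
    intro j hj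
    rw [Submodule.mem_comap]
    by_cases h : j = i
    · subst h; exact Submodule.mem_sup_right (Submodule.mem_span_singleton_self _)
    · refine Submodule.mem_sup_left ⟨e j, mem_W_of_lt e ?_, rfl⟩
      have : j.val ≠ i.val := fun h' => h (Fin.ext h')
      omega
  have h2 := Submodule.finrank_mono h1
  have h3 := Submodule.finrank_add_le_finrank_add_finrank ((W k e i.val).map φ) (Submodule.span k {φ (e i)})
  have h4 := finrank_span_le_card (R := k) ({φ (e i)} : Set H)
  simp at h4
  omega

/-- the type attached to a symplectic flag -/
lemma exists_type (hS : SS g ω) (hC : IsLagrangian ω (LinearMap.ker φ)) {e : Fin (2*g) → H} (he : Symp ω e) :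
    ∃ t : ZT g, ∀ s, s ≤ 2*g → cnt t.J s = Module.finrank k ((W k e s).map φ) := by
  classical
  have hm : ∀ s, Module.finrank k ((W k e s).map φ) ≤ Module.finrank k ((W k e (s+1)).map φ) := fun s =>
    Submodule.finrank_mono (map_mono' (W_mono e (Nat.le_succ s)))
  have hd : ∀ s, s ≤ 2*g → Module.finrank k ((W k e (2*g-s)).map φ) + s = g + Module.finrank k ((W k e s).map φ) := by
    intro s hs
    have := finrank_map_perp hS hC (W k e s)
    rwa [he.perp_W hS, finrank_W he.li hs] at this
  refine ⟨⟨fun i => decide (Module.finrank k ((W k e (i.val+1)).map φ) = Module.finrank k ((W k e i.val).map φ) + 1), ?_⟩, ?_⟩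
  · intro i
    have h1 := hd i.val i.2.le
    have h2 := hd (i.val+1) i.2
    have h3 := map_step φ e i
    have h4 := hm i.val
    have e1 : (Fin.rev i).val = 2*g - (i.val+1) := Fin.val_rev i
    have e2 : (Fin.rev i).val + 1 = 2*g - i.val := by rw [e1]; have := i.2; omega
    rw [e2, e1, ← decide_not]
    congr 1
    rw [eq_iff_iff]
    omega
  · intro s
    induction s with
    | zero =>
      intro _
      have h1 := semi_rank φ (W k e 0)
      rw [finrank_W he.li (Nat.zero_le _)] at h1
      rw [cnt_zero]; omega
    | succ s ih =>
      intro hs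
      have ih := ih (by omega)
      have h3 := map_step φ e ⟨s, hs⟩
      have h4 := hm s
      by_cases h : Module.finrank k ((W k e (s+1)).map φ) = Module.finrank k ((W k e s).map φ) + 1
      · rw [h, ← ih]
        exact cnt_succ_true _ ⟨s, hs⟩ (by simpa using h)
      · rw [cnt_succ_false _ ⟨s, hs⟩ (by simpa using h), ih]
        simp only at h3
        omega

/-- adapted bases -/
structure AD (ω : H →ₗ[k] H →ₗ[k] k) (φ : H →ₛₗ[frobenius k p] H) (t : ZT g) (S : Set ℕ)
    (e : Fin (2*g) → H) : Prop where
  symp : Symp ω e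
  S0 : 0 ∈ S
  Sle : ∀ s ∈ S, s ≤ 2*g
  Srev : ∀ s ∈ S, 2*g - s ∈ S
  Sc : ∀ s ∈ S, cnt t.J s ∈ S
  Sgen : ∀ s ∈ S, ∃ r ∈ S, s = cnt t.J r ∨ s = 2*g - cnt t.J r
  map : ∀ s ∈ S, (W k e s).map φ = W k e (cnt t.J s)
  SN : ∃ N, S ⊆ t.lev N

lemma exists_AD (hS : SS g ω) (hC : IsLagrangian ω (LinearMap.ker φ)) (hD : IsLagrangian ω (LinearMap.range φ)) :
    ∃ (t : ZT g) (S : Set ℕ) (e : Fin (2*g) → H), AD ω φ t S e := by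
  classical
  obtain ⟨e, he, hX⟩ := exists_adapted hS hD
  obtain ⟨t, ht⟩ := exists_type hS hC he
  have hle : ∀ X : Submodule k H, Module.finrank k X ≤ 2*g := fun X => by
    rw [← hS.dim]; exact Submodule.finrank_le X
  have hc : ∀ X, CC ω φ X → Module.finrank k (X.map φ) = cnt t.J (Module.finrank k X) := by
    intro X h
    rw [ht _ (hle X), ← hX X h]
  have hp : ∀ X : Submodule k H, Module.finrank k (perp ω X) = 2*g - Module.finrank k X := by
    intro X; have := hS.finrank_perp X; omega
  have hlev : ∀ X, CC ω φ X → ∃ N, Module.finrank k X ∈ t.lev N := by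
    intro X h
    induction h with
    | bot => exact ⟨0, Or.inl (by simp)⟩
    | top => exact ⟨0, Or.inr (by simpa using hS.dim)⟩
    | im X h ih =>
      obtain ⟨N, hN⟩ := ih
      exact ⟨N+1, _, hN, Or.inl (hc X h)⟩
    | pim X h ih =>
      obtain ⟨N, hN⟩ := ih
      exact ⟨N+1, _, hN, Or.inr (by rw [hp, hc X h])⟩
  refine ⟨t, {s | ∃ X, CC ω φ X ∧ Module.finrank k X = s}, e, he, ⟨⊥, .bot, by simp⟩, ?_, ?_, ?_, ?_, ?_, ?_⟩
  · rintro _ ⟨X, h, rfl⟩; exact hle X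
  · rintro _ ⟨X, h, rfl⟩; exact ⟨_, h.perp hS, hp X⟩
  · rintro _ ⟨X, h, rfl⟩; exact ⟨_, .im X h, hc X h⟩
  · rintro _ ⟨X, h, rfl⟩
    cases h with
    | bot => exact ⟨0, ⟨⊥, .bot, by simp⟩, Or.inl (by simp [cnt_zero])⟩
    | top => exact ⟨0, ⟨⊥, .bot, by simp⟩, Or.inr (by simpa [cnt_zero] using hS.dim)⟩
    | im X h => exact ⟨_, ⟨X, h, rfl⟩, Or.inl (hc X h)⟩
    | pim X h => exact ⟨_, ⟨X, h, rfl⟩, Or.inr (by rw [hp, hc X h])⟩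
  · rintro _ ⟨X, h, rfl⟩
    rw [← hX X h, ← hc X h]
    exact hX _ (.im X h)
  · have : ∀ n, ∃ N, ∀ s, s ≤ n → (∃ X, CC ω φ X ∧ Module.finrank k X = s) → s ∈ t.lev N := by
      intro n
      induction n with
      | zero => exact ⟨0, fun s hs _ => Or.inl (by omega)⟩
      | succ n ih =>
        obtain ⟨N, hN⟩ := ih
        by_cases hn : ∃ X, CC ω φ X ∧ Module.finrank k X = n+1
        · obtain ⟨X, h, hXn⟩ := hn
          obtain ⟨M, hM⟩ := hlev X h
          refine ⟨max N M, fun s hs hs' => ?_⟩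
          rcases Nat.lt_or_ge n s with h2 | h2
          · have : s = n+1 := by omega
            rw [this, ← hXn]; exact t.lev_mono (le_max_right _ _) hM
          · exact t.lev_mono (le_max_left _ _) (hN s h2 hs')
        · refine ⟨N, fun s hs hs' => ?_⟩
          rcases Nat.lt_or_ge n s with h2 | h2
          · have : s = n+1 := by omega
            subst this; exact absurd hs' hn
          · exact hN s h2 hs'
    obtain ⟨N, hN⟩ := this (2*g)
    refine ⟨N, ?_⟩
    rintro _ ⟨X, h, rfl⟩
    exact hN _ (hle X) ⟨X, h, rfl⟩

end adapted
end ZipOrb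

namespace ZipOrb
set_option linter.unusedSectionVars false
set_option linter.unusedSimpArgs false
section blocks
variable {g : ℕ}

/-- combinatorial part of the adapted data -/
structure BS (t : ZT g) (S : Set ℕ) : Prop where
  S0 : 0 ∈ S
  Sle : ∀ s ∈ S, s ≤ 2*g
  Srev : ∀ s ∈ S, 2*g - s ∈ S
  Sc : ∀ s ∈ S, cnt t.J s ∈ S

open Classical in
/-- lower end of the block of `j` -/
noncomputable def lo (S : Set ℕ) (j : Fin (2*g)) : ℕ := Nat.findGreatest (· ∈ S) j.val

/-- upper end of the block of `j` -/
noncomputable def hi (S : Set ℕ) (j : Fin (2*g)) : ℕ := 2*g - lo S (Fin.rev j)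

namespace BS
variable {t : ZT g} {S : Set ℕ}

lemma lo_le (S : Set ℕ) (j : Fin (2*g)) : lo S j ≤ j.val := by
  classical exact Nat.findGreatest_le _

lemma lo_mem (h : BS t S) (j : Fin (2*g)) : lo S j ∈ S := by
  classical exact Nat.findGreatest_spec (P := (· ∈ S)) (Nat.zero_le _) h.S0

lemma le_lo {j : Fin (2*g)} {s : ℕ} (hs : s ∈ S) (hj : s ≤ j.val) : s ≤ lo S j := by
  classical exact Nat.le_findGreatest hj hs

lemma hi_mem (h : BS t S) (j : Fin (2*g)) : hi S j ∈ S := h.Srev _ (h.lo_mem _)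

lemma lt_hi (j : Fin (2*g)) : j.val < hi S j := by
  have := lo_le S (Fin.rev j)
  rw [Fin.val_rev] at this
  have := j.2
  unfold hi; omega

lemma hi_le (h : BS t S) {j : Fin (2*g)} {s : ℕ} (hs : s ∈ S) (hj : j.val < s) : hi S j ≤ s := by
  have := le_lo (j := Fin.rev j) (h.Srev s hs) (by rw [Fin.val_rev]; omega)
  have := h.Sle s hs
  unfold hi; omega

lemma lo_eq_iff (h : BS t S) {i j : Fin (2*g)} : lo S i = lo S j ↔ ∀ s ∈ S, s ≤ i.val ↔ s ≤ j.val := by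
  constructor
  · intro e s hs
    constructor
    · intro hi; exact (le_lo hs hi).trans (e ▸ lo_le S j)
    · intro hi; exact (le_lo hs hi).trans (e ▸ lo_le S i)
  · intro hh
    apply le_antisymm
    · exact le_lo (h.lo_mem i) ((hh _ (h.lo_mem i)).1 (lo_le S i))
    · exact le_lo (h.lo_mem j) ((hh _ (h.lo_mem j)).2 (lo_le S j))

lemma lo_rev (h : BS t S) {i j : Fin (2*g)} (e : lo S i = lo S j) : lo S (Fin.rev i) = lo S (Fin.rev j) := by
  rw [h.lo_eq_iff] at e ⊢
  intro s hs
  have := e _ (h.Srev s hs)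
  have := h.Sle s hs
  have := i.2
  have := j.2
  rw [Fin.val_rev, Fin.val_rev]; omega

lemma hi_eq (h : BS t S) {i j : Fin (2*g)} (e : lo S i = lo S j) : hi S i = hi S j := by
  unfold hi; rw [h.lo_rev e]

/-- not in the same block and above the lower end means above the upper end -/
lemma hi_le_of (h : BS t S) {i j : Fin (2*g)} (hne : lo S j ≠ lo S i) (hl : lo S i ≤ j.val) : hi S i ≤ j.val := by
  by_contra hc
  push Not at hc
  apply hne
  rw [h.lo_eq_iff]
  intro s hs
  constructor
  · intro h1; by_contra h2
    have := h.hi_le hs (j := i) (by omega)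
    omega
  · intro h1; exact (le_lo hs h1).trans hl

lemma cons (h : BS t S) {s s' : ℕ} (hs : s ∈ S) (hs' : s' ∈ S) (hlt : s < s') (hc : ∀ r ∈ S, r ≤ s ∨ s' ≤ r) :
    cnt t.J s = cnt t.J s' ∨ cnt t.J s + s' = cnt t.J s' + s := by
  classical
  have hmem : ∀ s, s ∈ (Finset.range (2*g+1)).filter (· ∈ S) ↔ s ∈ S := by
    intro s; simp only [Finset.mem_filter, Finset.mem_range]
    exact ⟨fun h => h.2, fun h' => ⟨by have := h.Sle s h'; omega, h'⟩⟩
  have hb : ∀ s ∈ S, (2*g - cnt t.J (2*g - s)) + cnt t.J s = g + s := by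
    intro s hs
    have h1 := h.Sle s hs
    have h2 := t.cnt_rev s h1
    have h3 := t.cnt_le_g (2*g - s) (by omega)
    omega
  have := count_lemma ((Finset.range (2*g+1)).filter (· ∈ S)) g (cnt t.J) (fun s => 2*g - cnt t.J (2*g - s))
    (fun s _ r _ hsr => (cnt_mono t.J hsr).1)
    (fun s _ r _ hsr => by
      have := (cnt_mono t.J (show 2*g - r ≤ 2*g - s by omega)).1
      omega)
    ((hmem 0).2 h.S0)
    (fun s hs => ⟨(hmem _).2 (h.Sc s ((hmem s).1 hs)), t.cnt_le_g s (h.Sle s ((hmem s).1 hs))⟩)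
    (fun s hs => ⟨(hmem _).2 (h.Srev _ (h.Sc _ (h.Srev s ((hmem s).1 hs)))), by
      have := t.cnt_le_g (2*g - s) (by omega)
      omega⟩)
    (fun s hs => by have := hb s ((hmem s).1 hs); omega)
    s s' ((hmem s).2 hs) ((hmem s').2 hs') hlt (fun r hr => hc r ((hmem r).1 hr))
  rcases this with h1 | h1
  · exact Or.inl h1
  · right
    have h2 := hb s hs
    have h3 := hb s' hs'
    omega

lemma J_iff (h : BS t S) (j : Fin (2*g)) : t.J j = true ↔ cnt t.J (lo S j) < cnt t.J (hi S j) := by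
  have h1 := lo_le S j
  have h2 := lt_hi (S := S) j
  have h3 := h.cons (h.lo_mem j) (h.hi_mem j) (by omega) (fun r hr => by
    rcases Nat.lt_or_ge j.val r with h' | h'
    · exact Or.inr (h.hi_le hr h')
    · exact Or.inl (le_lo hr h'))
  have h4 := cnt_mono t.J h1
  have h5 := cnt_mono t.J (show j.val + 1 ≤ hi S j from h2)
  constructor
  · intro hj
    have := cnt_succ_true t.J j hj
    omega
  · intro hlt
    by_contra hj
    have := cnt_succ_false t.J j (by simpa using hj)
    omega

lemma J_eq (h : BS t S) {i j : Fin (2*g)} (e : lo S i = lo S j) : t.J i = t.J j := by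
  have h1 := h.J_iff i
  have h2 := h.J_iff j
  rw [e, h.hi_eq e, ← h2] at h1
  exact Bool.eq_iff_iff.2 h1

lemma pf_lo (h : BS t S) (hgen : ∀ s ∈ S, ∃ r ∈ S, s = cnt t.J r ∨ s = 2*g - cnt t.J r)
    {i j : Fin (2*g)} (e : lo S i = lo S j) : lo S (t.pf i) = lo S (t.pf j) := by
  have hJ := h.J_eq e
  rw [h.lo_eq_iff] at e ⊢
  intro s hs
  obtain ⟨r, hr, hr'⟩ := hgen s hs
  have hr2 := h.Sle r hr
  have h3 := t.cnt_le_g r hr2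
  have h4 := t.cnt_rev r hr2
  have e1 := e r hr
  have e2 := e _ (h.Srev r hr)
  cases hi : t.J i
  · have hj : t.J j = false := by rw [← hJ, hi]
    have i1 := t.pf_ge_g hi
    have j1 := t.pf_ge_g hj
    have i2 := t.pf_lt_nu hi (2*g - r)
    have j2 := t.pf_lt_nu hj (2*g - r)
    omega
  · have hj : t.J j = true := by rw [← hJ, hi]
    have i1 := t.pf_lt_g hi
    have j1 := t.pf_lt_g hj
    have i2 := t.pf_lt_cnt hi r
    have j2 := t.pf_lt_cnt hj r
    omega

lemma pf_o1 (h : BS t S) (hgen : ∀ s ∈ S, ∃ r ∈ S, s = cnt t.J r ∨ s = 2*g - cnt t.J r)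
    (m : ℕ) (i : Fin (2*g)) (e : lo S (t.pi^[m] i) = lo S i) : t.pi^[m] i = i := by
  have hit : ∀ m, ∀ a b, lo S a = lo S b → lo S (t.pi^[m] a) = lo S (t.pi^[m] b) := by
    intro m
    induction m with
    | zero => exact fun a b h => h
    | succ m ih => intro a b hab; exact ih _ _ (h.pf_lo hgen hab)
  have hlt : ∀ m, ∀ a b, lo S a = lo S b → a < b → t.pi^[m] a < t.pi^[m] b := by
    intro m
    induction m with
    | zero => exact fun a b _ h => h
    | succ m ih => intro a b hab hl; exact ih _ _ (h.pf_lo hgen hab) (t.pf_lt_pf (h.J_eq hab) hl)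
  let f : {a : Fin (2*g) // lo S a = lo S i} → {a : Fin (2*g) // lo S a = lo S i} :=
    fun a => ⟨t.pi^[m] a.1, (hit m _ _ a.2).trans e⟩
  have hf : StrictMono f := fun a b hab => hlt m a.1 b.1 (a.2.trans b.2.symm) hab
  have h1 := hf.le_apply (x := ⟨i, rfl⟩)
  have h2 := hf.apply_le (x := ⟨i, rfl⟩)
  exact congrArg Subtype.val (le_antisymm h2 h1)

end BS
end blocks
end ZipOrb

namespace ZipOrb
set_option linter.unusedSectionVars false
set_option linter.unusedSimpArgs false
section existence
variable {k H : Type*} [Field k] [AddCommGroup H] [Module k H] [FiniteDimensional k H]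
variable {p : ℕ} [Fact p.Prime] [CharP k p]
variable {g : ℕ} {ω : H →ₗ[k] H →ₗ[k] k} {φ : H →ₛₗ[frobenius k p] H}

lemma coef_add (ω : H →ₗ[k] H →ₗ[k] k) (e : Fin (2*g) → H) (x y : H) (i) :
    coef ω e (x + y) i = coef ω e x i + coef ω e y i := by
  simp [coef, mul_add]

lemma coef_sub (ω : H →ₗ[k] H →ₗ[k] k) (e : Fin (2*g) → H) (x y : H) (i) :
    coef ω e (x - y) i = coef ω e x i - coef ω e y i := by
  simp [coef, mul_sub]

lemma coef_smul (ω : H →ₗ[k] H →ₗ[k] k) (e : Fin (2*g) → H) (a : k) (x : H) (i) :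
    coef ω e (a • x) i = a * coef ω e x i := by
  simp [coef]; ring

lemma coef_sum' (ω : H →ₗ[k] H →ₗ[k] k) (e : Fin (2*g) → H) {ι : Type*} (s : Finset ι) (x : ι → H) (i) :
    coef ω e (∑ a ∈ s, x a) i = ∑ a ∈ s, coef ω e (x a) i := by
  simp [coef, Finset.mul_sum]

lemma Symp.mem_W_coef {e : Fin (2*g) → H} (he : Symp ω e) (hS : SS g ω) {x : H} {s : ℕ} :
    x ∈ W k e s ↔ ∀ i : Fin (2*g), s ≤ i.val → coef ω e x i = 0 := by
  rw [he.mem_W hS]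
  refine forall₂_congr fun i _ => ?_
  rw [coef, mul_eq_zero, or_iff_right (ep_ne i)]

lemma Symp.coef_self {e : Fin (2*g) → H} (he : Symp ω e) (i j : Fin (2*g)) :
    coef ω e (e i) j = if j = i then 1 else 0 := by
  rw [coef, he]
  by_cases h : j = i
  · subst h; simp [ep_sq]
  · rw [if_neg h, if_neg, mul_zero]
    exact fun h' => h (Fin.rev_injective h')

lemma exists_V [PerfectRing k p] (hS : SS g ω) {e : Fin (2*g) → H} (he : Symp ω e) (φ : H →ₛₗ[frobenius k p] H) (v : H) :
    ∃ u, Adj ω φ u v := by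
  choose rt hrt using fun l => exists_root p (ω (φ (e l)) v)
  let u : H := ∑ i, (ep k (Fin.rev i) * rt (Fin.rev i)) • e i
  have hu : ∀ l, ω (e l) u = rt l := by
    intro l
    have he2 : ∀ i j, ω (e i) (e j) = if j = Fin.rev i then ep k i else 0 := he
    simp only [u, map_sum, map_smul, he2, smul_eq_mul, mul_ite, mul_zero, Finset.sum_ite_eq', Finset.mem_univ,
      if_true, Fin.rev_rev]
    linear_combination rt l * ep_sq (k := k) l
  refine ⟨u, fun x => ?_⟩
  have : x ∈ Submodule.span k (Set.range e) := by rw [he.span_top hS]; trivial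
  induction this using Submodule.span_induction with
  | mem x hx => obtain ⟨l, rfl⟩ := hx; rw [hu, hrt]
  | zero => simp [pp]
  | add x y _ _ hx hy =>
    rw [map_add, map_add, LinearMap.add_apply, hx, hy, map_add, LinearMap.add_apply]
    exact (map_add (frobenius k p) _ _).symm
  | smul a x _ hx =>
    rw [phi_smul, map_smul, LinearMap.smul_apply, hx, map_smul, LinearMap.smul_apply, smul_eq_mul, smul_eq_mul, mul_pow]

namespace AD
variable {t : ZT g} {S : Set ℕ} {e : Fin (2*g) → H}

section
variable [PerfectRing k p]

lemma toBS (h : AD ω φ t S e) : BS t S := ⟨h.S0, h.Sle, h.Srev, h.Sc⟩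

lemma phi_mem (h : AD ω φ t S e) {s : ℕ} (hs : s ∈ S) {x : H} (hx : x ∈ W k e s) : φ x ∈ W k e (cnt t.J s) := by
  rw [← h.map s hs]; exact ⟨x, hx, rfl⟩

lemma coef_phi (hS : SS g ω) (h : AD ω φ t S e) {s : ℕ} (hs : s ∈ S) {x : H} (hx : x ∈ W k e s)
    {m : Fin (2*g)} (hm : cnt t.J s ≤ m.val) : coef ω e (φ x) m = 0 :=
  (h.symp.mem_W_coef hS).1 (h.phi_mem hs hx) m hm

lemma gS (h : AD ω φ t S e) : g ∈ S := by
  have := h.Sc _ (h.Srev 0 h.S0)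
  rwa [Nat.sub_zero, t.cnt_top] at this

lemma ep_lo (h : AD ω φ t S e) {i j : Fin (2*g)} (hl : lo S i = lo S j) : ep k i = ep k j := by
  have := h.toBS.lo_eq_iff.1 hl g h.gS
  unfold ep
  congr 1
  rw [eq_iff_iff]; omega

/-- the block matrices -/
lemma exists_mat (hS : SS g ω) (h : AD ω φ t S e) : ∃ A Y : Matrix (Fin (2*g)) (Fin (2*g)) k,
    Y * A = 1 ∧ (∀ l i, lo S l ≠ lo S i → A l i = 0) ∧ (∀ l i, lo S l ≠ lo S i → Y l i = 0) ∧
    ∀ l i, t.J i = true → cnt t.J (lo S i) ≤ (t.pf l).val → coef ω e (φ (e i)) (t.pf l) = A l i := by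
  classical
  have hb := h.toBS
  have he := h.symp
  let A : Matrix (Fin (2*g)) (Fin (2*g)) k := fun l i =>
    if lo S l = lo S i then (if t.J i = true then coef ω e (φ (e i)) (t.pf l) else if l = i then 1 else 0) else 0
  have hz : ∀ l, ∃ z : Fin (2*g) → k, t.J l = true → 
      (∀ i : Fin (2*g), hi S l ≤ i.val → z i = 0) ∧ φ (∑ i, z i • e i) = e (t.pf l) := by
    intro l
    by_cases hl : t.J l = true
    · have h1 : e (t.pf l) ∈ (W k e (hi S l)).map φ := by
        rw [h.map _ (hb.hi_mem l)]
        exact mem_W_of_lt e ((t.pf_lt_cnt hl _).2 (BS.lt_hi l))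
      obtain ⟨x, hx, hx'⟩ := h1
      refine ⟨coef ω e x, fun _ => ⟨(he.mem_W_coef hS).1 hx, ?_⟩⟩
      rw [← he.expand hS x]; exact hx'
    · exact ⟨0, fun h => absurd h hl⟩
  choose z hz using hz
  let Y : Matrix (Fin (2*g)) (Fin (2*g)) k := fun i l =>
    if lo S l = lo S i then (if t.J l = true then z l i ^ p else if l = i then 1 else 0) else 0
  have hAY : A * Y = 1 := by
    ext l' l
    rw [Matrix.mul_apply, Matrix.one_apply]
    by_cases hll : lo S l' = lo S l
    · cases hl : t.J l
      · rw [Finset.sum_eq_single l]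
        · have : t.J l = false := hl
          simp [A, Y, hl, hll]
        · intro i _ hi
          simp [A, Y, hl, hi.symm]
        · simp
      · have hl' : t.J l' = true := by rw [hb.J_eq hll, hl]
        obtain ⟨h1, h2⟩ := hz l hl
        have h3 := congrArg (fun x => coef ω e x (t.pf l')) h2
        simp only [map_sum, coef_sum', phi_smul, coef_smul, he.coef_self] at h3
        have h4 : (t.pf l' = t.pf l) ↔ l' = l := t.pf_inj.eq_iff
        simp only [h4] at h3
        rw [← h3]
        refine Finset.sum_congr rfl fun i _ => ?_
        by_cases hi : lo S l = lo S i
        · have hJi : t.J i = true := by rw [← hb.J_eq hi, hl]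
          simp only [A, Y, hll, hi, hJi, hl, if_true]
          ring
        · have hA : A l' i = 0 := by simp only [A]; rw [if_neg]; rwa [hll]
          rw [hA, zero_mul]
          rcases Nat.lt_or_ge i.val (lo S l) with h5 | h5
          · rw [h.coef_phi hS (hb.lo_mem l) (mem_W_of_lt e h5), mul_zero]
            have h6 := t.pf_lt_cnt hl' (lo S l)
            have h7 := BS.lo_le S l'
            by_contra hc
            have := h6.1 (by omega)
            omega
          · rw [h1 i (hb.hi_le_of (fun h => hi h.symm) h5), zero_pow pp, zero_mul]
    · rw [if_neg (by rintro rfl; exact hll rfl)]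
      refine Finset.sum_eq_zero fun i _ => ?_
      simp only [A, Y]
      by_cases h1 : lo S l' = lo S i
      · rw [if_neg (c := lo S l = lo S i) (fun h2 => hll (h1.trans h2.symm)), mul_zero]
      · rw [if_neg (c := lo S l' = lo S i) h1, zero_mul]
  refine ⟨A, Y, mul_eq_one_comm.1 hAY, ?_, ?_, ?_⟩
  · intro l i hli; simp only [A]; rw [if_neg hli]
  · intro l i hli; simp only [Y]; rw [if_neg (Ne.symm hli)]
  · intro l i hJi hc
    by_cases hli : lo S l = lo S i
    · simp only [A, hli, hJi, if_true]
    · simp only [A]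
      rw [if_neg hli]
      refine h.coef_phi hS (hb.hi_mem i) (mem_W_of_lt e (BS.lt_hi i)) ?_
      cases hl : t.J l
      · exact (t.cnt_le_g _ (h.Sle _ (hb.hi_mem i))).trans (t.pf_ge_g hl)
      · have h1 := t.pf_lt_cnt hl (lo S i)
        have h2 := t.pf_lt_cnt hl (hi S i)
        have h3 := hb.hi_le_of hli (by omega)
        omega

end

variable [IsAlgClosed k]

lemma exists_frame (hS : SS g ω) (h : AD ω φ t S e) : ∃ f : Fin (2*g) → Fin (2*g) → k,
    (∀ i j, lo S j ≠ lo S i → f i j = 0) ∧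
    (∀ i j, Bf Fin.rev (f i) (f j) = if j = Fin.rev i then 1 else 0) ∧
    ∀ j l, t.J j = true → cnt t.J (lo S j) ≤ (t.pf l).val →
      f (t.pf j) (t.pf l) = ∑ i, f j i ^ p * coef ω e (φ (e i)) (t.pf l) := by
  classical
  have hb := h.toBS
  obtain ⟨A, Y, hYA, hA0, hY0, hA⟩ := h.exists_mat hS
  let A' : Fin (2*g) → Fin (2*g) → k := fun l i => if t.J i = true then A l i else Y (Fin.rev i) (Fin.rev l)
  have hA'0 : ∀ l i, lo S l ≠ lo S i → A' l i = 0 := by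
    intro l i hli
    simp only [A']
    split_ifs
    · exact hA0 l i hli
    · refine hY0 _ _ fun h2 => hli ?_
      have := hb.lo_rev h2
      rw [Fin.rev_rev, Fin.rev_rev] at this
      exact this.symm
  have hsum : ∀ i i', ∑ l, A' l i * A' (Fin.rev l) i' = if i' = Fin.rev i then 1 else 0 := by
    intro i i'
    by_cases hJJ : t.J i' = t.J i
    · rw [if_neg]
      · refine Finset.sum_eq_zero fun l _ => ?_
        by_cases h1 : lo S l = lo S i
        · by_cases h2 : lo S (Fin.rev l) = lo S i'
          · have h3 := hb.J_eq h1
            have h4 := hb.J_eq h2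
            rw [t.hJ, h3, hJJ] at h4
            cases hh : t.J i <;> rw [hh] at h4 <;> cases h4
          · rw [hA'0 _ _ h2, mul_zero]
        · rw [hA'0 _ _ h1, zero_mul]
      · rintro rfl
        rw [t.hJ] at hJJ
        cases hh : t.J i <;> rw [hh] at hJJ <;> cases hJJ
    · cases hi : t.J i
      · have hi' : t.J i' = true := by cases hh : t.J i' <;> simp_all
        have := congrFun (congrFun hYA (Fin.rev i)) i'
        rw [Matrix.mul_apply, Matrix.one_apply] at this
        rw [← Equiv.sum_comp Fin.revPerm] at this
        simp only [A', hi, hi', if_true, Fin.revPerm_apply] at this ⊢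
        simp only [Bool.false_eq_true, if_false]
        rw [this]
        congr 1
        exact propext eq_comm
      · have hi' : t.J i' = false := by cases hh : t.J i' <;> simp_all
        have := congrFun (congrFun hYA (Fin.rev i')) i
        rw [Matrix.mul_apply, Matrix.one_apply] at this
        simp only [A', hi, hi', if_true, Bool.false_eq_true, if_false, Fin.rev_rev]
        simp only [mul_comm (A _ i)]
        rw [this]
        congr 1
        exact propext ⟨fun h => by rw [← h, Fin.rev_rev], fun h => by rw [h, Fin.rev_rev]⟩
  let R : (Fin (2*g) → k) →+ (Fin (2*g) → k) := AddMonoidHom.mk'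
    (fun x m => ∑ i, A' (t.pi.symm m) i * x i ^ p) (fun x y => by
      funext m
      simp only [Pi.add_apply]
      rw [← Finset.sum_add_distrib]
      refine Finset.sum_congr rfl fun i _ => ?_
      rw [show (x i + y i) ^ p = x i ^ p + y i ^ p from map_add (frobenius k p) _ _, mul_add])
  have hR : ∀ x l, R x (t.pf l) = ∑ i, A' l i * x i ^ p := by
    intro x l
    show ∑ i, A' (t.pi.symm (t.pf l)) i * x i ^ p = _
    rw [show t.pi.symm (t.pf l) = l from t.pi.symm_apply_apply l]
  have hBL : BL p t.pi Fin.rev (lo S) R :=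
    { rr := Fin.rev_rev
      rpi := t.pi_rev
      clpi := fun i j hij => hb.pf_lo h.Sgen hij
      clr := fun i j hij => hb.lo_rev hij
      nr := fun i hi => by
        have := hb.J_eq hi
        rw [t.hJ] at this
        cases hh : t.J i <;> rw [hh] at this <;> cases this
      o1 := hb.pf_o1 h.Sgen
      Rs := fun a x => by
        funext m
        show ∑ i, A' (t.pi.symm m) i * (a * x i) ^ p = a ^ p * ∑ i, A' (t.pi.symm m) i * x i ^ p
        rw [Finset.mul_sum]
        refine Finset.sum_congr rfl fun i _ => ?_
        ring
      RX := fun i x hx => by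
        intro m hm
        obtain ⟨l, rfl⟩ := t.pi.surjective m
        rw [t.pi_apply, hR]
        refine Finset.sum_eq_zero fun i' _ => ?_
        by_cases h1 : lo S i' = lo S i
        · rw [hA'0 l i', zero_mul]
          intro h2
          exact hm (hb.pf_lo h.Sgen (h2.trans h1))
        · rw [hx i' h1, zero_pow pp, mul_zero]
      RB := fun x y => by
        unfold Bf
        rw [← Equiv.sum_comp t.pi]
        simp only [t.pi_apply, ← t.pi_rev, hR]
        have e1 : (∑ i, x i * y (Fin.rev i)) ^ p = ∑ i, x i ^ p * y (Fin.rev i) ^ p := by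
          have := map_sum (frobenius k p) (fun i => x i * y (Fin.rev i)) Finset.univ
          simp only [frobenius_def, mul_pow] at this
          exact this
        rw [e1]
        simp only [Finset.sum_mul_sum]
        rw [Finset.sum_comm]
        refine Finset.sum_congr rfl fun i _ => ?_
        rw [Finset.sum_comm]
        have : ∀ i', ∑ l, A' l i * x i ^ p * (A' (Fin.rev l) i' * y i' ^ p) =
            if i' = Fin.rev i then x i ^ p * y i' ^ p else 0 := by
          intro i'
          have h2 := congrArg (fun c => c * (x i ^ p * y i' ^ p)) (hsum i i')
          simp only [Finset.sum_mul, ite_mul, one_mul, zero_mul] at h2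
          rw [← h2]
          refine Finset.sum_congr rfl fun l _ => ?_
          ring
        simp only [this, Finset.sum_ite_eq', Finset.mem_univ, if_true] }
  obtain ⟨f, hf1, hf2, hf3⟩ := hBL.main
  refine ⟨f, fun i j hij => hf1 i j hij, hf3, ?_⟩
  intro j l hj hl
  have := hf2 j
  rw [t.pi_apply] at this
  rw [← this, hR]
  refine Finset.sum_congr rfl fun i _ => ?_
  by_cases hi : lo S i = lo S j
  · have hJi : t.J i = true := by rw [hb.J_eq hi, hj]
    rw [hA l i hJi (by rw [hi]; exact hl)]
    simp only [A', hJi, if_true]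
    ring
  · rw [hf1 j i hi, zero_pow pp]; ring

lemma exists_good (hS : SS g ω) (h : AD ω φ t S e) : ∃ e', Good ω φ t S e' := by
  classical
  have hb := h.toBS
  have he := h.symp
  obtain ⟨f, hf0, hfB, hfR⟩ := h.exists_frame hS
  let e' : Fin (2*g) → H := fun j => ∑ i, f j i • e i
  have hcoef : ∀ j i, coef ω e (e' j) i = f j i := fun j i => he.coef_sum _ i
  have he' : Symp ω e' := by
    intro i j
    have e1 : ω (e' i) (e' j) = ∑ a, ep k i * (f i a * f j (Fin.rev a)) := by
      have he2 : ∀ i j, ω (e i) (e j) = if j = Fin.rev i then ep k i else 0 := he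
      simp only [e', map_sum, LinearMap.sum_apply, map_smul, LinearMap.smul_apply, he2, smul_eq_mul, Finset.mul_sum]
      rw [Finset.sum_comm]
      refine Finset.sum_congr rfl fun a _ => ?_
      rw [Finset.sum_eq_single (Fin.rev a)]
      · rw [if_pos rfl]
        by_cases ha : lo S a = lo S i
        · rw [h.ep_lo (k := k) ha]; ring
        · rw [hf0 i a ha]; ring
      · intro b _ hb; rw [if_neg hb]; ring
      · simp
    rw [e1, ← Finset.mul_sum]
    have := hfB i j
    unfold Bf at this
    rw [this]; split_ifs <;> simp
  have hWW : ∀ s ∈ S, W k e' s = W k e s := by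
    intro s hs
    apply Submodule.eq_of_le_of_finrank_eq
    · rw [W_le_iff]; intro i hi
      rw [he.mem_W_coef hS]
      intro m hm
      rw [hcoef]
      refine hf0 i m fun h2 => ?_
      have := hb.lo_eq_iff.1 h2 s hs
      omega
    · rw [finrank_W he.li (h.Sle s hs), finrank_W he'.li (h.Sle s hs)]
  have hd : ∀ j, t.J j = true → φ (e' j) - e' (t.pf j) ∈ W k e (cnt t.J (lo S j)) := by
    intro j hj
    rw [he.mem_W_coef hS]
    intro m hm
    obtain ⟨l, rfl⟩ := t.pi.surjective m
    rw [t.pi_apply] at hm ⊢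
    rw [coef_sub, hcoef, hfR j l hj hm]
    simp only [e', map_sum, coef_sum', phi_smul, coef_smul, sub_self]
  refine ⟨e', he', ?_, ?_⟩
  · intro j hj
    have h1 := hd j hj
    rw [← h.map _ (hb.lo_mem j)] at h1
    obtain ⟨w, hw, hw'⟩ := h1
    refine ⟨lo S j, hb.lo_mem j, BS.lo_le S j, -w, ?_, ?_⟩
    · rw [hWW _ (hb.lo_mem j)]; exact Submodule.neg_mem _ hw
    · rw [map_add, map_neg, hw']; abel
  · intro j hj
    obtain ⟨u, hu⟩ := exists_V hS he φ (ep k (Fin.rev j) • e' (t.pf j))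
    refine ⟨lo S j, hb.lo_mem j, BS.lo_le S j, u - e' j, ?_, by rwa [add_sub_cancel]⟩
    rw [he'.mem_W' hS]
    intro l hl
    have hrj : t.J (Fin.rev j) = true := by rw [t.hJ, hj]; rfl
    have hrm := hb.lo_mem (Fin.rev j)
    have hpair : ∀ x ∈ W k e (cnt t.J (lo S (Fin.rev j))), ω x (e' (t.pf j)) = 0 := by
      intro x hx
      rw [← hWW _ (h.Sc _ hrm)] at hx
      have h1 := (he'.mem_W hS).1 hx (t.pf (Fin.rev j)) (by
        have := t.pf_lt_cnt hrj (lo S (Fin.rev j))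
        have := BS.lo_le S (Fin.rev j)
        by_contra hc
        omega)
      rwa [t.pi_rev, Fin.rev_rev] at h1
    have hlhi : l.val < hi S (Fin.rev j) := by unfold hi; rw [Fin.rev_rev]; exact hl
    suffices hh : ω (e' l) u = ω (e' l) (e' j) by
      rw [map_sub, LinearMap.sub_apply, hS.skew u, hS.skew (e' j), hh, sub_self]
    apply pinj (p := p)
    rw [← hu (e' l), he', map_smul, smul_eq_mul]
    cases hJl : t.J l
    · rw [if_neg (fun e => by rw [e, t.hJ, hJl] at hj; cases hj), zero_pow pp, hpair, mul_zero]
      apply h.phi_mem hrm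
      rw [← hWW _ hrm]
      apply mem_W_of_lt
      by_contra hc
      have := hb.hi_le_of (i := Fin.rev j) (j := l) (fun h2 => by
        have := hb.J_eq h2
        rw [hJl, hrj] at this; cases this) (by omega)
      omega
    · have e1 : φ (e' l) = e' (t.pf l) + (φ (e' l) - e' (t.pf l)) := by abel
      have hlo : lo S l ≤ lo S (Fin.rev j) := by
        by_contra hc
        have h1 := BS.lo_le S l
        have h2 : ¬ lo S l ≤ (Fin.rev j).val := fun h3 => hc (BS.le_lo (hb.lo_mem l) h3)
        have := hb.hi_le (j := Fin.rev j) (hb.lo_mem l) (by omega)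
        omega
      rw [e1, map_add, LinearMap.add_apply, hpair _ (W_mono e (cnt_mono t.J hlo).1 (hd l hJl)), add_zero, he']
      by_cases hjl : j = Fin.rev l
      · subst hjl
        have := t.pf_lt_g hJl
        rw [if_pos rfl, if_pos (t.pi_rev l), Fin.rev_rev, ep_pow]
        simp [ep, this]
      · rw [if_neg hjl, if_neg, mul_zero, zero_pow pp]
        rw [← t.pi_rev]
        exact fun h' => hjl (t.pf_inj h')

end AD

lemma exists_NB [IsAlgClosed k] (hS : SS g ω) (hC : IsLagrangian ω (LinearMap.ker φ))
    (hD : IsLagrangian ω (LinearMap.range φ)) : ∃ (t : ZT g) (e : Fin (2*g) → H), NB ω φ t e := by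
  obtain ⟨t, S, e, h⟩ := exists_AD hS hC hD
  obtain ⟨e', h'⟩ := h.exists_good hS
  obtain ⟨N, hN⟩ := h.SN
  obtain ⟨e'', h''⟩ := lift_all hS hC hD t N e' ⟨h'.symp,
    fun j hj => by
      obtain ⟨s, hs, r⟩ := h'.jmp j hj
      exact ⟨s, hN hs, r⟩,
    fun j hj => by
      obtain ⟨s, hs, r⟩ := h'.njm j hj
      exact ⟨s, hN hs, r⟩⟩
  exact ⟨t, e'', h''⟩

end existence
end ZipOrb

namespace ZipOrb
set_option linter.unusedSectionVars false
set_option linter.unusedSimpArgs false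
section final
variable {k H : Type*} [Field k] [AddCommGroup H] [Module k H] [FiniteDimensional k H]
variable {p : ℕ} [Fact p.Prime] [CharP k p] [PerfectRing k p]
variable {g : ℕ} {ω : H →ₗ[k] H →ₗ[k] k} {φ : H →ₛₗ[frobenius k p] H}

lemma NB.map_W {t : ZT g} {e : Fin (2*g) → H} (h : NB ω φ t e) {s : ℕ} (hs : s ≤ 2*g) :
    (W k e s).map φ = W k e (cnt t.J s) := by
  apply le_antisymm
  · rw [Submodule.map_le_iff_le_comap, W_le_iff]
    intro i hi
    rw [Submodule.mem_comap, h.im]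
    cases hJ : t.J i
    · simp
    · simp only [if_true]
      exact mem_W_of_lt e ((t.pf_lt_cnt hJ s).2 hi)
  · rw [W_le_iff]
    intro i hi
    obtain ⟨l, hl, hls, rfl⟩ := t.exists_pf_lt hi hs
    refine ⟨e l, mem_W_of_lt e hls, ?_⟩
    rw [h.im, if_pos hl]

lemma ZT.ext' {t t' : ZT g} (h : ∀ i, t.J i = t'.J i) : t = t' := by
  cases t; cases t'; congr; exact funext h

lemma NB.unique (hS : SS g ω) {t t' : ZT g} {e e' : Fin (2*g) → H} (h : NB ω φ t e) (h' : NB ω φ t' e') :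
    t = t' := by
  let S : Set ℕ := {s | s ≤ 2*g ∧ W k e s = W k e' s}
  have hc : ∀ s ∈ S, cnt t.J s = cnt t'.J s := by
    intro s hs
    have h1 := h.map_W hs.1
    have h2 := h'.map_W hs.1
    rw [hs.2, h2] at h1
    have h3 := congrArg (fun X : Submodule k H => Module.finrank k X) h1
    rw [finrank_W h.symp.li ((cnt_le _ _).trans hs.1), finrank_W h'.symp.li ((cnt_le _ _).trans hs.1)] at h3
    exact h3.symm
  have hb : BS t S :=
    { S0 := ⟨Nat.zero_le _, by rw [W_zero, W_zero]⟩
      Sle := fun s hs => hs.1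
      Srev := fun s hs => ⟨Nat.sub_le _ _, by
        rw [← h.symp.perp_W hS, ← h'.symp.perp_W hS, hs.2]⟩
      Sc := fun s hs => ⟨(cnt_le _ _).trans hs.1, by
        rw [← h.map_W hs.1, hs.2, h'.map_W hs.1, hc s hs]⟩ }
  have hb' : BS t' S := ⟨hb.S0, hb.Sle, hb.Srev, fun s hs => by rw [← hc s hs]; exact hb.Sc s hs⟩
  refine ZT.ext' fun j => ?_
  rw [Bool.eq_iff_iff, hb.J_iff, hb'.J_iff, hc _ (hb.lo_mem j), hc _ (hb.hi_mem j)]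

/-- the standard map -/
noncomputable def stdMap (p : ℕ) [Fact p.Prime] [CharP k p] (ω : H →ₗ[k] H →ₗ[k] k) (e : Fin (2*g) → H)
    (v : Fin (2*g) → H) : H →ₛₗ[frobenius k p] H where
  toFun x := ∑ i, (coef ω e x i) ^ p • v i
  map_add' x y := by
    rw [← Finset.sum_add_distrib]
    refine Finset.sum_congr rfl fun i _ => ?_
    rw [coef_add, ← add_smul]
    congr 1
    exact map_add (frobenius k p) _ _
  map_smul' a x := by
    rw [Finset.smul_sum]
    refine Finset.sum_congr rfl fun i _ => ?_
    rw [coef_smul, mul_pow, mul_smul]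
    rfl

lemma realize (p : ℕ) [Fact p.Prime] [CharP k p] [PerfectRing k p] (hS : SS g ω) (t : ZT g) :
    ∃ (φ : H →ₛₗ[frobenius k p] H) (e : Fin (2*g) → H),
    IsLagrangian ω (LinearMap.ker φ) ∧ IsLagrangian ω (LinearMap.range φ) ∧ NB ω φ t e := by
  obtain ⟨e, he⟩ := hS.exists_symp
  let v : Fin (2*g) → H := fun j => if t.J j then e (t.pf j) else 0
  let φ := stdMap p ω e v
  have hφ : ∀ x, φ x = ∑ i, (coef ω e x i) ^ p • v i := fun x => rfl
  have hNB : NB ω φ t e := ⟨he, fun j => by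
    rw [hφ, Finset.sum_eq_single j]
    · rw [he.coef_self, if_pos rfl, one_pow, one_smul]
    · intro i _ hij
      rw [he.coef_self, if_neg hij, zero_pow pp, zero_smul]
    · simp⟩
  have hker : ∀ x, φ x = 0 ↔ ∀ i, t.J i = true → coef ω e x i = 0 := by
    intro x
    constructor
    · intro h i hi
      have h1 := congrArg (fun y => coef ω e y (t.pf i)) (hφ x)
      simp only [coef_sum', coef_smul] at h1
      rw [Finset.sum_eq_single i] at h1
      · simp only [v, hi, if_true, he.coef_self, mul_one] at h1
        rw [h] at h1
        have h0 : coef ω e 0 (t.pf i) = 0 := by simp [coef]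
        rw [h0] at h1
        exact pow_eq_zero_iff (pp (p := p)) |>.1 h1.symm
      · intro l _ hl
        simp only [v]
        split_ifs
        · rw [he.coef_self, if_neg, mul_zero]
          exact fun h2 => hl (t.pf_inj h2).symm
        · simp [coef]
      · simp
    · intro h
      rw [hφ]
      refine Finset.sum_eq_zero fun i _ => ?_
      cases hi : t.J i
      · simp [v, hi]
      · rw [h i hi, zero_pow pp, zero_smul]
  refine ⟨φ, e, ?_, ?_, hNB⟩
  · ext x
    rw [LinearMap.mem_ker, hker]
    constructor
    · intro hx i hi
      rw [coef, hx, mul_zero]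
      rw [LinearMap.mem_ker, hNB.im, t.hJ, hi]
      simp
    · intro hx y hy
      rw [LinearMap.mem_ker, hker] at hy
      rw [he.expand hS y, map_sum]
      refine Finset.sum_eq_zero fun i _ => ?_
      rw [map_smul, smul_eq_mul]
      cases hi : t.J i
      · have := hx (Fin.rev i) (by rw [t.hJ, hi]; rfl)
        rw [coef, mul_eq_zero, or_iff_right (ep_ne _), Fin.rev_rev] at this
        rw [this, mul_zero]
      · rw [hy i hi, zero_mul]
  · have : LinearMap.range φ = W k e g := by
      rw [LinearMap.range_eq_map, ← he.W_top hS le_rfl, hNB.map_W le_rfl, t.cnt_top]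
    rw [this, IsLagrangian, he.perp_W hS]
    congr 1
    omega

lemma NB.conj {t : ZT g} {e : Fin (2*g) → H} (h : NB ω φ t e) {ψ : H →ₛₗ[frobenius k p] H} (τ : H ≃ₗ[k] H)
    (hτ : ∀ x y, ω (τ x) (τ y) = ω x y) (hψ : ∀ x, ψ x = τ (φ (τ.symm x))) : NB ω ψ t (fun i => τ (e i)) :=
  ⟨fun i j => by rw [hτ]; exact h.symp i j, fun j => by
    rw [hψ, τ.symm_apply_apply, h.im]
    split_ifs <;> simp⟩

lemma NB.exists_conj (hS : SS g ω) {t : ZT g} {e e' : Fin (2*g) → H} (h : NB ω φ t e)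
    {ψ : H →ₛₗ[frobenius k p] H} (h' : NB ω ψ t e') :
    ∃ τ : H ≃ₗ[k] H, (∀ x y, ω (τ x) (τ y) = ω x y) ∧ ∀ x : H, ψ x = τ (φ (τ.symm x)) := by
  let b := Module.Basis.mk h.symp.li (h.symp.span_top hS).ge
  let b' := Module.Basis.mk h'.symp.li (h'.symp.span_top hS).ge
  let τ := b.equiv b' (Equiv.refl _)
  have hτ : ∀ i, τ (e i) = e' i := by
    intro i
    have := b.equiv_apply i b' (Equiv.refl _)
    simpa [b, b', τ] using this
  refine ⟨τ, ?_, ?_⟩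
  · intro x y
    rw [h.symp.expand hS x, h.symp.expand hS y]
    simp only [map_sum, map_smul, LinearMap.sum_apply, LinearMap.smul_apply, hτ]
    have e1 : ∀ i j, ω (e' i) (e' j) = ω (e i) (e j) := fun i j => by rw [h.symp, h'.symp]
    simp only [e1]
  · intro x
    obtain ⟨y, rfl⟩ := τ.surjective x
    rw [τ.symm_apply_apply, h.symp.expand hS y]
    simp only [map_sum, map_smul, phi_smul, hτ, h.im, h'.im]
    refine Finset.sum_congr rfl fun i _ => ?_
    split_ifs <;> simp [hτ]

lemma exists_ZT_equiv (g : ℕ) : Nonempty (ZT g ≃ Fin (2^g)) := by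
  let E : ZT g ≃ (Fin g → Bool) :=
    { toFun := fun t i => t.J ⟨i.val, by omega⟩
      invFun := fun f => ⟨fun i => if h : i.val < g then f ⟨i.val, h⟩ else
          !(f ⟨(Fin.rev i).val, by rw [Fin.val_rev]; omega⟩), fun i => by
        have hi := i.2
        by_cases h : i.val < g
        · have h2 : ¬ (Fin.rev i).val < g := by rw [Fin.val_rev]; omega
          rw [dif_neg h2, dif_pos h]
          simp only [Fin.rev_rev]
        · have h2 : (Fin.rev i).val < g := by rw [Fin.val_rev]; omega
          rw [dif_pos h2, dif_neg h, Bool.not_not]⟩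
      left_inv := fun t => ZT.ext' fun i => by
        by_cases h : i.val < g
        · simp only [dif_pos h]
        · simp only [dif_neg h]
          rw [Fin.eta, t.hJ, Bool.not_not]
      right_inv := fun f => by
        funext i
        simp }
  refine ⟨E.trans (Fintype.equivFinOfCardEq (by simp))⟩

end final
end ZipOrb

theorem zip_orbit_count
    {k : Type*} [Field k] (p : ℕ) [Fact p.Prime] [CharP k p] [IsAlgClosed k]
    {H : Type*} [AddCommGroup H] [Module k H] [FiniteDimensional k H]
    (g : ℕ)
    (ω : H →ₗ[k] H →ₗ[k] k)
    (halt : ∀ x, ω x x = 0)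
    (hnd : ∀ x, (∀ y, ω x y = 0) → x = 0)
    (hdim : Module.finrank k H = 2 * g) :
    ∃ c : {φ : H →ₛₗ[frobenius k p] H //
        IsLagrangian ω (LinearMap.ker φ) ∧ IsLagrangian ω (LinearMap.range φ)} →
          Fin (2 ^ g),
      Function.Surjective c ∧
      ∀ A B, c A = c B ↔
        ∃ τ : H ≃ₗ[k] H, (∀ x y, ω (τ x) (τ y) = ω x y) ∧
          ∀ x : H, B.1 x = τ (A.1 (τ.symm x)) := by
  have hS : ZipOrb.SS g ω := ⟨halt, hnd, hdim⟩
  obtain ⟨E⟩ := ZipOrb.exists_ZT_equiv g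
  choose t e h using fun A : {φ : H →ₛₗ[frobenius k p] H //
        IsLagrangian ω (LinearMap.ker φ) ∧ IsLagrangian ω (LinearMap.range φ)} =>
    ZipOrb.exists_NB hS A.2.1 A.2.2
  refine ⟨fun A => E (t A), ?_, ?_⟩
  · intro n
    obtain ⟨φ, e', hC, hD, hN⟩ := ZipOrb.realize p hS (E.symm n)
    refine ⟨⟨φ, hC, hD⟩, ?_⟩
    have := (h ⟨φ, hC, hD⟩).unique hS hN
    simp only [this, E.apply_symm_apply]
  · intro A B
    constructor
    · intro hAB
      have hAB' : t A = t B := E.injective hAB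
      have hB := h B
      rw [← hAB'] at hB
      exact (h A).exists_conj hS hB
    · rintro ⟨τ, h1, h2⟩
      exact congrArg E (((h A).conj τ h1 h2).unique hS (h B))
end

section
/- Let k be an algebraically closed field of characteristic p > 0, (H, ω) a finite-dimensional symplectic k-vector space, and I ⊆ H an isotropic subspace, with H' = I^⊥/I the induced symplectic space. Let φ and ψ be symplectic zips on H, both compatible with I, with induced zips φ' and ψ' on H'. If there exists σ ∈ Sp(H', ω') with ψ' = σ∘φ'∘σ^{-1}, then there exists τ ∈ Sp(H, ω) with ψ = τ∘φ∘τ^{-1}. -/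
open Polynomial in
/-- The polynomials recursively giving the coefficients of a solution. -/
noncomputable def zpoly {k : Type*} [Field k] (p : ℕ) (a : ℕ → k) (b : k) : ℕ → k[X]
  | 0 => C (a 0) * X ^ p + C b
  | (i+1) => zpoly p a b i ^ p + C (a (i+1)) * X ^ p

open Polynomial in
lemma zpoly_deriv {k : Type*} [Field k] (p : ℕ) [CharP k p] (a : ℕ → k) (b : k) (i : ℕ) :
    derivative (zpoly p a b i) = 0 := by
  cases i <;> simp [zpoly, derivative_pow]

open Polynomial in
lemma zpoly_root {k : Type*} [Field k] [IsAlgClosed k] (p : ℕ) [CharP k p]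
    (a : ℕ → k) (b : k) (i : ℕ) : ∃ t : k, (zpoly p a b i).eval t = t := by
  have hd : derivative (zpoly p a b i - X) = -1 := by simp [zpoly_deriv]
  have : (zpoly p a b i - X).degree ≠ 0 := by
    intro h
    rw [eq_C_of_degree_eq_zero h] at hd
    simp at hd
  obtain ⟨t, ht⟩ := IsAlgClosed.exists_root _ this
  exact ⟨t, by simpa [sub_eq_zero] using ht⟩

open Polynomial in
lemma zpoly_dvd {k : Type*} [Field k] (p : ℕ) (hp : p.Prime) (a : ℕ → k) (i : ℕ) :
    X ^ p ∣ zpoly p a 0 i ∧ (zpoly p a 0 i = 0 → ∀ j ≤ i, a j = 0) := by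
  induction i with
  | zero => simp [zpoly]
  | succ i ih =>
    obtain ⟨⟨q, hq⟩, h2⟩ := ih
    refine ⟨?_, ?_⟩
    · refine dvd_add ?_ (Dvd.intro_left _ rfl)
      exact dvd_trans ⟨q, hq⟩ (dvd_pow_self _ hp.ne_zero)
    · intro h
      have ha : a (i+1) = 0 := by
        have h3 := congrArg (fun r => coeff r p) h
        have h4 : coeff (zpoly p a 0 i ^ p) p = 0 := by
          rw [hq, mul_pow, ← pow_mul, coeff_X_pow_mul']
          have := hp.two_le
          rw [if_neg]; nlinarith
        simpa [zpoly, h4] using h3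
      have h0 : zpoly p a 0 i = 0 := by
        have : zpoly p a 0 i ^ p = 0 := by simpa [zpoly, ha] using h
        exact pow_eq_zero_iff hp.ne_zero |>.1 this
      intro j hj
      rcases Nat.lt_or_ge i j with h' | h'
      · obtain rfl : j = i + 1 := by omega
        exact ha
      · exact h2 h0 j h'

open Polynomial in
lemma zpoly_root_ne {k : Type*} [Field k] [IsAlgClosed k] (p : ℕ) [Fact p.Prime] [CharP k p]
    (a : ℕ → k) (i : ℕ) (h : ∃ j ≤ i, a j ≠ 0) :
    ∃ t : k, t ≠ 0 ∧ (zpoly p a 0 i).eval t = t := by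
  have hp : p.Prime := Fact.out
  obtain ⟨⟨q, hq⟩, h2⟩ := zpoly_dvd p hp a i
  have hq0 : q ≠ 0 := by
    rintro rfl
    obtain ⟨j, hj, hj'⟩ := h
    exact hj' (h2 (by simpa using hq) j hj)
  have hp1 : p - 1 ≠ 0 := by have := hp.two_le; omega
  have hdeg : (X ^ (p-1) * q - 1).degree ≠ 0 := by
    have : (X ^ (p-1) * q).degree = ((p - 1 + q.natDegree : ℕ) : WithBot ℕ) := by
      rw [degree_mul, degree_X_pow, degree_eq_natDegree hq0]; simp
    rw [degree_sub_eq_left_of_degree_lt, this]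
    · norm_cast; omega
    · rw [this, degree_one]; norm_cast; omega
  obtain ⟨t, ht⟩ := IsAlgClosed.exists_root _ hdeg
  have ht' : t ^ (p-1) * q.eval t = 1 := by simpa [sub_eq_zero] using ht
  refine ⟨t, ?_, ?_⟩
  · rintro rfl
    simp [zero_pow hp1] at ht'
  · rw [hq]
    obtain ⟨m, rfl⟩ : ∃ m, p = m + 1 := ⟨p - 1, by omega⟩
    simp at ht'
    simp [pow_succ', mul_assoc, ht']

/-- Solving `f y - y = -b v` inside a cyclic space. -/
lemma zsolve {k : Type*} [Field k] (p : ℕ) [Fact p.Prime] [CharP k p]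
    {V : Type*} [AddCommGroup V] [Module k V] (f : V →ₛₗ[frobenius k p] V) (v : V)
    (a : ℕ → k) (b : k) (n : ℕ)
    (hrel : f^[n+1] v = ∑ i ∈ Finset.range (n+1), a i • f^[i] v) (t : k)
    (ht : (zpoly p a b n).eval t = t) :
    f (∑ i ∈ Finset.range (n+1), (zpoly p a b i).eval t • f^[i] v)
      = (∑ i ∈ Finset.range (n+1), (zpoly p a b i).eval t • f^[i] v) - b • v := by
  have key : ∀ m, f (∑ i ∈ Finset.range (m+1), (zpoly p a b i).eval t • f^[i] v)
      = (∑ i ∈ Finset.range (m+1), (zpoly p a b i).eval t • f^[i] v) - b • v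
        + ((zpoly p a b m).eval t) ^ p • f^[m+1] v
        - t ^ p • ∑ i ∈ Finset.range (m+1), a i • f^[i] v := by
    intro m
    induction m with
    | zero =>
      simp [zpoly, frobenius_def]
      module
    | succ m ih =>
      rw [Finset.sum_range_succ, map_add, ih, Finset.sum_range_succ (fun i => a i • f^[i] v) (m+1),
        map_smulₛₗ, ← Function.iterate_succ_apply' f]
      simp only [frobenius_def]
      have : (zpoly p a b (m+1)).eval t = (zpoly p a b m).eval t ^ p + a (m+1) * t ^ p := by
        simp [zpoly]
      generalize (zpoly p a b (m+1)).eval t = c at *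
      subst this
      module
  rw [key, ht, hrel]
  abel

lemma zrel {k : Type*} [Field k] {V : Type*} [AddCommGroup V] [Module k V]
    [FiniteDimensional k V] (g : V → V) (v : V) (hv : v ≠ 0) :
    ∃ (n : ℕ) (a : ℕ → k), g^[n+1] v = ∑ i ∈ Finset.range (n+1), a i • g^[i] v ∧
      LinearIndependent k (fun i : Fin (n+1) => g^[i] v) := by
  classical
  have hex : ∃ n, ¬ LinearIndependent k (fun i : Fin n => g^[i] v) := by
    refine ⟨Module.finrank k V + 1, fun h => ?_⟩
    have := h.fintype_card_le_finrank
    simp at this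
  have h1 : Nat.find hex ≠ 0 := by
    intro h
    have := Nat.find_spec hex
    rw [h] at this
    exact this linearIndependent_empty_type
  have h2 : Nat.find hex ≠ 1 := by
    intro h
    have := Nat.find_spec hex
    rw [h] at this
    apply this
    rw [linearIndependent_unique_iff]
    simpa using hv
  obtain ⟨n, hn⟩ : ∃ n, Nat.find hex = n + 1 + 1 := ⟨Nat.find hex - 2, by omega⟩
  have hli : LinearIndependent k (fun i : Fin (n+1) => g^[i] v) := by
    have := Nat.find_min hex (m := n + 1) (by omega)
    simpa using this
  have hnli := Nat.find_spec hex
  rw [hn, linearIndependent_finSucc'] at hnli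
  have hmem : g^[n+1] v ∈ Submodule.span k (Set.range (fun i : Fin (n+1) => g^[i] v)) := by
    by_contra hc
    exact hnli ⟨hli, hc⟩
  obtain ⟨c, hc⟩ := (Submodule.mem_span_range_iff_exists_fun k).1 hmem
  refine ⟨n, fun i => if h : i < n + 1 then c ⟨i, h⟩ else 0, ?_, hli⟩
  rw [Finset.sum_range, ← hc]
  refine Finset.sum_congr rfl fun i _ => ?_
  beta_reduce
  rw [dif_pos i.2]

/-- Lemma A. -/
lemma frob_sub_one_surj {k : Type*} [Field k] [IsAlgClosed k] (p : ℕ) [Fact p.Prime] [CharP k p]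
    {V : Type*} [AddCommGroup V] [Module k V] [FiniteDimensional k V]
    (f : V →ₛₗ[frobenius k p] V) (W : Submodule k V) (hW : ∀ x ∈ W, f x ∈ W) (v : V)
    (hv : v ∈ W) : ∃ y ∈ W, f y = y + v := by
  by_cases h0 : v = 0
  · exact ⟨0, W.zero_mem, by simp [h0]⟩
  obtain ⟨n, a, hrel, -⟩ := zrel (k := k) f v h0
  obtain ⟨t, ht⟩ := zpoly_root p a (-1) n
  refine ⟨_, ?_, (zsolve p f v a (-1) n hrel t ht).trans (by simp)⟩
  refine W.sum_mem fun i _ => W.smul_mem _ ?_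
  induction i with
  | zero => simpa using hv
  | succ i ih => rw [Function.iterate_succ_apply']; exact hW _ (ih (by simp_all; omega))

lemma frob_fixed_ne {k : Type*} [Field k] [IsAlgClosed k] (p : ℕ) [Fact p.Prime] [CharP k p]
    {V : Type*} [AddCommGroup V] [Module k V] [FiniteDimensional k V]
    (f : V →ₛₗ[frobenius k p] V) (hf : ∀ x, f x = 0 → x = 0) (v : V)
    (hv : v ≠ 0) : ∃ y, y ≠ 0 ∧ f y = y := by
  obtain ⟨n, a, hrel, hli⟩ := zrel (k := k) f v hv
  have hit : ∀ m, f^[m] v ≠ 0 := by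
    intro m
    induction m with
    | zero => simpa using hv
    | succ m ih => rw [Function.iterate_succ_apply']; exact fun h => ih (hf _ h)
  have ha : ∃ j ≤ n, a j ≠ 0 := by
    by_contra! hc
    apply hit (n+1)
    rw [hrel]
    refine Finset.sum_eq_zero fun i hi => ?_
    rw [hc i (by simp at hi; omega), zero_smul]
  obtain ⟨t, ht0, ht⟩ := zpoly_root_ne p a n ha
  refine ⟨_, ?_, (zsolve p f v a 0 n hrel t ht).trans (by simp)⟩
  intro h
  rw [Finset.sum_range] at h
  have := Fintype.linearIndependent_iff.1 hli _ h (Fin.last n)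
  simp [ht] at this
  exact ht0 this

/-- Lemma B. -/
lemma frob_span_fixed {k : Type*} [Field k] [IsAlgClosed k] (p : ℕ) [Fact p.Prime] [CharP k p]
    {V : Type*} [AddCommGroup V] [Module k V] [FiniteDimensional k V]
    (f : V →ₛₗ[frobenius k p] V) (hf : ∀ x, f x = 0 → x = 0) :
    Submodule.span k {v | f v = v} = ⊤ := by
  set W := Submodule.span k {v | f v = v} with hWdef
  have h1 : W ≤ W.comap f := by
    rw [hWdef, Submodule.span_le]
    intro x hx
    have hx' : f x = x := hx
    simp only [Submodule.comap_coe, Set.mem_preimage, SetLike.mem_coe, hx']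
    exact Submodule.subset_span hx
  have h2 : W ≤ W.map f := by
    conv_lhs => rw [hWdef]
    rw [Submodule.span_le]
    intro x hx
    exact ⟨x, Submodule.subset_span hx, hx⟩
  by_contra hne
  obtain ⟨v, hv⟩ : ∃ v, v ∉ W := by
    by_contra! hc
    exact hne (eq_top_iff.2 fun x _ => hc x)
  obtain ⟨y, hy0, hy⟩ := frob_fixed_ne p (W.mapQ W f h1) (by
    intro x hx
    obtain ⟨x, rfl⟩ := W.mkQ_surjective x
    simp only [Submodule.mkQ_apply, Submodule.mapQ_apply, Submodule.Quotient.mk_eq_zero] at hx ⊢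
    obtain ⟨w, hw, hwx⟩ := h2 hx
    have : w - x = 0 := hf _ (by rw [map_sub, hwx, sub_self])
    rwa [← sub_eq_zero.1 this]) (W.mkQ v) (by simpa using hv)
  obtain ⟨x, rfl⟩ := W.mkQ_surjective y
  simp only [Submodule.mkQ_apply, Submodule.mapQ_apply, Submodule.Quotient.mk_eq_zero, ne_eq] at hy hy0
  rw [Submodule.Quotient.eq] at hy
  obtain ⟨z, hz, hz'⟩ := frob_sub_one_surj p f W h1 _ hy
  apply hy0
  have : x - z ∈ W := Submodule.subset_span (by
    change f (x - z) = x - z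
    rw [map_sub, hz']; abel)
  simpa using W.add_mem this hz

/-- Lemma C. -/
lemma frob_fixed_basis {k : Type*} [Field k] [IsAlgClosed k] (p : ℕ) [Fact p.Prime] [CharP k p]
    {V : Type*} [AddCommGroup V] [Module k V] [FiniteDimensional k V]
    (f : V →ₛₗ[frobenius k p] V) (P : Submodule k V) (hP : ∀ x ∈ P, f x ∈ P)
    (hinj : ∀ x, f x ∈ P → x ∈ P) :
    ∃ (e : Fin (Module.finrank k (V ⧸ P)) → V) (b : Module.Basis (Fin (Module.finrank k (V ⧸ P))) k (V ⧸ P)),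
      (∀ i, f (e i) = e i) ∧ ∀ i, b i = P.mkQ (e i) := by
  have hB := frob_span_fixed p (P.mapQ P f hP) (by
    intro x hx
    obtain ⟨x, rfl⟩ := P.mkQ_surjective x
    simp only [Submodule.mkQ_apply, Submodule.mapQ_apply, Submodule.Quotient.mk_eq_zero] at hx ⊢
    exact hinj x hx)
  let b0 := Module.Basis.ofSpan hB.ge
  have hb0 : ∀ i, P.mapQ P f hP (b0 i) = b0 i := by
    intro i
    have := Module.Basis.ofSpan_subset hB.ge (Set.mem_range_self i)
    exact this
  have : Fintype _ := FiniteDimensional.fintypeBasisIndex b0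
  let b := b0.reindex (Fintype.equivFinOfCardEq (Module.finrank_eq_card_basis b0).symm)
  have hb : ∀ i, P.mapQ P f hP (b i) = b i := by
    intro i
    simp only [b, Module.Basis.reindex_apply]
    exact hb0 _
  have hl : ∀ i, ∃ e, f e = e ∧ b i = P.mkQ e := by
    intro i
    have := hb i
    obtain ⟨x, hx⟩ := P.mkQ_surjective (b i)
    rw [← hx] at this ⊢
    simp only [Submodule.mkQ_apply, Submodule.mapQ_apply] at this
    rw [Submodule.Quotient.eq] at this
    obtain ⟨z, hz, hz'⟩ := frob_sub_one_surj p f P hP _ this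
    refine ⟨x - z, by rw [map_sub, hz']; abel, ?_⟩
    rw [map_sub, (by simpa using hz : P.mkQ z = 0), sub_zero]
  choose e he using hl
  exact ⟨e, b, fun i => (he i).1, fun i => (he i).2⟩

/-- Lemma D: the normal form of a zip compatible with `I`. -/
lemma zip_normal_form
    {k : Type*} [Field k] (p : ℕ) [Fact p.Prime] [CharP k p] [IsAlgClosed k]
    {H : Type*} [AddCommGroup H] [Module k H] [FiniteDimensional k H]
    (ω : H →ₗ[k] H →ₗ[k] k)
    (halt : ∀ x, ω x x = 0)
    (hnd : ∀ x, (∀ y, ω x y = 0) → x = 0)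
    (I : Submodule k H) (hiso : I ≤ perp ω I)
    (ω' : (perp ω I ⧸ I.comap (perp ω I).subtype) →ₗ[k]
        (perp ω I ⧸ I.comap (perp ω I).subtype) →ₗ[k] k)
    (hω' : ∀ x y : perp ω I,
        ω' (Submodule.Quotient.mk x) (Submodule.Quotient.mk y) = ω (x : H) (y : H))
    (φ : H →ₛₗ[frobenius k p] H)
    (hφrange : IsLagrangian ω (LinearMap.range φ))
    (hφI : ∀ x ∈ I, φ x = 0)
    (hφP : ∀ x ∈ perp ω I, φ x ∈ perp ω I)
    (hφinj : ∀ x : H, φ x ∈ perp ω I → x ∈ perp ω I)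
    (φ' : (perp ω I ⧸ I.comap (perp ω I).subtype) →
        (perp ω I ⧸ I.comap (perp ω I).subtype))
    (hφ' : ∀ (x : perp ω I) (hx : φ (x : H) ∈ perp ω I),
        φ' (Submodule.Quotient.mk x) =
          Submodule.Quotient.mk (⟨φ (x : H), hx⟩ : perp ω I)) :
    ∃ Θ : ((Fin (Module.finrank k (H ⧸ perp ω I)) → k) ×
        (Fin (Module.finrank k (H ⧸ perp ω I)) → k) ×
        (perp ω I ⧸ I.comap (perp ω I).subtype)) ≃ₗ[k] H,
      (∀ u v, ω (Θ u) (Θ v) = ∑ i, u.2.1 i * v.1 i - ∑ i, u.1 i * v.2.1 i + ω' u.2.2 v.2.2) ∧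
      ∀ u, φ (Θ u) = Θ (fun i => u.1 i ^ p, 0, φ' u.2.2) := by
  classical
  have hskew : ∀ x y, ω x y = - ω y x := by
    intro x y
    have := halt (x + y)
    simp only [map_add, LinearMap.add_apply, halt, zero_add, add_zero] at this
    exact eq_neg_of_add_eq_zero_right this
  have hLL : ∀ x y, ω (φ x) (φ y) = 0 := by
    intro x y
    have : φ x ∈ perp ω (LinearMap.range φ) := by
      rw [hφrange]; exact ⟨x, rfl⟩
    exact this _ ⟨y, rfl⟩
  obtain ⟨e, b, he, hb⟩ := frob_fixed_basis p φ (perp ω I) hφP hφinj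
  have hnondeg : LinearMap.BilinForm.Nondegenerate ω := by
    refine ⟨fun x hx => hnd x hx, fun x hx => hnd x fun y => ?_⟩
    rw [hskew, hx, neg_zero]
  have hrefl : LinearMap.BilinForm.IsRefl ω := by
    intro x y h
    rw [hskew, h, neg_zero]
  have hperp : ∀ x, (∀ y ∈ perp ω I, ω x y = 0) → x ∈ I := by
    intro x hx
    have h := LinearMap.BilinForm.orthogonal_orthogonal hnondeg hrefl I
    rw [← h]
    intro y hy
    apply hrefl
    apply hx
    intro z hz
    exact hrefl _ _ (hy z hz)
  -- dual vectors
  let f : Fin (Module.finrank k (H ⧸ perp ω I)) → H := fun i =>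
    (LinearMap.BilinForm.toDual ω hnondeg).symm ((b.coord i) ∘ₗ (perp ω I).mkQ)
  have hf : ∀ i x, ω (f i) x = b.coord i ((perp ω I).mkQ x) := by
    intro i x
    exact LinearMap.BilinForm.apply_toDual_symm_apply (B := ω) (hB := hnondeg)
      ((b.coord i) ∘ₗ (perp ω I).mkQ) x
  have hfP : ∀ i, ∀ x ∈ perp ω I, ω (f i) x = 0 := by
    intro i x hx
    rw [hf, (by simpa using hx : (perp ω I).mkQ x = 0), map_zero]
  have hfI : ∀ i, f i ∈ I := fun i => hperp _ (hfP i)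
  have hfe : ∀ i j, ω (f i) (e j) = if i = j then 1 else 0 := by
    intro i j
    rw [hf, ← hb, Module.Basis.coord_apply, Module.Basis.repr_self, Finsupp.single_apply]
    simp only [eq_comm]
  have hee : ∀ i j, ω (e i) (e j) = 0 := by
    intro i j
    rw [← he i, ← he j]; exact hLL _ _
  have hff : ∀ i j, ω (f i) (f j) = 0 := fun i j => hfP i _ (hiso (hfI j))
  have hdec : ∀ x : H, x - ∑ i, b.repr ((perp ω I).mkQ x) i • e i ∈ perp ω I := by
    intro x
    rw [← Submodule.Quotient.mk_eq_zero, ← Submodule.mkQ_apply, map_sub, map_sum]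
    simp only [map_smul, ← hb]
    rw [b.sum_repr, sub_self]
  have hIz : ∀ x ∈ I, (∀ i, ω x (e i) = 0) → x = 0 := by
    intro x hx h
    apply hnd
    intro y
    have h1 := hiso hx
    have h2 : ω x (y - ∑ i, b.repr ((perp ω I).mkQ y) i • e i) = 0 := by
      rw [hskew, hdec y x hx, neg_zero]
    rw [map_sub, map_sum] at h2
    simpa [h] using h2
  -- the section
  let q : H →ₗ[k] H := LinearMap.id - ∑ i, (ω.flip (e i)).smulRight (f i)
  have hq : ∀ x, q x = x - ∑ i, ω x (e i) • f i := by
    intro x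
    simp [q, LinearMap.sum_apply]
  have hqe : ∀ x j, ω (q x) (e j) = 0 := by
    intro x j
    rw [hq]
    simp [LinearMap.sum_apply, hfe]
  let s : (perp ω I ⧸ I.comap (perp ω I).subtype) →ₗ[k] H :=
    (I.comap (perp ω I).subtype).liftQ (q ∘ₗ (perp ω I).subtype) (by
      intro x hx
      rw [LinearMap.mem_ker]
      refine hIz _ ?_ (fun i => hqe _ i)
      simp only [LinearMap.comp_apply]
      rw [hq]
      exact I.sub_mem hx (I.sum_mem fun i _ => I.smul_mem _ (hfI i)))
  have hs : ∀ x : perp ω I, s (Submodule.Quotient.mk x) = q x := fun x => rfl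
  have hsP : ∀ z, s z ∈ perp ω I := by
    intro z
    obtain ⟨x, rfl⟩ := Submodule.Quotient.mk_surjective _ z
    rw [hs, hq]
    exact Submodule.sub_mem _ x.2 (hiso (I.sum_mem fun i _ => I.smul_mem _ (hfI i)))
  have hsmk : ∀ z, Submodule.Quotient.mk (⟨s z, hsP z⟩ : perp ω I) = z := by
    intro z
    obtain ⟨x, rfl⟩ := Submodule.Quotient.mk_surjective _ z
    rw [Submodule.Quotient.eq]
    change s (Submodule.Quotient.mk x) - (x : H) ∈ I
    rw [hs, hq, sub_sub_cancel_left]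
    exact I.neg_mem (I.sum_mem fun i _ => I.smul_mem _ (hfI i))
  have hse : ∀ z j, ω (s z) (e j) = 0 := by
    intro z j
    obtain ⟨x, rfl⟩ := Submodule.Quotient.mk_surjective _ z
    exact hqe _ _
  have hes : ∀ z j, ω (e j) (s z) = 0 := fun z j => hrefl _ _ (hse z j)
  have hfs : ∀ z j, ω (f j) (s z) = 0 := fun z j => hfP j _ (hsP z)
  have hsf : ∀ z j, ω (s z) (f j) = 0 := fun z j => hrefl _ _ (hfs z j)
  have hef : ∀ i j, ω (e i) (f j) = - if i = j then 1 else 0 := by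
    intro i j
    rw [hskew, hfe]; simp only [eq_comm]
  have hss : ∀ z w, ω (s z) (s w) = ω' z w := by
    intro z w
    rw [← hω' ⟨s z, hsP z⟩ ⟨s w, hsP w⟩, hsmk, hsmk]
  have hφs : ∀ z, φ (s z) = s (φ' z) := by
    intro z
    have h1 := hφ' ⟨s z, hsP z⟩ (hφP _ (hsP z))
    rw [hsmk] at h1
    rw [h1, hs, hq]
    simp only
    rw [Finset.sum_eq_zero, sub_zero]
    intro i _
    rw [← he i, hLL, zero_smul]
  let T : ((Fin (Module.finrank k (H ⧸ perp ω I)) → k) ×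
        (Fin (Module.finrank k (H ⧸ perp ω I)) → k) ×
        (perp ω I ⧸ I.comap (perp ω I).subtype)) →ₗ[k] H :=
    (Fintype.linearCombination k e).coprod ((Fintype.linearCombination k f).coprod s)
  have hT : ∀ u, T u = ∑ i, u.1 i • e i + (∑ i, u.2.1 i • f i + s u.2.2) := by
    intro u
    simp [T, Fintype.linearCombination_apply]
  have hform : ∀ u v, ω (T u) (T v) =
      ∑ i, u.2.1 i * v.1 i - ∑ i, u.1 i * v.2.1 i + ω' u.2.2 v.2.2 := by
    intro u v
    rw [hT, hT]
    simp [LinearMap.sum_apply, hee, hff, hef, hfe, hse, hes, hfs, hsf, hss]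
    ring
  have hinj : Function.Injective T := by
    rw [← LinearMap.ker_eq_bot, LinearMap.ker_eq_bot']
    rintro ⟨a, c, z⟩ h0
    have hc : c = 0 := by
      funext j
      have h1 := hform (a, c, z) (Pi.single j 1, 0, 0)
      rw [h0] at h1
      simpa [Pi.single_apply] using h1.symm
    have ha : a = 0 := by
      funext j
      have h1 := hform (a, c, z) (0, Pi.single j 1, 0)
      rw [h0] at h1
      simpa [Pi.single_apply] using h1.symm
    subst hc ha
    rw [hT] at h0
    have hz : s z = 0 := by simpa using h0
    have := hsmk z
    have h3 : (⟨s z, hsP z⟩ : perp ω I) = 0 := Subtype.ext hz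
    rw [h3, Submodule.Quotient.mk_zero] at this
    rw [← this]; rfl
  have hsurj : Function.Surjective T := by
    intro x
    have hx := hdec x
    refine ⟨(fun i => b.repr ((perp ω I).mkQ x) i, 
      fun i => ω (x - ∑ i, b.repr ((perp ω I).mkQ x) i • e i) (e i),
      Submodule.Quotient.mk ⟨_, hx⟩), ?_⟩
    rw [hT]
    simp only [hs, hq]
    abel
  refine ⟨LinearEquiv.ofBijective T ⟨hinj, hsurj⟩, hform, ?_⟩
  intro u
  change φ (T u) = T _
  rw [hT, hT]
  simp [map_sum, map_smulₛₗ, he, hφI _ (hfI _), hφs, frobenius_def]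

theorem zip_conjugate_of_induced_conjugate
    {k : Type*} [Field k] (p : ℕ) [Fact p.Prime] [CharP k p] [IsAlgClosed k]
    {H : Type*} [AddCommGroup H] [Module k H] [FiniteDimensional k H]
    (ω : H →ₗ[k] H →ₗ[k] k)
    (halt : ∀ x, ω x x = 0)
    (hnd : ∀ x, (∀ y, ω x y = 0) → x = 0)
    (I : Submodule k H) (hiso : I ≤ perp ω I)
    -- the induced form `ω'` on `H' = I^⊥ / I`:
    (ω' : (perp ω I ⧸ I.comap (perp ω I).subtype) →ₗ[k]
        (perp ω I ⧸ I.comap (perp ω I).subtype) →ₗ[k] k)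
    (hω' : ∀ x y : perp ω I,
        ω' (Submodule.Quotient.mk x) (Submodule.Quotient.mk y) = ω (x : H) (y : H))
    -- `φ` is a symplectic zip on `H` compatible with `I`:
    (φ : H →ₛₗ[frobenius k p] H)
    (hφker : IsLagrangian ω (LinearMap.ker φ))
    (hφrange : IsLagrangian ω (LinearMap.range φ))
    (hφI : ∀ x ∈ I, φ x = 0)
    (hφP : ∀ x ∈ perp ω I, φ x ∈ perp ω I)
    (hφinj : ∀ x : H, φ x ∈ perp ω I → x ∈ perp ω I)
    (hφsurj : ∀ y : H, ∃ x : H, y - φ x ∈ perp ω I)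
    -- `ψ` is a symplectic zip on `H` compatible with `I`:
    (ψ : H →ₛₗ[frobenius k p] H)
    (hψker : IsLagrangian ω (LinearMap.ker ψ))
    (hψrange : IsLagrangian ω (LinearMap.range ψ))
    (hψI : ∀ x ∈ I, ψ x = 0)
    (hψP : ∀ x ∈ perp ω I, ψ x ∈ perp ω I)
    (hψinj : ∀ x : H, ψ x ∈ perp ω I → x ∈ perp ω I)
    (hψsurj : ∀ y : H, ∃ x : H, y - ψ x ∈ perp ω I)
    -- the induced zips `φ'` and `ψ'` on `H' = I^⊥ / I`:
    (φ' : (perp ω I ⧸ I.comap (perp ω I).subtype) →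
        (perp ω I ⧸ I.comap (perp ω I).subtype))
    (hφ' : ∀ (x : perp ω I) (hx : φ (x : H) ∈ perp ω I),
        φ' (Submodule.Quotient.mk x) =
          Submodule.Quotient.mk (⟨φ (x : H), hx⟩ : perp ω I))
    (ψ' : (perp ω I ⧸ I.comap (perp ω I).subtype) →
        (perp ω I ⧸ I.comap (perp ω I).subtype))
    (hψ' : ∀ (x : perp ω I) (hx : ψ (x : H) ∈ perp ω I),
        ψ' (Submodule.Quotient.mk x) =
          Submodule.Quotient.mk (⟨ψ (x : H), hx⟩ : perp ω I)) :
    (∃ σ : (perp ω I ⧸ I.comap (perp ω I).subtype) ≃ₗ[k]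
        (perp ω I ⧸ I.comap (perp ω I).subtype),
      (∀ z w, ω' (σ z) (σ w) = ω' z w) ∧ ∀ z, ψ' z = σ (φ' (σ.symm z))) →
    ∃ τ : H ≃ₗ[k] H, (∀ x y, ω (τ x) (τ y) = ω x y) ∧ ∀ x : H, ψ x = τ (φ (τ.symm x)) := by
  rintro ⟨σ, hσ, hσφ⟩
  obtain ⟨A, hA, hAφ⟩ := zip_normal_form p ω halt hnd I hiso ω' hω' φ hφrange hφI hφP hφinj φ' hφ'
  obtain ⟨B, hB, hBψ⟩ := zip_normal_form p ω halt hnd I hiso ω' hω' ψ hψrange hψI hψP hψinj ψ' hψ'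
  let S := (LinearEquiv.refl k (Fin (Module.finrank k (H ⧸ perp ω I)) → k)).prodCongr
    ((LinearEquiv.refl k (Fin (Module.finrank k (H ⧸ perp ω I)) → k)).prodCongr σ)
  have hS : ∀ u, S u = (u.1, u.2.1, σ u.2.2) := fun u => rfl
  refine ⟨A.symm.trans (S.trans B), ?_, ?_⟩
  · intro x y
    obtain ⟨u, rfl⟩ := A.surjective x
    obtain ⟨v, rfl⟩ := A.surjective y
    simp only [LinearEquiv.trans_apply, LinearEquiv.symm_apply_apply, hA, hB, hS, hσ]
  · intro x
    obtain ⟨v, rfl⟩ := B.surjective x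
    obtain ⟨u, rfl⟩ := S.surjective v
    have h1 : (A.symm.trans (S.trans B)).symm (B (S u)) = A u := by
      rw [LinearEquiv.symm_apply_eq]
      simp
    rw [h1, hAφ, hBψ]
    simp only [LinearEquiv.trans_apply, LinearEquiv.symm_apply_apply, hS, hσφ]
end
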